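/- For every tilde-epsilon > 0 and q > 1 there exists an axisymmetric function omega_0 in C^infty(R^3 \ {0}; R) with compact support such that ||omega_0||_{L^infty(R^3)} + ||omega_0||_{L^1(R^3)} + ||omega_0/r||_{L^{3,q}(R^3)} <= tilde-epsilon, and such that for every T > 0 there exists no Yudovich-type weak solution (u, omega) of the axisymmetric relative-vorticity equation on (0,T) with initial data omega_0. -/

import Mathlib

noncomputable section

open MeasureTheory Real Set Filter
open scoped ENNReal

/-- Euclidean three-space. -/
abbrev E3 : Type := EuclideanSpace ℝ (Fin 3)

/-- Distance from `x` to the vertical (third-coordinate) axis. -/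
def rc (x : E3) : ℝ := Real.sqrt (x 0 ^ 2 + x 1 ^ 2)

/-- Vertical coordinate of `x`. -/
def zc (x : E3) : ℝ := x 2

/-- The point of `ℝ³` with coordinates `(a, b, c)`. -/
def mk3 (a b c : ℝ) : E3 := (WithLp.equiv 2 (Fin 3 → ℝ)).symm ![a, b, c]

/-- The radial unit vector `e_r(x)` (equal to `0` on the axis). -/
def eR (x : E3) : E3 := mk3 (x 0 / rc x) (x 1 / rc x) 0

/-- The azimuthal unit vector `e_θ(x)` (equal to `0` on the axis). -/
def eTheta (x : E3) : E3 := mk3 (-(x 1) / rc x) (x 0 / rc x) 0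

/-- The vertical unit vector `e_z`. -/
def eZ : E3 := mk3 0 0 1

/-- A function on `ℝ³` is axisymmetric if it depends only on `(r_x, z_x)`. -/
def Axisym (f : E3 → ℝ) : Prop :=
  ∀ x y : E3, rc x = rc y → zc x = zc y → f x = f y

/-- `cos(θ_x - θ_y)` for the angular variables of `x` and `y`. -/
def cosDiff (x y : E3) : ℝ := (x 0 * y 0 + x 1 * y 1) / (rc x * rc y)

/-- The radial component of the axisymmetric Biot–Savart velocity. -/
def ur (ω : E3 → ℝ) (x : E3) : ℝ :=
  (1 / (4 * π)) * ∫ y : E3, (zc x - zc y) * cosDiff x y * (‖x - y‖ ^ (-(3 : ℝ))) * ω y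

/-- The vertical component of the axisymmetric Biot–Savart velocity. -/
def uz (ω : E3 → ℝ) (x : E3) : ℝ :=
  -(1 / (4 * π)) * ∫ y : E3, (rc x * cosDiff x y - rc y) * (‖x - y‖ ^ (-(3 : ℝ))) * ω y

/-- Partial derivative in the `i`-th coordinate direction. -/
def pderiv3 (i : Fin 3) (f : E3 → ℝ) (x : E3) : ℝ :=
  fderiv ℝ f x (EuclideanSpace.single i 1)

/-- Curl of a vector field on `ℝ³`. -/
def curl3 (V : E3 → E3) (x : E3) : E3 :=
  mk3 (pderiv3 1 (fun y => V y 2) x - pderiv3 2 (fun y => V y 1) x)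
      (pderiv3 2 (fun y => V y 0) x - pderiv3 0 (fun y => V y 2) x)
      (pderiv3 0 (fun y => V y 1) x - pderiv3 1 (fun y => V y 0) x)

/-- The Lorentz `L^{3,q}` quasinorm, via the layer-cake formula
`‖f‖_{L^{3,q}}^q = 3 ∫_0^∞ λ^{q-1} (vol {|f| > λ})^{q/3} dλ`. -/
def lorentz3q (q : ℝ) (f : E3 → ℝ) : ℝ≥0∞ :=
  (3 * ∫⁻ l in Ioi (0 : ℝ),
      ENNReal.ofReal (l ^ (q - 1)) * (volume {x : E3 | l < |f x|}) ^ (q / 3)) ^ (1 / q)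

/-- A distributional solution of the axisymmetric relative-vorticity equation on `(0,T)`
with initial data `ω₀` (Definition 1.5 in the paper). -/
structure IsDistSolution (T : ℝ) (ω₀ : E3 → ℝ) (u : E3 → ℝ → E3) (ω : E3 → ℝ → ℝ) :
    Prop where
  /-- `u ∈ L¹_loc((0,T) × ℝ³)`. -/
  u_loc : LocallyIntegrableOn (fun p : E3 × ℝ => u p.1 p.2)
    ((univ : Set E3) ×ˢ Ioo 0 T) volume
  /-- `ω/r ∈ L¹_loc([0,T) × ℝ³)`. -/
  relvort_loc : LocallyIntegrableOn (fun p : E3 × ℝ => ω p.1 p.2 / rc p.1)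
    ((univ : Set E3) ×ˢ Ico 0 T) volume
  /-- `u (ω/r) ∈ L¹_loc([0,T) × ℝ³)`. -/
  u_relvort_loc : LocallyIntegrableOn (fun p : E3 × ℝ => (ω p.1 p.2 / rc p.1) • u p.1 p.2)
    ((univ : Set E3) ×ˢ Ico 0 T) volume
  /-- `u` is axisymmetric without swirl. -/
  no_swirl : ∃ Ur Uz : ℝ → ℝ → ℝ → ℝ, ∀ (x : E3) (t : ℝ),
    u x t = Ur (rc x) (zc x) t • eR x + Uz (rc x) (zc x) t • eZ
  /-- `div u = 0` in the sense of distributions on `(0,T) × ℝ³`. -/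
  div_free : ∀ φ : E3 × ℝ → ℝ, ContDiff ℝ (⊤ : ℕ∞) φ → HasCompactSupport φ →
    tsupport φ ⊆ (univ : Set E3) ×ˢ Ioo 0 T →
    (∫ p : E3 × ℝ in (univ : Set E3) ×ˢ Ioo 0 T,
        fderiv ℝ (fun y => φ (y, p.2)) p.1 (u p.1 p.2)) = 0
  /-- `curl u = ω e_θ` in the sense of distributions on `(0,T) × ℝ³`. -/
  curl_eq : ∀ Φ : E3 × ℝ → E3, ContDiff ℝ (⊤ : ℕ∞) Φ → HasCompactSupport Φ →
    tsupport Φ ⊆ (univ : Set E3) ×ˢ Ioo 0 T →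
    (∫ p : E3 × ℝ in (univ : Set E3) ×ˢ Ioo 0 T,
        ∑ i : Fin 3, u p.1 p.2 i * curl3 (fun y => Φ (y, p.2)) p.1 i)
      = ∫ p : E3 × ℝ in (univ : Set E3) ×ˢ Ioo 0 T,
          ω p.1 p.2 * ∑ i : Fin 3, eTheta p.1 i * Φ p i
  /-- The weak formulation of the transport of `ω/r`, for every
  `ψ ∈ C_c^∞(ℝ³ × [0,T))`. -/
  transport : ∀ ψ : E3 × ℝ → ℝ, ContDiff ℝ (⊤ : ℕ∞) ψ → HasCompactSupport ψ →
    tsupport ψ ⊆ (univ : Set E3) ×ˢ Iio T →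
    (∫ p : E3 × ℝ in (univ : Set E3) ×ˢ Ioo 0 T,
        (ω p.1 p.2 / rc p.1) *
          (deriv (fun s => ψ (p.1, s)) p.2 +
            fderiv ℝ (fun y => ψ (y, p.2)) p.1 (u p.1 p.2)))
      + (∫ x : E3, (ω₀ x / rc x) * ψ (x, 0)) = 0

/-- A Yudovich-type weak solution: a distributional solution with
`ω ∈ L^∞(0,T; L^∞ ∩ L¹)` whose velocity is given by the axisymmetric Biot–Savart law. -/
structure IsYudovichSolution (T : ℝ) (ω₀ : E3 → ℝ) (u : E3 → ℝ → E3) (ω : E3 → ℝ → ℝ)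
    extends IsDistSolution T ω₀ u ω : Prop where
  /-- `ω ∈ L^∞(0,T; L^∞(ℝ³) ∩ L¹(ℝ³))`. -/
  bounded : ∃ M : ℝ, ∀ᵐ t ∂(volume.restrict (Ioo 0 T)),
    eLpNorm (fun x => ω x t) ∞ volume ≤ ENNReal.ofReal M ∧
    eLpNorm (fun x => ω x t) 1 volume ≤ ENNReal.ofReal M
  /-- `u` is given from `ω` via the axisymmetric Biot–Savart law. -/
  biot_savart : ∀ᵐ t ∂(volume.restrict (Ioo 0 T)), ∀ x : E3,
    u x t = ur (fun y => ω y t) x • eR x + uz (fun y => ω y t) x • eZ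

local notation "CD" => ContDiff ℝ (⊤ : ℕ∞)
lemma mll {a b c : ℝ} (h : b ≤ c) (ha : 0 ≤ a) : a * b ≤ a * c := mul_le_mul_of_nonneg_left h ha
lemma mlr {a b c : ℝ} (h : b ≤ c) (ha : 0 ≤ a) : b * a ≤ c * a := mul_le_mul_of_nonneg_right h ha

def κ3 : ℝ := 3 * volume.real (Metric.ball (0 : E3) 1)

lemma κ3_nonneg : 0 ≤ κ3 := by unfold κ3; positivity

lemma radial_int (f : ℝ → ℝ) :
    ∫ x : E3, f ‖x‖ = κ3 * ∫ y in Ioi (0 : ℝ), y ^ 2 * f y := by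
  rw [integral_fun_norm_addHaar volume f]; simp [κ3, mul_assoc]

lemma radial_intble (f : ℝ → ℝ) (h : IntegrableOn (fun y : ℝ => y ^ 2 * f y) (Ioi 0)) :
    Integrable (fun x : E3 => f ‖x‖) := by
  rw [integrable_fun_norm_addHaar volume (f := f)]; simpa using h

def q2 (s : ℝ) (v : E3) : ℝ := if ‖v‖ ≤ s then (‖v‖ ^ 2)⁻¹ else 0
def q3 (a : ℝ) (v : E3) : ℝ := if a ≤ ‖v‖ ∧ ‖v‖ ≤ 1 then (‖v‖ ^ 3)⁻¹ else 0
def q4 (a : ℝ) (v : E3) : ℝ := if a ≤ ‖v‖ then (‖v‖ ^ 4)⁻¹ else 0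
def q0 (s : ℝ) (v : E3) : ℝ := if ‖v‖ ≤ s then 1 else 0

lemma q2_nonneg (s : ℝ) (v : E3) : 0 ≤ q2 s v := by unfold q2; split_ifs <;> positivity
lemma q3_nonneg (s : ℝ) (v : E3) : 0 ≤ q3 s v := by unfold q3; split_ifs <;> positivity
lemma q4_nonneg (s : ℝ) (v : E3) : 0 ≤ q4 s v := by unfold q4; split_ifs <;> positivity
lemma q0_nonneg (s : ℝ) (v : E3) : 0 ≤ q0 s v := by unfold q0; split_ifs <;> positivity

lemma q2_int {s : ℝ} (hs : 0 ≤ s) : Integrable (q2 s) ∧ ∫ v, q2 s v = κ3 * s := by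
  have e : ∀ y ∈ Ioi (0:ℝ), (Iic s).indicator (fun _ => (1:ℝ)) y =
      y ^ 2 * (fun t : ℝ => if t ≤ s then (t ^ 2)⁻¹ else 0) y := by
    intro y hy; have hy : (0:ℝ) < y := hy
    by_cases h : y ≤ s
    · simp [h]; field_simp
    · simp [h]
  have hi : IntegrableOn ((Iic s).indicator (fun _ => (1:ℝ))) (Ioi 0) := by
    rw [IntegrableOn, integrable_indicator_iff measurableSet_Iic, IntegrableOn,
      Measure.restrict_restrict measurableSet_Iic, Iic_inter_Ioi]
    simp
  constructor
  · exact radial_intble (fun t : ℝ => if t ≤ s then (t ^ 2)⁻¹ else 0)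
      (hi.congr_fun e measurableSet_Ioi)
  · have := radial_int (fun t : ℝ => if t ≤ s then (t ^ 2)⁻¹ else 0)
    unfold q2; rw [this, ← setIntegral_congr_fun measurableSet_Ioi e,
      setIntegral_indicator measurableSet_Iic, Ioi_inter_Iic]
    simp [hs]

lemma q0_int {s : ℝ} (hs : 0 ≤ s) : Integrable (q0 s) ∧ ∫ v, q0 s v ≤ κ3 * s ^ 3 := by
  have e : q0 s = (Metric.closedBall (0 : E3) s).indicator (fun _ => 1) := by
    ext v; simp [q0, indicator]
  have hf := (measure_closedBall_lt_top (μ := (volume : Measure E3)) (x := 0) (r := s)).ne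
  refine ⟨?_, ?_⟩
  · rw [e, integrable_indicator_iff Metric.isClosed_closedBall.measurableSet]; exact integrableOn_const hf
  · rw [e, integral_indicator Metric.isClosed_closedBall.measurableSet]
    simp only [integral_const, MeasurableSet.univ, measureReal_restrict_apply, univ_inter, smul_eq_mul, mul_one]
    rw [Measure.addHaar_real_closedBall volume 0 hs]; simp [κ3]; have : 0 ≤ s ^ 3 * volume.real (Metric.ball (0 : E3) 1) := by positivity
    linarith

lemma q3_int {a : ℝ} (ha : 0 < a) (ha1 : a ≤ 1) :
    Integrable (q3 a) ∧ ∫ v, q3 a v = κ3 * log (1 / a) := by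
  have e : ∀ y ∈ Ioi (0:ℝ), (Icc a 1).indicator (fun y => y⁻¹) y =
      y ^ 2 * (fun t : ℝ => if a ≤ t ∧ t ≤ 1 then (t ^ 3)⁻¹ else 0) y := by
    intro y hy; have hy : (0:ℝ) < y := hy
    by_cases h : a ≤ y ∧ y ≤ 1
    · simp [indicator, h]; field_simp
    · simp [indicator, h]
  have hc : ContinuousOn (fun y : ℝ => y⁻¹) (Icc a 1) :=
    continuousOn_id.inv₀ (fun x hx => (lt_of_lt_of_le ha hx.1).ne')
  have hi : IntegrableOn ((Icc a 1).indicator (fun y : ℝ => y⁻¹)) (Ioi 0) := by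
    apply Integrable.integrableOn; rw [integrable_indicator_iff measurableSet_Icc]; exact hc.integrableOn_Icc
  constructor
  · exact radial_intble (fun t : ℝ => if a ≤ t ∧ t ≤ 1 then (t ^ 3)⁻¹ else 0)
      (hi.congr_fun e measurableSet_Ioi)
  · have := radial_int (fun t : ℝ => if a ≤ t ∧ t ≤ 1 then (t ^ 3)⁻¹ else 0)
    unfold q3; rw [this, ← setIntegral_congr_fun measurableSet_Ioi e,
      setIntegral_indicator measurableSet_Icc,
      inter_eq_right.2 (show Icc a 1 ⊆ Ioi (0:ℝ) from fun x hx => lt_of_lt_of_le ha hx.1), integral_Icc_eq_integral_Ioc,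
      ← intervalIntegral.integral_of_le ha1, integral_inv_of_pos ha one_pos]

lemma q4_int {a : ℝ} (ha : 0 < a) : Integrable (q4 a) ∧ ∫ v, q4 a v = κ3 * a⁻¹ := by
  have e : ∀ y ∈ Ioi (0:ℝ), (Ici a).indicator (fun y => y ^ (-2 : ℝ)) y =
      y ^ 2 * (fun t : ℝ => if a ≤ t then (t ^ 4)⁻¹ else 0) y := by
    intro y hy; have hy : (0:ℝ) < y := hy
    by_cases h : a ≤ y
    · simp only [mem_Ici, h, indicator_of_mem, if_true]; rw [rpow_neg hy.le]; norm_cast; field_simp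
    · simp [h]
  have hi : IntegrableOn ((Ici a).indicator (fun y : ℝ => y ^ (-2 : ℝ))) (Ioi 0) := by
    apply Integrable.integrableOn; rw [integrable_indicator_iff measurableSet_Ici, integrableOn_Ici_iff_integrableOn_Ioi]
    exact integrableOn_Ioi_rpow_of_lt (by norm_num) ha
  constructor
  · exact radial_intble (fun t : ℝ => if a ≤ t then (t ^ 4)⁻¹ else 0)
      (hi.congr_fun e measurableSet_Ioi)
  · have := radial_int (fun t : ℝ => if a ≤ t then (t ^ 4)⁻¹ else 0)
    unfold q4; rw [this, ← setIntegral_congr_fun measurableSet_Ioi e,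
      setIntegral_indicator measurableSet_Ici,
      inter_eq_right.2 (show Ici a ⊆ Ioi (0:ℝ) from fun x hx => lt_of_lt_of_le ha hx), integral_Ici_eq_integral_Ioi,
      integral_Ioi_rpow_of_lt (by norm_num) ha]
    norm_num
    left; exact rpow_neg_one a

/-- bounded and integrable vorticity -/
def VB (M : ℝ) (ω : E3 → ℝ) : Prop :=
  0 ≤ M ∧ Integrable ω ∧ (∀ᵐ y, |ω y| ≤ M) ∧ ∫ y, |ω y| ≤ M

lemma kb {M : ℝ} {ω k p : E3 → ℝ} {q : ℝ} (hω : VB M ω) (hk : AEStronglyMeasurable k)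
    (hp : Integrable p) (hp0 : ∀ y, 0 ≤ p y) (hq : 0 ≤ q) (hb : ∀ᵐ y, |k y| ≤ p y + q) :
    Integrable (fun y => k y * ω y) ∧ |∫ y, k y * ω y| ≤ M * (∫ y, p y) + q * M := by
  obtain ⟨hM, hi, hb', h1⟩ := hω; have hg : Integrable (fun y => M * p y + q * |ω y|) := (hp.const_mul M).add (hi.abs.const_mul q)
  have hle : ∀ᵐ y, ‖k y * ω y‖ ≤ M * p y + q * |ω y| := by
    filter_upwards [hb', hb] with y hy hyb
    rw [norm_mul, norm_eq_abs, norm_eq_abs]; have := hp0 y; have h0 := abs_nonneg (ω y); nlinarith [mlr hyb h0]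
  refine ⟨hg.mono' (hk.mul hi.1) hle, ?_⟩
  have := norm_integral_le_of_norm_le hg hle
  rw [integral_add (hp.const_mul M) (hi.abs.const_mul q), integral_const_mul,
    integral_const_mul] at this
  rw [norm_eq_abs] at this; nlinarith

structure Ker (l : E3 → E3 → ℝ) : Prop where
  lin : ∀ y v w, l y (v - w) = l y v - l y w
  bd : ∀ y v, |l y v| ≤ ‖v‖
  meas : Measurable (Function.uncurry l)

def KI (l : E3 → E3 → ℝ) (ω : E3 → ℝ) (x : E3) : ℝ :=
  ∫ y, (l y (x - y) * (‖x - y‖ ^ 3)⁻¹) * ω y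

lemma Ker.meask {l} (hl : Ker l) (x : E3) :
    Measurable (fun y => l y (x - y) * (‖x - y‖ ^ 3)⁻¹) := by
  have h1 : Measurable (fun y : E3 => (y, x - y)) := by fun_prop
  have := hl.meas.comp h1
  have h2 : Measurable (fun y : E3 => (‖x - y‖ ^ 3)⁻¹) := by fun_prop
  exact this.mul h2

lemma Ker.bd2 {l} (hl : Ker l) (y v : E3) : |l y v * (‖v‖ ^ 3)⁻¹| ≤ (‖v‖ ^ 2)⁻¹ := by
  rw [abs_mul, abs_of_nonneg (a := (‖v‖ ^ 3)⁻¹) (by positivity)]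
  rcases (norm_nonneg v).eq_or_lt with h | h
  · simp [← h]
  · calc _ ≤ ‖v‖ * (‖v‖ ^ 3)⁻¹ := by gcongr; exact hl.bd y v
      _ = _ := by field_simp

def IB (p : E3 → ℝ) (c : ℝ) : Prop := Integrable p ∧ (∀ y, 0 ≤ p y) ∧ ∫ y, p y ≤ c

lemma IB.add {p p' : E3 → ℝ} {c c' : ℝ} (h : IB p c) (h' : IB p' c') :
    IB (fun y => p y + p' y) (c + c') :=
  ⟨h.1.add h'.1, fun y => add_nonneg (h.2.1 y) (h'.2.1 y), by
    rw [integral_add h.1 h'.1]; linarith [h.2.2, h'.2.2]⟩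

lemma IB.smul {p : E3 → ℝ} {c t : ℝ} (h : IB p c) (ht : 0 ≤ t) :
    IB (fun y => t * p y) (t * c) :=
  ⟨h.1.const_mul t, fun y => mul_nonneg ht (h.2.1 y), by
    rw [integral_const_mul]; exact mll h.2.2 ht⟩

lemma IB.shift {p : E3 → ℝ} {c : ℝ} (h : IB p c) (x : E3) : IB (fun y => p (x - y)) c :=
  ⟨h.1.comp_sub_left x, fun y => h.2.1 _, by rw [integral_sub_left_eq_self p volume x]; exact h.2.2⟩

lemma q2_sub {s : ℝ} (hs : 0 ≤ s) (x : E3) : IB (fun y => q2 s (x - y)) (κ3 * s) :=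
  IB.shift ⟨(q2_int hs).1, q2_nonneg s, (q2_int hs).2.le⟩ x
lemma q3_sub {s : ℝ} (hs : 0 < s) (hs1 : s ≤ 1) (x : E3) :
    IB (fun y => q3 s (x - y)) (κ3 * log (1 / s)) :=
  IB.shift ⟨(q3_int hs hs1).1, q3_nonneg s, (q3_int hs hs1).2.le⟩ x
lemma q4_sub {s : ℝ} (hs : 0 < s) (x : E3) : IB (fun y => q4 s (x - y)) (κ3 * s⁻¹) :=
  IB.shift ⟨(q4_int hs).1, q4_nonneg s, (q4_int hs).2.le⟩ x
lemma q0_sub {s : ℝ} (hs : 0 ≤ s) (x : E3) : IB (fun y => q0 s (x - y)) (κ3 * s ^ 3) :=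
  IB.shift ⟨(q0_int hs).1, q0_nonneg s, (q0_int hs).2⟩ x

lemma kb' {M c : ℝ} {ω k p : E3 → ℝ} {q : ℝ} (hω : VB M ω) (hk : Measurable k)
    (hp : IB p c) (hq : 0 ≤ q) (hb : ∀ y, y ∉ {y : E3 | rc y = 0} → |k y| ≤ p y + q) (hr : ∀ᵐ y : E3, rc y ≠ 0):
    Integrable (fun y => k y * ω y) ∧ |∫ y, k y * ω y| ≤ M * (c + q) := by
  have := kb hω hk.aestronglyMeasurable hp.1 hp.2.1 hq (hr.mono fun y hy => hb y hy)
  refine ⟨this.1, this.2.trans ?_⟩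
  have := mll hp.2.2 hω.1
  linarith

lemma rc_ae : ∀ᵐ y : E3, rc y ≠ 0 := by
  have h : volume ((LinearMap.ker (EuclideanSpace.proj (0 : Fin 3) : E3 →L[ℝ] ℝ).toLinearMap : Submodule ℝ E3) : Set E3) = 0 := by
    apply Measure.addHaar_submodule; intro h; have : EuclideanSpace.single (0 : Fin 3) (1 : ℝ) ∈ (⊤ : Submodule ℝ E3) := trivial; rw [← h] at this
    simp at this
  rw [ae_iff]; refine measure_mono_null (fun y hy => ?_) h
  simp only [ne_eq, not_not, mem_setOf_eq, rc] at hy; rw [Real.sqrt_eq_zero (by positivity)] at hy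
  have : y 0 = 0 := by nlinarith [sq_nonneg (y 0), sq_nonneg (y 1)]
  simpa using this

lemma Ker.b1 {l} (hl : Ker l) {M : ℝ} {ω : E3 → ℝ} (hω : VB M ω) (x : E3) :
    Integrable (fun y => (l y (x - y) * (‖x - y‖ ^ 3)⁻¹) * ω y) ∧
    |KI l ω x| ≤ (κ3 + 1) * M := by
  have := kb' hω (hl.meask x) (q2_sub zero_le_one x) zero_le_one (fun y _ => (by
      refine (hl.bd2 y (x - y)).trans ?_
      unfold q2
      split_ifs with h
      · linarith
      · have : 1 ≤ ‖x - y‖ ^ 2 := one_le_pow₀ (not_le.1 h).le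
        simpa using inv_le_one_of_one_le₀ this)) rc_ae
  refine ⟨this.1, this.2.trans ?_⟩
  linarith

lemma real_far {a b d : ℝ} (ha : 0 < a) (hb : a ≤ 2 * b) (hd : |a - b| ≤ d) :
    b * |(a ^ 3)⁻¹ - (b ^ 3)⁻¹| ≤ 7 * d * (a ^ 3)⁻¹ := by
  have hb0 : 0 < b := by linarith
  have e : (a ^ 3)⁻¹ - (b ^ 3)⁻¹ = (b - a) * (a ^ 2 + a * b + b ^ 2) * ((a ^ 3)⁻¹ * (b ^ 3)⁻¹) := by
    field_simp; ring
  rw [e, abs_mul, abs_mul, abs_sub_comm b a, abs_of_pos (a := a ^ 2 + a * b + b ^ 2) (by positivity),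
    abs_of_pos (a := (a ^ 3)⁻¹ * (b ^ 3)⁻¹) (by positivity)]
  have h2 : a ^ 2 + a * b + b ^ 2 ≤ 7 * b ^ 2 := by nlinarith
  calc b * (|a - b| * (a ^ 2 + a * b + b ^ 2) * ((a ^ 3)⁻¹ * (b ^ 3)⁻¹))
      ≤ b * (d * (7 * b ^ 2) * ((a ^ 3)⁻¹ * (b ^ 3)⁻¹)) := by gcongr; exact (abs_nonneg _).trans hd
    _ = _ := by field_simp

lemma Ker.far {l} (hl : Ker l) (x x' y : E3) (h : 2 * ‖x - x'‖ ≤ ‖x - y‖) (h0 : 0 < ‖x - y‖) :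
    |l y (x - y) * (‖x - y‖ ^ 3)⁻¹ - l y (x' - y) * (‖x' - y‖ ^ 3)⁻¹|
      ≤ 8 * ‖x - x'‖ * (‖x - y‖ ^ 3)⁻¹ := by
  have e1 : (x - y) - (x' - y) = x - x' := by abel
  have hd : |‖x - y‖ - ‖x' - y‖| ≤ ‖x - x'‖ := by
    rw [← e1]; exact abs_norm_sub_norm_le _ _
  have hb : ‖x - y‖ ≤ 2 * ‖x' - y‖ := by have := (abs_le.1 hd).2; linarith
  have hl1 : l y (x - x') = l y (x - y) - l y (x' - y) := by rw [← e1, hl.lin]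
  have : l y (x - y) * (‖x - y‖ ^ 3)⁻¹ - l y (x' - y) * (‖x' - y‖ ^ 3)⁻¹
     = l y (x - x') * (‖x - y‖ ^ 3)⁻¹ + l y (x' - y) * ((‖x - y‖ ^ 3)⁻¹ - (‖x' - y‖ ^ 3)⁻¹) := by
    rw [hl1]; ring
  rw [this]; refine (abs_add_le _ _).trans ?_; rw [abs_mul, abs_mul, abs_of_nonneg (a := (‖x - y‖ ^ 3)⁻¹) (by positivity)]
  have h1 : |l y (x - x')| * (‖x - y‖ ^ 3)⁻¹ ≤ ‖x - x'‖ * (‖x - y‖ ^ 3)⁻¹ := by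
    gcongr; exact hl.bd _ _
  have h2 : |l y (x' - y)| * |(‖x - y‖ ^ 3)⁻¹ - (‖x' - y‖ ^ 3)⁻¹| ≤
     ‖x' - y‖ * |(‖x - y‖ ^ 3)⁻¹ - (‖x' - y‖ ^ 3)⁻¹| := by
    gcongr; exact hl.bd _ _
  have := real_far h0 hb hd
  linarith

lemma Ker.b2 {l} (hl : Ker l) {M : ℝ} {ω : E3 → ℝ} (hω : VB M ω) (x x' : E3) {κ : ℝ}
    (hκ : 0 < κ) (hκ1 : κ ≤ 1) :
    |KI l ω x - KI l ω x'| ≤ (8 * (κ3 + 1)) * M * (‖x - x'‖ * (1 + log (1 / κ)) + κ) := by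
  set d := ‖x - x'‖ with hd; have hd0 : 0 ≤ d := norm_nonneg _; unfold KI; rw [← integral_sub (hl.b1 hω x).1 (hl.b1 hω x').1]
  simp_rw [← sub_mul]
  set R := 2 * d + κ with hR; have hR0 : 0 ≤ R := by positivity
  have hp := ((q2_sub hR0 x).add (q2_sub (by positivity : 0 ≤ 2 * R) x')).add
    ((q3_sub hκ hκ1 x).smul (by positivity : 0 ≤ 8 * d))
  have := kb' (k := fun y => l y (x - y) * (‖x - y‖ ^ 3)⁻¹ - l y (x' - y) * (‖x' - y‖ ^ 3)⁻¹) hω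
    ((hl.meask x).sub (hl.meask x')) hp (q := 8 * d) (by positivity)
    (fun y _ => (by
      have n1 := q2_nonneg R (x - y); have n2 := q2_nonneg (2 * R) (x' - y)
      have n3 := mul_nonneg (by positivity : 0 ≤ 8 * d) (q3_nonneg κ (x - y))
      by_cases h : ‖x - y‖ ≤ R
      · have hb : ‖x' - y‖ ≤ 2 * R := by
          have : x' - y = (x - y) - (x - x') := by abel
          have h2 := norm_sub_le (x - y) (x - x')
          rw [← this] at h2; linarith
        have e1 : q2 R (x - y) = (‖x - y‖ ^ 2)⁻¹ := if_pos h
        have e2 : q2 (2 * R) (x' - y) = (‖x' - y‖ ^ 2)⁻¹ := if_pos hb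
        have := hl.bd2 y (x - y)
        have := hl.bd2 y (x' - y)
        refine (abs_sub _ _).trans ?_
        linarith
      · push Not at h; have hp : 0 < ‖x - y‖ := by linarith
        have := hl.far x x' y (by linarith) hp
        refine this.trans ?_
        rw [← hd]
        by_cases h1 : ‖x - y‖ ≤ 1
        · have e3 : q3 κ (x - y) = (‖x - y‖ ^ 3)⁻¹ := if_pos ⟨by linarith, h1⟩
          rw [← e3]; linarith
        · have : (‖x - y‖ ^ 3)⁻¹ ≤ 1 := inv_le_one_of_one_le₀ (one_le_pow₀ (by linarith))
          nlinarith)) rc_ae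
  refine this.2.trans ?_
  have hL : 0 ≤ log (1 / κ) := log_nonneg (by rw [le_div_iff₀ hκ]; linarith)
  have h3 := κ3_nonneg
  have hM := hω.1
  have : κ3 * R + κ3 * (2 * R) + 8 * d * (κ3 * log (1 / κ)) + 8 * d ≤
     (8 * (κ3 + 1)) * (d * (1 + log (1 / κ)) + κ) := by
    rw [hR]; have := mul_nonneg h3 hd0; have := mul_nonneg h3 hκ.le; have := mul_nonneg hd0 hL; nlinarith
  nlinarith [mll this hM]

@[simp] lemma mk3_0 (a b c : ℝ) : mk3 a b c 0 = a := rfl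
@[simp] lemma mk3_1 (a b c : ℝ) : mk3 a b c 1 = b := rfl
@[simp] lemma mk3_2 (a b c : ℝ) : mk3 a b c 2 = c := rfl

lemma nsq (v : E3) : ‖v‖ ^ 2 = v 0 ^ 2 + v 1 ^ 2 + v 2 ^ 2 := by
  rw [EuclideanSpace.norm_sq_eq]; simp [Fin.sum_univ_three]

lemma norm_le_of_sq {v : E3} {c : ℝ} (hc : 0 ≤ c) (h : v 0 ^ 2 + v 1 ^ 2 + v 2 ^ 2 ≤ c ^ 2) :
    ‖v‖ ≤ c := by
  rw [← nsq] at h; exact (pow_le_pow_iff_left₀ (norm_nonneg _) hc two_ne_zero).1 h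

lemma rc_nonneg (x : E3) : 0 ≤ rc x := Real.sqrt_nonneg _
lemma rc_sq (x : E3) : rc x ^ 2 = x 0 ^ 2 + x 1 ^ 2 := Real.sq_sqrt (by positivity)
lemma rc_le (x : E3) : rc x ≤ ‖x‖ := by
  apply (pow_le_pow_iff_left₀ (rc_nonneg _) (norm_nonneg _) two_ne_zero).1; rw [rc_sq, nsq]; nlinarith [sq_nonneg (x 2)]
lemma coord_le (x : E3) (i : Fin 3) : |x i| ≤ ‖x‖ := by
  simpa using PiLp.norm_apply_le x i
lemma rc_cont : Continuous rc := by unfold rc; fun_prop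

lemma ab_sq (y : E3) : (y 0 / rc y) ^ 2 + (y 1 / rc y) ^ 2 ≤ 1 := by
  rw [div_pow, div_pow, ← add_div, rc_sq]; exact div_self_le_one _

def l0 (y v : E3) : ℝ := v 2 * (y 0 / rc y)
def l1 (y v : E3) : ℝ := v 2 * (y 1 / rc y)
def l2 (y v : E3) : ℝ := -(v 0 * (y 0 / rc y) + v 1 * (y 1 / rc y))

lemma ker0 : Ker l0 where
  lin y v w := by simp [l0]; ring
  bd y v := by
    apply abs_le_of_sq_le_sq _ (norm_nonneg _); rw [nsq, l0]; have := ab_sq y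
    nlinarith [sq_nonneg (v 0), sq_nonneg (v 1), sq_nonneg (v 2), sq_nonneg (y 1 / rc y),
      mul_nonneg (sq_nonneg (v 2)) (sq_nonneg (y 1 / rc y)), mll this (sq_nonneg (v 2))]
  meas := by
    have := rc_cont.measurable
    unfold Function.uncurry l0; fun_prop

lemma ker1 : Ker l1 where
  lin y v w := by simp [l1]; ring
  bd y v := by
    apply abs_le_of_sq_le_sq _ (norm_nonneg _); rw [nsq, l1]; have := ab_sq y
    nlinarith [sq_nonneg (v 0), sq_nonneg (v 1), sq_nonneg (v 2), sq_nonneg (y 1 / rc y),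
      mul_nonneg (sq_nonneg (v 2)) (sq_nonneg (y 0 / rc y)), mll this (sq_nonneg (v 2))]
  meas := by
    have := rc_cont.measurable
    unfold Function.uncurry l1; fun_prop

lemma ker2 : Ker l2 where
  lin y v w := by simp [l2]; ring
  bd y v := by
    apply abs_le_of_sq_le_sq _ (norm_nonneg _); rw [nsq, l2]; have := ab_sq y; have h := mll this (by positivity : 0 ≤ v 0 ^ 2 + v 1 ^ 2)
    nlinarith [sq_nonneg (v 0 * (y 1 / rc y) - v 1 * (y 0 / rc y)), sq_nonneg (v 2)]
  meas := by
    have := rc_cont.measurable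
    unfold Function.uncurry l2; fun_prop

lemma taylor_real {a b δ : ℝ} (ha : 0 < a) (hδ : 2 * δ ≤ a) (h : |b - a| ≤ δ) :
    |(b ^ 3)⁻¹ - (a ^ 3)⁻¹ + 3 / 2 * (a ^ 5)⁻¹ * (b ^ 2 - a ^ 2)| ≤ 24 * δ ^ 2 * (a ^ 5)⁻¹ := by
  have h' := abs_le.1 h
  have hb : a ≤ 2 * b := by linarith
  have hb0 : 0 < b := by linarith
  have e : (b ^ 3)⁻¹ - (a ^ 3)⁻¹ + 3 / 2 * (a ^ 5)⁻¹ * (b ^ 2 - a ^ 2) =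
    (b - a) ^ 2 * ((3 * b ^ 3 + 6 * a * b ^ 2 + 4 * a ^ 2 * b + 2 * a ^ 3) / 2) * ((a ^ 5)⁻¹ * (b ^ 3)⁻¹) := by
    field_simp; ring
  rw [e, abs_of_nonneg (by positivity)]
  have h1 : (b - a) ^ 2 ≤ δ ^ 2 := sq_le_sq' h'.1 h'.2
  have h2 : (3 * b ^ 3 + 6 * a * b ^ 2 + 4 * a ^ 2 * b + 2 * a ^ 3) / 2 ≤ 24 * b ^ 3 := by
    have h3 : a ^ 2 ≤ (2 * b) ^ 2 := by gcongr
    have h4 : a ^ 3 ≤ (2 * b) ^ 3 := by gcongr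
    nlinarith [mlr hb (sq_nonneg b), mlr h3 hb0.le]
  calc _ ≤ δ ^ 2 * (24 * b ^ 3) * ((a ^ 5)⁻¹ * (b ^ 3)⁻¹) := by gcongr
    _ = _ := by field_simp

lemma taylor3 {p q : E3} {D : ℝ} (hp : ‖p‖ ≤ D) (hq : 2 * D ≤ ‖q‖) (h0 : 0 < ‖q‖) :
    |(‖p - q‖ ^ 3)⁻¹ - ((‖q‖ ^ 3)⁻¹ + 3 * (p 0 * q 0 + p 1 * q 1 + p 2 * q 2) * (‖q‖ ^ 5)⁻¹)|
      ≤ 26 * D ^ 2 * (‖q‖ ^ 5)⁻¹ := by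
  have hb : |‖p - q‖ - ‖q‖| ≤ D := by
    have := abs_norm_sub_norm_le (q - p) q
    rw [norm_sub_rev p q]; refine this.trans ?_; simpa using hp
  have := taylor_real h0 hq hb
  have e : ‖p - q‖ ^ 2 - ‖q‖ ^ 2 = ‖p‖ ^ 2 - 2 * (p 0 * q 0 + p 1 * q 1 + p 2 * q 2) := by
    simp only [nsq, PiLp.sub_apply]; ring
  rw [e] at this; have h1 : 0 ≤ (‖q‖ ^ 5)⁻¹ := by positivity
  have h2 : ‖p‖ ^ 2 ≤ D ^ 2 := by gcongr
  have h3 := abs_le.1 this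
  have h4 := mlr h2 h1
  have h5 : 0 ≤ ‖p‖ ^ 2 * (‖q‖ ^ 5)⁻¹ := by positivity
  rw [abs_le]
  constructor <;> nlinarith

/-- cutoff -/
def cutθ (ρ R : ℝ) (q : E3) : ℝ :=
  Real.smoothTransition ((‖q‖ ^ 2 / ρ ^ 2 - 1) / 3) * Real.smoothTransition (2 - ‖q‖ ^ 2 / R ^ 2)

def Gk (ρ R : ℝ) (q : E3) : ℝ :=
  -(3 / (8 * π)) * (q 0 ^ 2 + q 1 ^ 2) * q 2 * (‖q‖ ^ 5)⁻¹ * cutθ ρ R q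

lemma cutθ_nonneg (ρ R : ℝ) (q : E3) : 0 ≤ cutθ ρ R q :=
  mul_nonneg (smoothTransition.nonneg _) (smoothTransition.nonneg _)
lemma cutθ_le (ρ R : ℝ) (q : E3) : cutθ ρ R q ≤ 1 :=
  mul_le_one₀ (smoothTransition.le_one _) (smoothTransition.nonneg _) (smoothTransition.le_one _)
lemma cutθ_zero {ρ R : ℝ} {q : E3} (hρ : 0 < ρ) (h : ‖q‖ ≤ ρ) : cutθ ρ R q = 0 := by
  unfold cutθ; rw [smoothTransition.zero_of_nonpos, zero_mul]; have : ‖q‖ ^ 2 / ρ ^ 2 ≤ 1 := by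
    rw [div_le_one (by positivity)]; gcongr
  linarith
lemma cutθ_zero' {ρ R : ℝ} {q : E3} (hR : 0 < R) (h : 2 * R ≤ ‖q‖) : cutθ ρ R q = 0 := by
  unfold cutθ; rw [smoothTransition.zero_of_nonpos (x := 2 - ‖q‖ ^ 2 / R ^ 2), mul_zero]; have : 2 ≤ ‖q‖ ^ 2 / R ^ 2 := by
    rw [le_div_iff₀ (by positivity)]; nlinarith
  linarith
lemma cutθ_one {ρ R : ℝ} {q : E3} (hρ : 0 < ρ) (hR : 0 < R) (h : 2 * ρ ≤ ‖q‖) (h' : ‖q‖ ≤ R) :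
    cutθ ρ R q = 1 := by
  unfold cutθ; rw [smoothTransition.one_of_one_le, smoothTransition.one_of_one_le, one_mul]
  · have : ‖q‖ ^ 2 / R ^ 2 ≤ 1 := by
      rw [div_le_one (by positivity)]; gcongr
    linarith
  · have : 4 ≤ ‖q‖ ^ 2 / ρ ^ 2 := by
      rw [le_div_iff₀ (by positivity)]; nlinarith
    linarith
lemma cutθ_anti {ρ ρ' R : ℝ} {q : E3} (hρ : 0 < ρ) (h : ρ ≤ ρ') : cutθ ρ' R q ≤ cutθ ρ R q := by
  unfold cutθ; gcongr
  · exact smoothTransition.nonneg _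
  · apply smoothTransition.monotone; gcongr
lemma cutθ_cont (ρ R : ℝ) : Continuous (cutθ ρ R) := by
  have := @smoothTransition.continuous
  unfold cutθ; fun_prop

lemma near2 {x y : E3} {s : ℝ} (h : ‖x - y‖ ≤ s) {l} (hl : Ker l) :
    |l y (x - y) * (‖x - y‖ ^ 3)⁻¹| ≤ q2 s (x - y) :=
  (hl.bd2 y (x - y)).trans (if_pos h).ge

lemma inv_helper {a : ℝ} (ha : 0 < a) : a * (a ^ 5)⁻¹ = (a ^ 4)⁻¹ := by field_simp

lemma mul_bd {a b A B : ℝ} (ha : |a| ≤ A) (hb : |b| ≤ B) : |a * b| ≤ A * B := by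
  rw [abs_mul]; exact mul_le_mul ha hb (abs_nonneg _) ((abs_nonneg _).trans ha)

lemma farW_real {r pz α rq qz a D A3 A5 T1 T2 : ℝ} (hr : |r| ≤ D) (hα : |α| ≤ 1)
    (hrq : |rq| ≤ a) (hD : 2 * D ≤ a) (hA : 0 ≤ A5)
    (h1 : |T1 - (A3 + 3 * (r * (α * rq) + pz * qz) * A5)| ≤ 26 * D ^ 2 * A5)
    (h2 : |T2 - (A3 + 3 * (-r * (α * rq) + pz * qz) * A5)| ≤ 26 * D ^ 2 * A5) :
    |1 / 2 * ((rq - r * α) * T1 + (rq + r * α) * T2) - rq * A3 - 3 * pz * rq * qz * A5|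
      ≤ 60 * D ^ 2 * (a * A5) := by
  have hD0 : 0 ≤ D := (abs_nonneg _).trans hr
  have ha0 : 0 ≤ a := (abs_nonneg _).trans hrq
  set E1 := T1 - (A3 + 3 * (r * (α * rq) + pz * qz) * A5) with hE1; set E2 := T2 - (A3 + 3 * (-r * (α * rq) + pz * qz) * A5) with hE2
  have e : 1 / 2 * ((rq - r * α) * T1 + (rq + r * α) * T2) - rq * A3 - 3 * pz * rq * qz * A5
    = -3 * ((r * α) * (r * α) * rq) * A5 + 1 / 2 * ((rq - r * α) * E1 + (rq + r * α) * E2) := by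
    rw [hE1, hE2]; ring
  have k1 : |r * α| ≤ D * 1 := mul_bd hr hα
  rw [mul_one] at k1; have k2 := mul_bd (mul_bd (mul_bd k1 k1) hrq) (abs_of_nonneg hA).le; have k3 : |rq - r * α| ≤ a + D := (abs_sub _ _).trans (by linarith)
  have k4 : |rq + r * α| ≤ a + D := (abs_add_le _ _).trans (by linarith)
  have k5 := mul_bd k3 h1
  have k6 := mul_bd k4 h2
  have k7 : (a + D) * (26 * D ^ 2 * A5) ≤ 39 * D ^ 2 * (a * A5) := by
    have := mlr (show a + D ≤ 3 / 2 * a by linarith)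
      (show 0 ≤ 26 * D ^ 2 * A5 by positivity)
    linarith
  have k8 : 0 ≤ D ^ 2 * (a * A5) := by positivity
  rw [e]
  clear_value E1 E2; have := abs_le.1 k2; have := abs_le.1 k5; have := abs_le.1 k6; rw [abs_le]; constructor <;> linarith

lemma farU_real {r pz α β rq qz a D A3 A5 T1 T2 T3 T4 : ℝ} (hr : |r| ≤ D) (hα : |α| ≤ 1)
    (hβ : |β| ≤ 1) (hab : (α ^ 2 + β ^ 2) = 1) (hpz : |pz| ≤ D) (hqz : |qz| ≤ a)
    (hrq : |rq| ≤ a) (hD : 2 * D ≤ a) (hA : 0 ≤ A5)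
    (h1 : |T1 - (A3 + 3 * (r * (α * rq) + pz * qz) * A5)| ≤ 26 * D ^ 2 * A5)
    (h2 : |T2 - (A3 + 3 * (-r * (α * rq) + pz * qz) * A5)| ≤ 26 * D ^ 2 * A5)
    (h3 : |T3 - (A3 + 3 * (r * (β * rq) + pz * qz) * A5)| ≤ 26 * D ^ 2 * A5)
    (h4 : |T4 - (A3 + 3 * (-r * (β * rq) + pz * qz) * A5)| ≤ 26 * D ^ 2 * A5) :
    |1 / 4 * ((pz - qz) * α * T1 - (pz - qz) * α * T2 + (pz - qz) * β * T3 - (pz - qz) * β * T4)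
      + 3 / 2 * r * rq * qz * A5| ≤ 60 * D ^ 2 * (a * A5) := by
  have hD0 : 0 ≤ D := (abs_nonneg _).trans hr
  have ha0 : 0 ≤ a := (abs_nonneg _).trans hrq
  set E1 := T1 - (A3 + 3 * (r * (α * rq) + pz * qz) * A5) with hE1; set E2 := T2 - (A3 + 3 * (-r * (α * rq) + pz * qz) * A5) with hE2
  set E3 := T3 - (A3 + 3 * (r * (β * rq) + pz * qz) * A5) with hE3; set E4 := T4 - (A3 + 3 * (-r * (β * rq) + pz * qz) * A5) with hE4
  have e : 1 / 4 * ((pz - qz) * α * T1 - (pz - qz) * α * T2 + (pz - qz) * β * T3 - (pz - qz) * β * T4)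
      + 3 / 2 * r * rq * qz * A5 = 3 / 2 * (pz * r * rq * A5) +
      1 / 4 * ((pz - qz) * α * E1 - (pz - qz) * α * E2 + (pz - qz) * β * E3 - (pz - qz) * β * E4) +
      3 / 2 * ((α ^ 2 + β ^ 2) - 1) * (pz - qz) * r * rq * A5 := by
    rw [hE1, hE2, hE3, hE4]; ring
  rw [e, hab]
  clear_value E1 E2 E3 E4; have k3 : |pz - qz| ≤ a + D := (abs_sub _ _).trans (by linarith)
  have k2 := abs_le.1 (mul_bd (mul_bd (mul_bd hpz hr) hrq) (abs_of_nonneg hA).le)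
  have m1 := abs_le.1 (mul_bd (mul_bd k3 hα) h1)
  have m2 := abs_le.1 (mul_bd (mul_bd k3 hα) h2)
  have m3 := abs_le.1 (mul_bd (mul_bd k3 hβ) h3)
  have m4 := abs_le.1 (mul_bd (mul_bd k3 hβ) h4)
  have k7 : (a + D) * 1 * (26 * D ^ 2 * A5) ≤ 39 * D ^ 2 * (a * A5) := by
    have := mlr (show a + D ≤ 3 / 2 * a by linarith)
      (show 0 ≤ 26 * D ^ 2 * A5 by positivity)
    linarith
  have k8 : 0 ≤ D ^ 2 * (a * A5) := by positivity
  rw [abs_le]; constructor <;> linarith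

lemma b3_aux {y ζ x : E3} {D : ℝ} (hx : ‖x - ζ‖ ≤ D) (h : 2 * D ≤ ‖ζ - y‖) (h0 : 0 < ‖ζ - y‖) :
    |(‖x - y‖ ^ 3)⁻¹ - ((‖ζ - y‖ ^ 3)⁻¹ + 3 * ((x - ζ) 0 * (y - ζ) 0 + (x - ζ) 1 * (y - ζ) 1
      + (x - ζ) 2 * (y - ζ) 2) * (‖ζ - y‖ ^ 5)⁻¹)| ≤ 26 * D ^ 2 * (‖ζ - y‖ ^ 5)⁻¹ := by
  rw [norm_sub_rev ζ y] at *; have := taylor3 hx h h0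
  rwa [show x - ζ - (y - ζ) = x - y by abel] at this

/-- the θ correction term -/
lemma cut_corr {y ζ : E3} {ρ R D P rq qz : ℝ} (hρ : 0 < ρ) (hD : ρ ≤ D) (hR : 1 ≤ R)
    (hP : |P| ≤ 3 * D) (hrq : |rq| ≤ ‖ζ - y‖) (hqz : |qz| ≤ ‖ζ - y‖) :
    (2 * D < ‖ζ - y‖ →
    |P * rq * qz * (‖ζ - y‖ ^ 5)⁻¹ - P * rq * qz * (‖ζ - y‖ ^ 5)⁻¹ * cutθ ρ R (y - ζ)| ≤ 3 * D) ∧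
    (‖ζ - y‖ ≤ 2 * D → |P * rq * qz * (‖ζ - y‖ ^ 5)⁻¹ * cutθ ρ R (y - ζ)|
      ≤ 3 * D * (ρ ^ 3)⁻¹ * q0 (2 * D) (ζ - y)) := by
  have hθ0 := cutθ_nonneg ρ R (y - ζ)
  have hθ1 := cutθ_le ρ R (y - ζ)
  have hm := mul_bd (mul_bd hP hrq) hqz
  have hD0 : 0 < D := by linarith
  have key : 0 < ‖ζ - y‖ → |P * rq * qz * (‖ζ - y‖ ^ 5)⁻¹| ≤ 3 * D * (‖ζ - y‖ ^ 3)⁻¹ := by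
    intro ha; rw [abs_mul, abs_of_nonneg (a := (‖ζ - y‖ ^ 5)⁻¹) (by positivity)]
    calc _ ≤ 3 * D * ‖ζ - y‖ * ‖ζ - y‖ * (‖ζ - y‖ ^ 5)⁻¹ := by gcongr
      _ = _ := by field_simp
  constructor
  · intro h; have ha : 0 < ‖ζ - y‖ := by linarith
    by_cases h1 : ‖ζ - y‖ ≤ R
    · rw [cutθ_one hρ (by linarith) (by rw [norm_sub_rev]; linarith) (by rwa [norm_sub_rev])]
      simp; exact hD0.le
    · rw [show P * rq * qz * (‖ζ - y‖ ^ 5)⁻¹ - P * rq * qz * (‖ζ - y‖ ^ 5)⁻¹ * cutθ ρ R (y - ζ)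
        = P * rq * qz * (‖ζ - y‖ ^ 5)⁻¹ * (1 - cutθ ρ R (y - ζ)) by ring, abs_mul]
      have h2 : |1 - cutθ ρ R (y - ζ)| ≤ 1 := by rw [abs_le]; constructor <;> linarith
      have h3 : (‖ζ - y‖ ^ 3)⁻¹ ≤ 1 := inv_le_one_of_one_le₀ (one_le_pow₀ (by linarith))
      have h4 := key ha
      have h5 := abs_nonneg (P * rq * qz * (‖ζ - y‖ ^ 5)⁻¹)
      nlinarith [abs_nonneg (1 - cutθ ρ R (y - ζ))]
  · intro h; rw [q0, if_pos h]
    by_cases h1 : ‖ζ - y‖ ≤ ρ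
    · rw [cutθ_zero hρ (by rwa [norm_sub_rev])]; simp; positivity
    · push Not at h1; rw [abs_mul, abs_of_nonneg hθ0]; have := key (by linarith)
      have h6 : (‖ζ - y‖ ^ 3)⁻¹ ≤ (ρ ^ 3)⁻¹ := by gcongr
      have h7 : 3 * D * (‖ζ - y‖ ^ 3)⁻¹ ≤ 3 * D * (ρ ^ 3)⁻¹ := by gcongr
      nlinarith [abs_nonneg (P * rq * qz * (‖ζ - y‖ ^ 5)⁻¹)]

def Sθ (ρ R : ℝ) (ζ : E3) (y : E3) : ℝ :=
  rc y * (y - ζ) 2 * (‖ζ - y‖ ^ 5)⁻¹ * cutθ ρ R (y - ζ)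

lemma Sθ_meas (ρ R : ℝ) (ζ : E3) : Measurable (Sθ ρ R ζ) := by
  have := rc_cont.measurable
  have := (cutθ_cont ρ R).measurable
  unfold Sθ; fun_prop

def pB (D ρ : ℝ) (ζ x1 x2 x3 x4 y : E3) : ℝ :=
  q2 (3 * D) (x1 - y) + q2 (3 * D) (x2 - y) + q2 (3 * D) (x3 - y) + q2 (3 * D) (x4 - y)
  + q2 (2 * D) (ζ - y) + 3 * D * (ρ ^ 3)⁻¹ * q0 (2 * D) (ζ - y) + 60 * D ^ 2 * q4 (2 * D) (ζ - y)

lemma pB_IB {D ρ : ℝ} (hρ : 0 < ρ) (hD : ρ ≤ D) (ζ x1 x2 x3 x4 : E3) :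
    IB (pB D ρ ζ x1 x2 x3 x4) (100 * κ3 * D * (D / ρ) ^ 3) := by
  have hD0 : 0 < D := by linarith
  have h3 := fun x => q2_sub (by positivity : 0 ≤ 3 * D) x
  have := ((((((h3 x1).add (h3 x2)).add (h3 x3)).add (h3 x4)).add
    (q2_sub (by positivity : 0 ≤ 2 * D) ζ)).add ((q0_sub (by positivity : 0 ≤ 2 * D) ζ).smul
      (by positivity : 0 ≤ 3 * D * (ρ ^ 3)⁻¹))).add ((q4_sub (by positivity : 0 < 2 * D) ζ).smul
      (by positivity : 0 ≤ 60 * D ^ 2))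
  refine ⟨this.1, this.2.1, this.2.2.trans ?_⟩
  have h1 : 1 ≤ (D / ρ) ^ 3 := one_le_pow₀ (by rw [le_div_iff₀ hρ]; linarith)
  have hk := κ3_nonneg
  have e1 : 3 * D * (ρ ^ 3)⁻¹ * (κ3 * (2 * D) ^ 3) = 24 * (κ3 * D) * (D / ρ) ^ 3 := by
    field_simp; ring
  have e2 : 60 * D ^ 2 * (κ3 * (2 * D)⁻¹) = 30 * (κ3 * D) := by field_simp; ring
  rw [e1, e2]; have : 0 ≤ κ3 * D := by positivity
  nlinarith

lemma pB_terms {D ρ : ℝ} (hρ : 0 < ρ) (hD : ρ ≤ D) (ζ x1 x2 x3 x4 y : E3) :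
    0 ≤ q2 (3 * D) (x1 - y) ∧ 0 ≤ q2 (3 * D) (x2 - y) ∧ 0 ≤ q2 (3 * D) (x3 - y) ∧
    0 ≤ q2 (3 * D) (x4 - y) ∧ 0 ≤ q2 (2 * D) (ζ - y) ∧
    0 ≤ 3 * D * (ρ ^ 3)⁻¹ * q0 (2 * D) (ζ - y) ∧ 0 ≤ 60 * D ^ 2 * q4 (2 * D) (ζ - y) := by
  have : 0 < D := by linarith
  exact ⟨q2_nonneg _ _, q2_nonneg _ _, q2_nonneg _ _, q2_nonneg _ _, q2_nonneg _ _,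
    mul_nonneg (by positivity) (q0_nonneg _ _), mul_nonneg (by positivity) (q4_nonneg _ _)⟩

lemma ab_le (y : E3) : |y 0 / rc y| ≤ 1 ∧ |y 1 / rc y| ≤ 1 := by
  have := ab_sq y
  constructor <;> apply abs_le_of_sq_le_sq _ zero_le_one <;>
    nlinarith [sq_nonneg (y 0 / rc y), sq_nonneg (y 1 / rc y)]

lemma rc_le_ax {ζ : E3} (h0 : ζ 0 = 0) (h1 : ζ 1 = 0) (y : E3) : |rc y| ≤ ‖ζ - y‖ := by
  have : rc (ζ - y) = rc y := by simp [rc, h0, h1]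
  rw [abs_of_nonneg (rc_nonneg y), ← this]; exact rc_le _

lemma b3W_pt {ρ D R r c z : ℝ} (hρ : 0 < ρ) (hD : ρ ≤ D) (hR : 1 ≤ R)
    (hx : ‖mk3 r 0 z - mk3 0 0 c‖ ≤ D) (hx' : ‖mk3 (-r) 0 z - mk3 0 0 c‖ ≤ D)
    (y : E3) (hy : rc y ≠ 0) :
    |1 / 2 * (l2 y (mk3 r 0 z - y) * (‖mk3 r 0 z - y‖ ^ 3)⁻¹ +
      l2 y (mk3 (-r) 0 z - y) * (‖mk3 (-r) 0 z - y‖ ^ 3)⁻¹) -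
      l2 y (mk3 0 0 c - y) * (‖mk3 0 0 c - y‖ ^ 3)⁻¹ - 3 * (z - c) * Sθ ρ R (mk3 0 0 c) y|
    ≤ pB D ρ (mk3 0 0 c) (mk3 r 0 z) (mk3 (-r) 0 z) (mk3 r 0 z) (mk3 r 0 z) y + 3 * D := by
  set x1 := mk3 r 0 z with hx1; set x2 := mk3 (-r) 0 z with hx2; set ζ := mk3 0 0 c with hζ; have hr : |r| ≤ D := by
    have := (coord_le (x1 - ζ) 0).trans hx
    simpa [hx1, hζ] using this
  have hz : |z - c| ≤ D := by
    have := (coord_le (x1 - ζ) 2).trans hx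
    simpa [hx1, hζ] using this
  have hrq := rc_le_ax (ζ := ζ) (by simp [hζ]) (by simp [hζ]) y
  have hqz : |(y - ζ) 2| ≤ ‖ζ - y‖ := by rw [norm_sub_rev]; exact coord_le _ 2
  obtain ⟨t1, t2, t3, t4, t5, t6, t7⟩ := pB_terms hρ hD ζ x1 x2 x1 x1 y; obtain ⟨cc1, cc2⟩ := cut_corr (P := 3 * (z - c)) hρ hD hR
    (by rw [abs_mul]; simp; exact hz) hrq hqz
  have es : 3 * (z - c) * Sθ ρ R ζ y =
    3 * (z - c) * rc y * (y - ζ) 2 * (‖ζ - y‖ ^ 5)⁻¹ * cutθ ρ R (y - ζ) := by unfold Sθ; ring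
  unfold pB
  by_cases h : ‖ζ - y‖ ≤ 2 * D
  · have n1 : ∀ x : E3, ‖x - ζ‖ ≤ D → ‖x - y‖ ≤ 3 * D := by
      intro x hx; have := norm_add_le (x - ζ) (ζ - y); rw [show x - ζ + (ζ - y) = x - y by abel] at this
      linarith
    have k1 := abs_le.1 (near2 (n1 x1 hx) (y := y) ker2)
    have k2 := abs_le.1 (near2 (n1 x2 hx') (y := y) ker2)
    have k3 := abs_le.1 (near2 h ker2)
    have k4 := abs_le.1 (cc2 h)
    rw [es]; rw [abs_le]; constructor <;> linarith
  · push Not at h; have hD0 : 0 < D := by linarith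
    have h0 : 0 < ‖ζ - y‖ := by linarith
    have a1 := b3_aux hx h.le h0
    have a2 := b3_aux hx' h.le h0
    have y0 : y 0 = (y 0 / rc y) * rc y := by field_simp
    have fw := farW_real (r := r) (pz := z - c) (α := y 0 / rc y) (rq := rc y) (qz := (y - ζ) 2)
      (a := ‖ζ - y‖) (D := D) (A3 := (‖ζ - y‖ ^ 3)⁻¹) (A5 := (‖ζ - y‖ ^ 5)⁻¹)
      (T1 := (‖x1 - y‖ ^ 3)⁻¹) (T2 := (‖x2 - y‖ ^ 3)⁻¹) hr (ab_le y).1 hrq h.le (by positivity)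
      (by rw [← y0]; simpa [hx1, hζ] using a1) (by rw [← y0]; simpa [hx2, hζ] using a2)
    have hb : (y 0 / rc y) * y 0 + (y 1 / rc y) * y 1 = rc y := by
      have := rc_sq y
      field_simp; linarith
    have e1 : l2 y (x1 - y) = rc y - r * (y 0 / rc y) := by
      simp [l2, hx1]; linarith
    have e2 : l2 y (x2 - y) = rc y + r * (y 0 / rc y) := by
      simp [l2, hx2]; linarith
    have e3 : l2 y (ζ - y) = rc y := by
      simp [l2, hζ]; linarith
    rw [e1, e2, e3, es]; have h4 : q4 (2 * D) (ζ - y) = (‖ζ - y‖ ^ 4)⁻¹ := if_pos h.le; rw [inv_helper h0, ← h4] at fw; have fw' := abs_le.1 fw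
    have c' := abs_le.1 (cc1 h)
    rw [abs_le]; constructor <;> linarith

lemma b3U_pt {ρ D R r c z : ℝ} (hρ : 0 < ρ) (hD : ρ ≤ D) (hR : 1 ≤ R)
    (hx : ‖mk3 r 0 z - mk3 0 0 c‖ ≤ D) (hx2' : ‖mk3 (-r) 0 z - mk3 0 0 c‖ ≤ D)
    (hx3' : ‖mk3 0 r z - mk3 0 0 c‖ ≤ D) (hx4' : ‖mk3 0 (-r) z - mk3 0 0 c‖ ≤ D)
    (y : E3) (hy : rc y ≠ 0) :
    |1 / 4 * (l0 y (mk3 r 0 z - y) * (‖mk3 r 0 z - y‖ ^ 3)⁻¹ -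
      l0 y (mk3 (-r) 0 z - y) * (‖mk3 (-r) 0 z - y‖ ^ 3)⁻¹ +
      l1 y (mk3 0 r z - y) * (‖mk3 0 r z - y‖ ^ 3)⁻¹ -
      l1 y (mk3 0 (-r) z - y) * (‖mk3 0 (-r) z - y‖ ^ 3)⁻¹)
       - (-(3 / 2 * r)) * Sθ ρ R (mk3 0 0 c) y|
    ≤ pB D ρ (mk3 0 0 c) (mk3 r 0 z) (mk3 (-r) 0 z) (mk3 0 r z) (mk3 0 (-r) z) y + 3 * D := by
  set x1 := mk3 r 0 z with hx1; set x2 := mk3 (-r) 0 z with hx2; set x3 := mk3 0 r z with hx3; set x4 := mk3 0 (-r) z with hx4; set ζ := mk3 0 0 c with hζ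
  have hr : |r| ≤ D := by
    have := (coord_le (x1 - ζ) 0).trans hx
    simpa [hx1, hζ] using this
  have hz : |z - c| ≤ D := by
    have := (coord_le (x1 - ζ) 2).trans hx
    simpa [hx1, hζ] using this
  have hrq := rc_le_ax (ζ := ζ) (by simp [hζ]) (by simp [hζ]) y
  have hqz : |(y - ζ) 2| ≤ ‖ζ - y‖ := by rw [norm_sub_rev]; exact coord_le _ 2
  obtain ⟨t1, t2, t3, t4, t5, t6, t7⟩ := pB_terms hρ hD ζ x1 x2 x3 x4 y; obtain ⟨cc1, cc2⟩ := cut_corr (P := 3 / 2 * r) hρ hD hR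
    (by rw [abs_mul, abs_of_pos (by norm_num)]; linarith [abs_nonneg r]) hrq hqz
  have es : -(3 / 2 * r) * Sθ ρ R ζ y =
    -(3 / 2 * r * rc y * (y - ζ) 2 * (‖ζ - y‖ ^ 5)⁻¹ * cutθ ρ R (y - ζ)) := by unfold Sθ; ring
  unfold pB; rw [es]
  by_cases h : ‖ζ - y‖ ≤ 2 * D
  · have n1 : ∀ x : E3, ‖x - ζ‖ ≤ D → ‖x - y‖ ≤ 3 * D := by
      intro x hx; have := norm_add_le (x - ζ) (ζ - y); rw [show x - ζ + (ζ - y) = x - y by abel] at this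
      linarith
    have k1 := abs_le.1 (near2 (n1 x1 hx) (y := y) ker0)
    have k2 := abs_le.1 (near2 (n1 x2 hx2') (y := y) ker0)
    have k3 := abs_le.1 (near2 (n1 x3 hx3') (y := y) ker1)
    have k3' := abs_le.1 (near2 (n1 x4 hx4') (y := y) ker1)
    have k4 := abs_le.1 (cc2 h)
    rw [abs_le]; constructor <;> linarith
  · push Not at h; have hD0 : 0 < D := by linarith
    have h0 : 0 < ‖ζ - y‖ := by linarith
    have a1 := b3_aux hx h.le h0
    have a2 := b3_aux hx2' h.le h0
    have a3 := b3_aux hx3' h.le h0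
    have a4 := b3_aux hx4' h.le h0
    have y0 : y 0 = (y 0 / rc y) * rc y := by field_simp
    have y1 : y 1 = (y 1 / rc y) * rc y := by field_simp
    have hab : (y 0 / rc y) ^ 2 + (y 1 / rc y) ^ 2 = 1 := by
      have := rc_sq y
      field_simp; linarith
    have fw := farU_real (r := r) (pz := z - c) (α := y 0 / rc y) (β := y 1 / rc y) (rq := rc y)
      (qz := (y - ζ) 2)
      (a := ‖ζ - y‖) (D := D) (A3 := (‖ζ - y‖ ^ 3)⁻¹) (A5 := (‖ζ - y‖ ^ 5)⁻¹)
      (T1 := (‖x1 - y‖ ^ 3)⁻¹) (T2 := (‖x2 - y‖ ^ 3)⁻¹) (T3 := (‖x3 - y‖ ^ 3)⁻¹)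
      (T4 := (‖x4 - y‖ ^ 3)⁻¹) hr (ab_le y).1 (ab_le y).2 hab hz hqz hrq h.le (by positivity)
      (by rw [← y0]; simpa [hx1, hζ] using a1) (by rw [← y0]; simpa [hx2, hζ] using a2)
      (by rw [← y1]; simpa [hx3, hζ] using a3) (by rw [← y1]; simpa [hx4, hζ] using a4)
    have e0 : (y - ζ) 2 = y 2 - c := by simp [hζ]
    have e1 : l0 y (x1 - y) = (z - c - (y - ζ) 2) * (y 0 / rc y) := by
      rw [e0]; simp [l0, hx1]
    have e2 : l0 y (x2 - y) = (z - c - (y - ζ) 2) * (y 0 / rc y) := by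
      rw [e0]; simp [l0, hx2]
    have e3 : l1 y (x3 - y) = (z - c - (y - ζ) 2) * (y 1 / rc y) := by
      rw [e0]; simp [l1, hx3]
    have e4 : l1 y (x4 - y) = (z - c - (y - ζ) 2) * (y 1 / rc y) := by
      rw [e0]; simp [l1, hx4]
    rw [e1, e2, e3, e4]; have h4 : q4 (2 * D) (ζ - y) = (‖ζ - y‖ ^ 4)⁻¹ := if_pos h.le; rw [inv_helper h0, ← h4] at fw; have fw' := abs_le.1 fw
    have c' := abs_le.1 (cc1 h)
    rw [abs_le]; constructor <;> linarith

def Jm (p : E3) : E3 := mk3 (p 0) (p 1) (-2 * p 2)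

structure GF (C M : ℝ) (g : E3 → ℝ) (v : E3 → E3) : Prop where
  bd : ∀ x, ‖v x‖ ≤ C * M
  lip : ∀ x x' (κ : ℝ), 0 < κ → κ ≤ 1 →
    ‖v x - v x'‖ ≤ C * M * (‖x - x'‖ * (1 + log (1 / κ)) + κ)
  ax : ∀ c, v (mk3 0 0 c) 0 = 0 ∧ v (mk3 0 0 c) 1 = 0
  exp : ∀ (ρ D R c : ℝ) (x : E3), 0 < ρ → ρ ≤ D → 1 ≤ R → ‖x - mk3 0 0 c‖ ≤ D →
    ‖v x - v (mk3 0 0 c) - (∫ y, g y * Gk ρ R (y - mk3 0 0 c)) • Jm (x - mk3 0 0 c)‖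
      ≤ C * M * D * (D / ρ) ^ 3

lemma rpow3 (t : ℝ) (ht : 0 ≤ t) : t ^ (-(3 : ℝ)) = (t ^ 3)⁻¹ := by
  rw [rpow_neg ht]; norm_cast

lemma rc0 {y : E3} (h : rc y = 0) : y 0 = 0 ∧ y 1 = 0 := by
  have := rc_sq y
  rw [h] at this
  constructor <;> nlinarith [sq_nonneg (y 0), sq_nonneg (y 1)]

lemma four_uz (ω : E3 → ℝ) (x : E3) : 4 * π * uz ω x = KI l2 ω x := by
  have hp : (4 * π) ≠ 0 := by positivity
  unfold uz KI; rw [show 4 * π * (-(1 / (4 * π)) * ∫ y : E3, (rc x * cosDiff x y - rc y) * (‖x - y‖ ^ (-(3 : ℝ))) * ω y)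
    = -∫ y : E3, (rc x * cosDiff x y - rc y) * (‖x - y‖ ^ (-(3 : ℝ))) * ω y by field_simp, ← integral_neg]
  congr 1; ext y
  rw [rpow3 _ (norm_nonneg _)]; have : -(rc x * cosDiff x y - rc y) = l2 y (x - y) := by
    unfold cosDiff l2
    by_cases hy : rc y = 0
    · simp [hy]
    · have hs := rc_sq y
      by_cases hx : rc x = 0
      · obtain ⟨h0, h1⟩ := rc0 hx; simp [h0, h1, hx]; field_simp; linarith
      · simp; field_simp; linarith
  rw [← this]; ring

lemma four_ur {M : ℝ} {ω : E3 → ℝ} (hω : VB M ω) (x : E3) :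
    4 * π * ur ω x = (x 0 / rc x) * KI l0 ω x + (x 1 / rc x) * KI l1 ω x := by
  have hp : (4 * π) ≠ 0 := by positivity
  unfold ur KI; rw [← integral_const_mul, ← integral_const_mul, ← integral_const_mul, ← integral_const_mul,
    ← integral_add ((ker0.b1 hω x).1.const_mul _) ((ker1.b1 hω x).1.const_mul _)]
  congr 1; ext y
  rw [rpow3 _ (norm_nonneg _)]; unfold cosDiff l0 l1 zc; simp only [PiLp.sub_apply]
  rw [add_div, mul_comm (rc x), mul_div_mul_comm, mul_comm (rc y), mul_div_mul_comm]; field_simp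

lemma mk3_norm_sq (a b c : ℝ) : ‖mk3 a b c‖ ^ 2 = a ^ 2 + b ^ 2 + c ^ 2 := by simp [nsq]
lemma mk3_sub (a b c a' b' c' : ℝ) : mk3 a b c - mk3 a' b' c' = mk3 (a - a') (b - b') (c - c') := by
  ext i; fin_cases i <;> simp [mk3]

lemma sq_abs_le {a b : ℝ} (hb : 0 ≤ b) (h : a ^ 2 ≤ b ^ 2) : a ≤ b :=
  (le_abs_self a).trans (abs_le_of_sq_le_sq h hb)

lemma horiz_cs (x x' : E3) : x 0 * x' 0 + x 1 * x' 1 ≤ rc x * rc x' := by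
  apply sq_abs_le (mul_nonneg (rc_nonneg _) (rc_nonneg _)); rw [mul_pow, rc_sq, rc_sq]; nlinarith [sq_nonneg (x 0 * x' 1 - x 1 * x' 0)]

lemma slice_dist (x x' : E3) : ‖mk3 (rc x) 0 (x 2) - mk3 (rc x') 0 (x' 2)‖ ≤ ‖x - x'‖ := by
  apply sq_abs_le (norm_nonneg _); rw [mk3_sub, mk3_norm_sq, nsq]; simp only [PiLp.sub_apply]; nlinarith [horiz_cs x x', rc_sq x, rc_sq x']

lemma rc_mk (r z : ℝ) (hr : 0 ≤ r) : rc (mk3 r 0 z) = r ∧ rc (mk3 (-r) 0 z) = r ∧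
    rc (mk3 0 r z) = r ∧ rc (mk3 0 (-r) z) = r := by
  simp [rc, Real.sqrt_sq hr]

lemma eR_norm (x : E3) : ‖eR x‖ ≤ 1 := by
  apply norm_le_of_sq zero_le_one; simpa [eR] using ab_sq x

lemma eR_diff {x x' : E3} (h : 0 < rc x) (h' : 0 < rc x') :
    rc x' * ‖eR x - eR x'‖ ≤ 2 * ‖x - x'‖ := by
  apply sq_abs_le (by positivity)
  rw [mul_pow, nsq, mul_pow, nsq]; simp only [eR, PiLp.sub_apply, mk3_0, mk3_1, mk3_2]
  have e : rc x' ^ 2 * ((x 0 / rc x - x' 0 / rc x') ^ 2 + (x 1 / rc x - x' 1 / rc x') ^ 2 + (0 - 0) ^ 2)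
     = 2 * (rc x' / rc x) * (rc x * rc x' - (x 0 * x' 0 + x 1 * x' 1)) := by
    have h1 := rc_sq x; have h2 := rc_sq x'
    field_simp
    linear_combination (-(rc x' ^ 2)) * h1 - rc x ^ 2 * h2
  rw [e]; have cs := horiz_cs x x'; have h1 := rc_sq x; have h2 := rc_sq x'; set s := x 0 * x' 0 + x 1 * x' 1
  have e2 : 2 ^ 2 * ((x 0 - x' 0) ^ 2 + (x 1 - x' 1) ^ 2 + (x 2 - x' 2) ^ 2) =
    4 * (rc x ^ 2 + rc x' ^ 2 - 2 * s) + 4 * (x 2 - x' 2) ^ 2 := by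
    rw [h1, h2]; ring
  rw [e2]; have hs : -(rc x * rc x') ≤ s := by
    have := horiz_cs x (-x')
    have e3 : rc (-x') = rc x' := by simp [rc]
    rw [e3] at this; simp only [PiLp.neg_apply] at this; have : s = -(x 0 * -x' 0 + x 1 * -x' 1) := by ring
    linarith
  rw [show 2 * (rc x' / rc x) * (rc x * rc x' - s) = (2 * rc x' * (rc x * rc x' - s)) / rc x by ring,
    div_le_iff₀ h]
  nlinarith [mul_nonneg h.le (sq_nonneg (x 2 - x' 2)), mul_nonneg h.le (sq_nonneg (rc x - rc x')),
    mul_nonneg (sub_nonneg.2 cs) h.le, mul_nonneg (sub_nonneg.2 cs) h'.le,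
    mul_nonneg h.le (sub_nonneg.2 cs), sq_nonneg (rc x - rc x'),
    mul_nonneg (sub_nonneg.2 cs) (sq_nonneg (rc x - rc x'))]

lemma combW {f1 f2 f3 f4 : E3 → ℝ} {c : ℝ} (h1 : Integrable f1) (h2 : Integrable f2) (h3 : Integrable f3)
    (h4 : Integrable f4) : 1 / 2 * ((∫ y, f1 y) + ∫ y, f2 y) - (∫ y, f3 y) - c * ∫ y, f4 y =
    ∫ y, (1 / 2 * (f1 y + f2 y) - f3 y - c * f4 y) := by
  have h12 : Integrable (fun y => f1 y + f2 y) := h1.add h2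
  have h5 : Integrable (fun y => 1 / 2 * (f1 y + f2 y)) := h12.const_mul _
  have h6 : Integrable (fun y => 1 / 2 * (f1 y + f2 y) - f3 y) := h5.sub h3
  rw [integral_sub h6 (h4.const_mul c), integral_sub h5 h3, integral_const_mul, integral_const_mul,
    integral_add h1 h2]

lemma combU {f1 f2 f3 f5 f4 : E3 → ℝ} {c : ℝ} (h1 : Integrable f1) (h2 : Integrable f2) (h3 : Integrable f3)
    (h5 : Integrable f5) (h4 : Integrable f4) :
    1 / 4 * ((∫ y, f1 y) - (∫ y, f2 y) + (∫ y, f3 y) - (∫ y, f5 y)) - c * ∫ y, f4 y =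
    ∫ y, (1 / 4 * (f1 y - f2 y + f3 y - f5 y) - c * f4 y) := by
  have h12 : Integrable (fun y => f1 y - f2 y) := h1.sub h2
  have h13 : Integrable (fun y => f1 y - f2 y + f3 y) := h12.add h3
  have h14 : Integrable (fun y => f1 y - f2 y + f3 y - f5 y) := h13.sub h5
  rw [integral_sub (h14.const_mul _) (h4.const_mul c), integral_const_mul, integral_const_mul,
    integral_sub h13 h5, integral_add h12 h3, integral_sub h1 h2]

def Cv : ℝ := 1000 * (κ3 + 1)

lemma pi4 : 1 ≤ 4 * π := by have := Real.pi_gt_three; linarith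

lemma of_four {a b : ℝ} (h : |4 * π * a| ≤ b) : |a| ≤ b := by
  rw [abs_mul, abs_of_pos (by positivity)] at h
  have := pi4
  nlinarith [abs_nonneg a]

structure SW (M : ℝ) (ω : E3 → ℝ) (v : E3 → E3) : Prop where
  vb : VB M ω
  sw : ∃ Ur Uz : ℝ → ℝ → ℝ, ∀ x, v x = Ur (rc x) (zc x) • eR x + Uz (rc x) (zc x) • eZ
  bs : ∀ x, v x = ur ω x • eR x + uz ω x • eZ

lemma SW.key {M ω v} (h : SW M ω v) : ∃ U W : ℝ → ℝ → ℝ,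
    (∀ x, v x = U (rc x) (x 2) • eR x + W (rc x) (x 2) • eZ) ∧
    (∀ x, 4 * π * W (rc x) (x 2) = KI l2 ω x) ∧
    (∀ x, 0 < rc x → 4 * π * U (rc x) (x 2) = (x 0 / rc x) * KI l0 ω x + (x 1 / rc x) * KI l1 ω x) := by
  obtain ⟨U, W, hv⟩ := h.sw; refine ⟨U, W, hv, fun x => ?_, fun x hx => ?_⟩
  · rw [← four_uz]; have := congrArg (fun w : E3 => w 2) ((hv x).symm.trans (h.bs x))
    simp [eR, eZ, zc] at this; rw [this]
  · rw [← four_ur h.vb]; have h0 := congrArg (fun w : E3 => w 0) ((hv x).symm.trans (h.bs x))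
    have h1 := congrArg (fun w : E3 => w 1) ((hv x).symm.trans (h.bs x))
    simp [eR, eZ, zc] at h0 h1; have := rc_sq x
    rcases h0 with h0 | h0
    · rw [h0]
    rcases h1 with h1 | h1
    · rw [h1]
    exfalso
    have a0 : x 0 = 0 := by rcases h0 with h | h; exact h; linarith
    have a1 : x 1 = 0 := by rcases h1 with h | h; exact h; linarith
    rw [a0, a1] at this; nlinarith

lemma eZ_norm : ‖eZ‖ ≤ 1 := by
  apply norm_le_of_sq zero_le_one; simp [eZ]

theorem SW.gf {M ω v} (h : SW M ω v) : GF Cv M (fun y => ω y / rc y) v := by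
  obtain ⟨U, W, hv, hW, hU⟩ := h.key; have hM := h.vb.1; have hk := κ3_nonneg; have hax : ∀ c, rc (mk3 0 0 c) = 0 := fun c => by simp [rc]
  have eax : ∀ x, rc x = 0 → eR x = 0 := fun x hx => by
    ext i; fin_cases i <;> simp [eR, hx]
  -- U at four points
  have U1 : ∀ r z, 0 < r → 4 * π * U r z = KI l0 ω (mk3 r 0 z) := fun r z hr => by
    have := hU (mk3 r 0 z) (by rw [(rc_mk r z hr.le).1]; exact hr)
    rw [(rc_mk r z hr.le).1] at this; simpa [hr.ne'] using this
  have U2 : ∀ r z, 0 < r → 4 * π * U r z = -KI l0 ω (mk3 (-r) 0 z) := fun r z hr => by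
    have := hU (mk3 (-r) 0 z) (by rw [(rc_mk r z hr.le).2.1]; exact hr)
    rw [(rc_mk r z hr.le).2.1] at this; simpa [hr.ne', neg_div] using this
  have U3 : ∀ r z, 0 < r → 4 * π * U r z = KI l1 ω (mk3 0 r z) := fun r z hr => by
    have := hU (mk3 0 r z) (by rw [(rc_mk r z hr.le).2.2.1]; exact hr)
    rw [(rc_mk r z hr.le).2.2.1] at this; simpa [hr.ne'] using this
  have U4 : ∀ r z, 0 < r → 4 * π * U r z = -KI l1 ω (mk3 0 (-r) z) := fun r z hr => by
    have := hU (mk3 0 (-r) z) (by rw [(rc_mk r z hr.le).2.2.2]; exact hr)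
    rw [(rc_mk r z hr.le).2.2.2] at this; simpa [hr.ne', neg_div] using this
  have Ubd : ∀ r z κ, 0 < r → 0 < κ → κ ≤ 1 →
      |U r z| ≤ 8 * (κ3 + 1) * M * (r * (1 + log (1 / κ)) + κ) := fun r z κ hr hκ hκ1 => by
    apply of_four; have h2 := ker0.b2 h.vb (mk3 r 0 z) (mk3 (-r) 0 z) hκ hκ1
    have e : 4 * π * U r z = 1 / 2 * (KI l0 ω (mk3 r 0 z) - KI l0 ω (mk3 (-r) 0 z)) := by
      linarith [U1 r z hr, U2 r z hr]
    have n : ‖mk3 r 0 z - mk3 (-r) 0 z‖ = 2 * r := by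
      apply (pow_left_inj₀ (norm_nonneg _) (by positivity) two_ne_zero).1
      rw [mk3_sub, mk3_norm_sq]; ring
    rw [n] at h2; rw [e, abs_mul, abs_of_pos (by norm_num)]
    have : 0 ≤ 8 * (κ3 + 1) * M * κ := by positivity
    linarith
  have Udiff : ∀ r z r' z' κ, 0 < r → 0 < r' → 0 < κ → κ ≤ 1 → |U r z - U r' z'| ≤
      8 * (κ3 + 1) * M * (‖mk3 r 0 z - mk3 r' 0 z'‖ * (1 + log (1 / κ)) + κ) :=
    fun r z r' z' κ hr hr' hκ hκ1 => by
    apply of_four; rw [mul_sub, U1 r z hr, U1 r' z' hr']; exact ker0.b2 h.vb _ _ hκ hκ1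
  have Wdiff : ∀ x x' κ, 0 < κ → κ ≤ 1 → |W (rc x) (x 2) - W (rc x') (x' 2)| ≤
      8 * (κ3 + 1) * M * (‖x - x'‖ * (1 + log (1 / κ)) + κ) := fun x x' κ hκ hκ1 => by
    apply of_four; rw [mul_sub, hW, hW]; exact ker2.b2 h.vb _ _ hκ hκ1
  have hJ : ∀ x x', v x - v x' = (U (rc x) (x 2) • eR x - U (rc x') (x' 2) • eR x') +
      (W (rc x) (x 2) - W (rc x') (x' 2)) • eZ := fun x x' => by
    rw [hv x, hv x', sub_smul]; abel
  constructor
  · intro x; rw [hv x]; refine (norm_add_le _ _).trans ?_; rw [norm_smul, norm_smul, norm_eq_abs, norm_eq_abs]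
    have w : |W (rc x) (x 2)| ≤ (κ3 + 1) * M := of_four (by rw [hW]; exact (ker2.b1 h.vb x).2)
    have uu : |U (rc x) (x 2)| * ‖eR x‖ ≤ (κ3 + 1) * M := by
      rcases (rc_nonneg x).eq_or_lt with h0 | h0
      · rw [eax x h0.symm]; simp; positivity
      · have : |U (rc x) (x 2)| ≤ (κ3 + 1) * M :=
          of_four (by rw [U1 _ _ h0]; exact (ker0.b1 h.vb _).2)
        nlinarith [eR_norm x, abs_nonneg (U (rc x) (x 2))]
    have := eZ_norm
    have : |W (rc x) (x 2)| * ‖eZ‖ ≤ (κ3 + 1) * M := by nlinarith [abs_nonneg (W (rc x) (x 2))]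
    unfold Cv; have : 0 ≤ (κ3 + 1) * M := by positivity
    linarith
  · intro x x' κ hκ hκ1; rw [hJ]; have hL : 0 ≤ log (1 / κ) := log_nonneg (by rw [le_div_iff₀ hκ]; linarith)
    set X := ‖x - x'‖ * (1 + log (1 / κ)) + κ with hX; have hX0 : 0 ≤ X := by positivity
    have hw := Wdiff x x' κ hκ hκ1
    refine (norm_add_le _ _).trans ?_
    have w1 : ‖(W (rc x) (x 2) - W (rc x') (x' 2)) • eZ‖ ≤ 8 * (κ3 + 1) * M * X := by
      rw [norm_smul, norm_eq_abs]; nlinarith [eZ_norm, abs_nonneg (W (rc x) (x 2) - W (rc x') (x' 2))]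
    have rdiff : |rc x - rc x'| ≤ ‖x - x'‖ := by
      have h1 := slice_dist x x'
      have h2 := coord_le (mk3 (rc x) 0 (x 2) - mk3 (rc x') 0 (x' 2)) 0
      simp at h2; exact h2.trans h1
    have u1 : ‖U (rc x) (x 2) • eR x - U (rc x') (x' 2) • eR x'‖ ≤ 100 * (κ3 + 1) * M * X := by
      have hC : 0 ≤ (κ3 + 1) * M * X := by positivity
      have single : ∀ r z (e : E3), 0 < r → r ≤ ‖x - x'‖ → ‖e‖ ≤ 1 → ‖U r z • e‖ ≤ 100 * (κ3 + 1) * M * X := by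
        intro r z e hr hrd he; rw [norm_smul, norm_eq_abs]; have h1 := Ubd r z κ hr hκ hκ1
        have h2 : 8 * (κ3 + 1) * M * (r * (1 + log (1 / κ)) + κ) ≤ 8 * (κ3 + 1) * M * X := by
          rw [hX]; gcongr
        nlinarith [abs_nonneg (U r z)]
      rcases (rc_nonneg x).eq_or_lt with h0 | h0
      · rw [eax x h0.symm, smul_zero, zero_sub, norm_neg]
        rcases (rc_nonneg x').eq_or_lt with h1 | h1
        · rw [eax x' h1.symm, smul_zero, norm_zero]; linarith
        · refine single _ _ _ h1 ?_ (eR_norm _)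
          rw [← h0, zero_sub, abs_neg] at rdiff; exact (le_abs_self _).trans rdiff
      · rcases (rc_nonneg x').eq_or_lt with h1 | h1
        · rw [eax x' h1.symm, smul_zero, sub_zero]; refine single _ _ _ h0 ?_ (eR_norm _); rw [← h1, sub_zero] at rdiff
          exact (le_abs_self _).trans rdiff
        · have e : U (rc x) (x 2) • eR x - U (rc x') (x' 2) • eR x' =
            (U (rc x) (x 2) - U (rc x') (x' 2)) • eR x + U (rc x') (x' 2) • (eR x - eR x') := by
            rw [sub_smul, smul_sub]; abel
          rw [e]; refine (norm_add_le _ _).trans ?_; rw [norm_smul, norm_smul, norm_eq_abs, norm_eq_abs]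
          have a1 := Udiff (rc x) (x 2) (rc x') (x' 2) κ h0 h1 hκ hκ1
          have a2 : 8 * (κ3 + 1) * M * (‖mk3 (rc x) 0 (x 2) - mk3 (rc x') 0 (x' 2)‖ * (1 + log (1 / κ)) + κ)
            ≤ 8 * (κ3 + 1) * M * X := by
            rw [hX]; gcongr; exact slice_dist x x'
          have a3 := Ubd (rc x') (x' 2) κ h1 hκ hκ1
          have a4 := eR_diff h0 h1
          have a5 : ‖eR x - eR x'‖ ≤ 2 := (norm_sub_le _ _).trans (by linarith [eR_norm x, eR_norm x'])
          have a6 : |U (rc x') (x' 2)| * ‖eR x - eR x'‖ ≤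
            8 * (κ3 + 1) * M * (rc x' * (1 + log (1 / κ)) + κ) * ‖eR x - eR x'‖ := by gcongr
          have a7 : (rc x' * (1 + log (1 / κ)) + κ) * ‖eR x - eR x'‖ ≤ 2 * X := by
            rw [hX]; have := mlr a4 (by linarith : 0 ≤ 1 + log (1 / κ))
            have := mll a5 hκ.le
            linarith
          have a8 := mll a7 (by positivity : 0 ≤ 8 * (κ3 + 1) * M)
          have a9 : |U (rc x) (x 2) - U (rc x') (x' 2)| * ‖eR x‖ ≤ 8 * (κ3 + 1) * M * X := by
            have := mul_le_mul (a1.trans a2) (eR_norm x) (norm_nonneg _) (by positivity)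
            linarith
          linarith
    unfold Cv; have hC : 0 ≤ (κ3 + 1) * M * X := by positivity
    linarith
  · intro c; rw [hv, eax _ (hax c)]; simp [eZ]
  · intro ρ D R c x hρ hD hR hx; have hD0 : 0 < D := by linarith
    set ζ := mk3 0 0 c with hζ; set S := ∫ y, ω y / rc y * Gk ρ R (y - ζ) with hS; have hSe : 8 * π * S = -3 * ∫ y, Sθ ρ R ζ y * ω y := by
      rw [hS, ← integral_const_mul, ← integral_const_mul]; congr 1; ext y; have e : (y - ζ) 0 ^ 2 + (y - ζ) 1 ^ 2 = rc y ^ 2 := by rw [rc_sq]; simp [hζ]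
      unfold Gk Sθ; rw [e, norm_sub_rev ζ y]
      by_cases hy : rc y = 0
      · simp [hy]
      · field_simp
    set r := rc x with hr; set z := x 2 with hz; have hr0 : 0 ≤ r := rc_nonneg x; have nn : ∀ a b : ℝ, a ^ 2 + b ^ 2 = r ^ 2 → ‖mk3 a b z - ζ‖ ≤ D := by
      intro a b hab; refine le_trans (sq_abs_le (norm_nonneg _) ?_) hx; rw [hζ, mk3_sub, mk3_norm_sq, nsq]; simp only [PiLp.sub_apply, mk3_0, mk3_1, mk3_2]
      have := rc_sq x
      nlinarith
    have n1 := nn r 0 (by ring)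
    have n2 := nn (-r) 0 (by ring)
    have n3 := nn 0 r (by ring)
    have n4 := nn 0 (-r) (by ring)
    have DD : 1 ≤ (D / ρ) ^ 3 := one_le_pow₀ (by rw [le_div_iff₀ hρ]; linarith)
    have fin : M * (100 * κ3 * D * (D / ρ) ^ 3 + 3 * D) ≤ 100 * (κ3 + 1) * M * D * (D / ρ) ^ 3 := by
      have : 0 ≤ M * D := by positivity
      nlinarith
    have Si : Integrable (fun y => Sθ ρ R ζ y * ω y) := by
      have := kb' (k := Sθ ρ R ζ) (c := 0) (p := fun _ => 0) (q := (ρ ^ 3)⁻¹) h.vb (Sθ_meas ρ R ζ)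
        ⟨integrable_zero _ _ _, fun _ => le_rfl, by simp⟩ (by positivity) (fun y _ => ?_) rc_ae
      · exact this.1
      · have hrq := rc_le_ax (ζ := ζ) (by simp [hζ]) (by simp [hζ]) y
        have hqz : |(y - ζ) 2| ≤ ‖ζ - y‖ := by rw [norm_sub_rev]; exact coord_le _ 2
        unfold Sθ; rw [zero_add]
        by_cases h1 : ‖ζ - y‖ ≤ ρ
        · rw [cutθ_zero hρ (by rwa [norm_sub_rev])]; simp; positivity
        · push Not at h1; have h0 : 0 < ‖ζ - y‖ := by linarith
          rw [abs_mul, abs_mul, abs_of_nonneg (cutθ_nonneg _ _ _),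
            abs_of_nonneg (a := (‖ζ - y‖ ^ 5)⁻¹) (by positivity)]
          calc _ ≤ (‖ζ - y‖ * ‖ζ - y‖) * (‖ζ - y‖ ^ 5)⁻¹ * 1 := by
                gcongr
                · exact cutθ_nonneg _ _ _
                · exact mul_bd hrq hqz
                · exact cutθ_le _ _ _
            _ = (‖ζ - y‖ ^ 3)⁻¹ := by field_simp
            _ ≤ _ := by gcongr
    have wW : |W r z - W (rc ζ) (ζ 2) + 2 * S * (z - c)| ≤ 100 * (κ3 + 1) * M * D * (D / ρ) ^ 3 := by
      refine le_trans (of_four ?_) fin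
      have i1 := (ker2.b1 h.vb (mk3 r 0 z)).1
      have i2 := (ker2.b1 h.vb (mk3 (-r) 0 z)).1
      have i3 := (ker2.b1 h.vb ζ).1
      have W1 := hW (mk3 r 0 z)
      have W2 := hW (mk3 (-r) 0 z)
      have W3 := hW ζ
      rw [(rc_mk r z hr0).1] at W1; rw [(rc_mk r z hr0).2.1] at W2; rw [mk3_2] at W1 W2; have e : 4 * π * (W r z - W (rc ζ) (ζ 2) + 2 * S * (z - c)) =
        1 / 2 * (KI l2 ω (mk3 r 0 z) + KI l2 ω (mk3 (-r) 0 z)) - KI l2 ω ζ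
          - 3 * (z - c) * ∫ y, Sθ ρ R ζ y * ω y := by linear_combination 1/2 * W1 + 1/2 * W2 - W3 + (z - c) * hSe
      rw [e]; unfold KI; rw [combW i1 i2 i3 Si]; have := (kb' h.vb (((((ker2.meask (mk3 r 0 z)).add (ker2.meask (mk3 (-r) 0 z))).const_mul (1/2)).sub
         (ker2.meask ζ)).sub ((Sθ_meas ρ R ζ).const_mul (3 * (z - c))))
         (pB_IB hρ hD ζ (mk3 r 0 z) (mk3 (-r) 0 z) (mk3 r 0 z) (mk3 r 0 z)) (by positivity)
         (fun y hy => b3W_pt hρ hD hR n1 n2 y hy) rc_ae).2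
      refine le_trans (le_of_eq ?_) this
      congr 2; ext y
      simp only [Pi.sub_apply, Pi.add_apply]; ring
    have uU : 0 < r → |U r z - S * r| ≤ 100 * (κ3 + 1) * M * D * (D / ρ) ^ 3 := by
      intro hrp; refine le_trans (of_four ?_) fin; have i1 := (ker0.b1 h.vb (mk3 r 0 z)).1; have i2 := (ker0.b1 h.vb (mk3 (-r) 0 z)).1
      have i3 := (ker1.b1 h.vb (mk3 0 r z)).1
      have i4 := (ker1.b1 h.vb (mk3 0 (-r) z)).1
      have e : 4 * π * (U r z - S * r) =
        1 / 4 * (KI l0 ω (mk3 r 0 z) - KI l0 ω (mk3 (-r) 0 z) + KI l1 ω (mk3 0 r z)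
          - KI l1 ω (mk3 0 (-r) z)) - (-(3 / 2 * r)) * ∫ y, Sθ ρ R ζ y * ω y := by
        linear_combination 1/4 * U1 r z hrp + 1/4 * U2 r z hrp + 1/4 * U3 r z hrp
          + 1/4 * U4 r z hrp - r / 2 * hSe
      rw [e]; unfold KI; rw [combU i1 i2 i3 i4 Si]; have := (kb' h.vb ((((((ker0.meask (mk3 r 0 z)).sub (ker0.meask (mk3 (-r) 0 z))).add
         (ker1.meask (mk3 0 r z))).sub (ker1.meask (mk3 0 (-r) z))).const_mul (1/4)).sub
          ((Sθ_meas ρ R ζ).const_mul (-(3 / 2 * r))))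
         (pB_IB hρ hD ζ (mk3 r 0 z) (mk3 (-r) 0 z) (mk3 0 r z) (mk3 0 (-r) z)) (by positivity)
         (fun y hy => b3U_pt hρ hD hR n1 n2 n3 n4 y hy) rc_ae).2
      refine le_trans (le_of_eq ?_) this
      congr 2; ext y
      simp only [Pi.sub_apply, Pi.add_apply]; ring
    have eq : v x - v ζ - S • Jm (x - ζ) = (U r z - S * r) • eR x +
        (W r z - W (rc ζ) (ζ 2) + 2 * S * (z - c)) • eZ := by
      rw [hv x, hv ζ, eax ζ (hax c)]; have r0 : r * (x 0 / r) = x 0 ∧ r * (x 1 / r) = x 1 := by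
        rcases hr0.eq_or_lt with h0 | h0
        · have := rc0 (hr ▸ h0.symm : rc x = 0)
          simp [this]
        · constructor <;> field_simp
      ext i; fin_cases i
      · simp [eR, eZ, Jm, hζ]; linear_combination S * r0.1
      · simp [eR, eZ, Jm, hζ]; linear_combination S * r0.2
      · simp [eR, eZ, Jm, hζ]; ring
    rw [eq]; refine (norm_add_le _ _).trans ?_; rw [norm_smul, norm_smul, norm_eq_abs, norm_eq_abs]; set B := 100 * (κ3 + 1) * M * D * (D / ρ) ^ 3 with hB
    have hB0 : 0 ≤ B := by positivity
    have f1 : |W r z - W (rc ζ) (ζ 2) + 2 * S * (z - c)| * ‖eZ‖ ≤ B * 1 :=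
      mul_le_mul wW eZ_norm (norm_nonneg _) hB0
    have f2 : |U r z - S * r| * ‖eR x‖ ≤ B := by
      rcases hr0.eq_or_lt with h0 | h0
      · rw [eax x (hr ▸ h0.symm)]; simpa using hB0
      · have := mul_le_mul (uU h0) (eR_norm x) (norm_nonneg _) hB0
        linarith
    unfold Cv
    calc _ ≤ 2 * B := by linarith
      _ ≤ 10 * B := by linarith
      _ = _ := by rw [hB]; ring

def nb (R : ℝ) : E3 → ℝ := indicator (Metric.closedBall 0 R) (fun x => (rc x)⁻¹)

lemma half_int (R : ℝ) (hR : 0 ≤ R) : Integrable (indicator (Icc (-R) R) (fun a : ℝ => |a| ^ (-(1/2) : ℝ))) := by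
  rw [integrable_indicator_iff measurableSet_Icc]; have h1 : IntegrableOn (fun a : ℝ => |a| ^ (-(1/2) : ℝ)) (Icc 0 R) := by
    have := (intervalIntegral.intervalIntegrable_rpow' (r := -(1/2)) (a := 0) (b := R) (by norm_num))
    rw [intervalIntegrable_iff_integrableOn_Icc_of_le hR] at this; refine this.congr_fun (fun a ha => ?_) measurableSet_Icc
    simp only [abs_of_nonneg ha.1]
  have h2 : IntegrableOn (fun a : ℝ => |a| ^ (-(1/2) : ℝ)) (Icc (-R) 0) := by
    have := ((Measure.measurePreserving_neg (volume : Measure ℝ)).integrableOn_comp_preimage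
      (Homeomorph.neg ℝ).measurableEmbedding (f := fun a : ℝ => |a| ^ (-(1/2) : ℝ)) (s := Icc 0 R)).2 h1
    have e : (Neg.neg ⁻¹' Icc (0:ℝ) R) = Icc (-R) 0 := by
      ext x; simp [and_comm]
    rw [e] at this; refine this.congr_fun (fun a ha => by simp) measurableSet_Icc
  have := h2.union h1
  rwa [Icc_union_Icc_eq_Icc (by linarith) hR] at this

lemma nb_meas (R : ℝ) : Measurable (nb R) :=
  (rc_cont.measurable.inv).indicator Metric.isClosed_closedBall.measurableSet

lemma nb_nonneg (R : ℝ) (x : E3) : 0 ≤ nb R x :=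
  indicator_nonneg (fun x _ => inv_nonneg.2 (rc_nonneg x)) x

lemma nb_int (R : ℝ) : Integrable (nb R) := by
  rcases lt_or_ge R 0 with hR | hR
  · have : nb R = 0 := by ext x; simp [nb, Metric.closedBall_eq_empty.2 hR]
    rw [this]; exact integrable_zero _ _ _
  let φ : Fin 3 → ℝ → ℝ := ![indicator (Icc (-R) R) (fun a : ℝ => |a| ^ (-(1/2) : ℝ)),
    indicator (Icc (-R) R) (fun a : ℝ => |a| ^ (-(1/2) : ℝ)), indicator (Icc (-R) R) (fun a : ℝ => 1)]
  have h : Integrable (fun x : Fin 3 → ℝ => ∏ i, φ i (x i)) := by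
    refine Integrable.fintype_prod fun i => ?_
    fin_cases i
    · exact half_int R hR
    · exact half_int R hR
    · exact (integrable_indicator_iff measurableSet_Icc).2 (by simp)
  have h2 := (PiLp.volume_preserving_ofLp (Fin 3)).integrable_comp_of_integrable h
  have ae : ∀ᵐ y : E3, y 0 ≠ 0 ∧ y 1 ≠ 0 := by
    have key : ∀ i : Fin 3, ∀ᵐ y : E3, y i ≠ 0 := by
      intro i; have h : volume ((LinearMap.ker (EuclideanSpace.proj i : E3 →L[ℝ] ℝ).toLinearMap : Submodule ℝ E3) : Set E3) = 0 := by
        apply Measure.addHaar_submodule; intro h; have : EuclideanSpace.single i (1 : ℝ) ∈ (⊤ : Submodule ℝ E3) := trivial; rw [← h] at this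
        simp at this
      rw [ae_iff]; refine measure_mono_null (fun y hy => ?_) h
      simpa using hy
    filter_upwards [key 0, key 1] with y h0 h1 using ⟨h0, h1⟩
  refine h2.mono' (nb_meas R).aestronglyMeasurable ?_
  filter_upwards [ae] with y hy
  rw [norm_eq_abs, abs_of_nonneg (nb_nonneg R y)]; have pos : 0 ≤ ∏ i, φ i (y i) := by
    refine Finset.prod_nonneg fun i _ => ?_
    have h1 : ∀ a, 0 ≤ indicator (Icc (-R) R) (fun a : ℝ => |a| ^ (-(1/2) : ℝ)) a :=
      indicator_nonneg (fun x _ => by positivity)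
    have h2 : ∀ a, 0 ≤ indicator (Icc (-R) R) (fun a : ℝ => (1:ℝ)) a :=
      indicator_nonneg (fun x _ => by positivity)
    fin_cases i
    · exact h1 _
    · exact h1 _
    · exact h2 _
  unfold nb
  by_cases hm : y ∈ Metric.closedBall (0 : E3) R
  · rw [indicator_of_mem hm]; have hn : ‖y‖ ≤ R := by simpa using hm
    have hi : ∀ i, y i ∈ Icc (-R) R := fun i => by
      have := (coord_le y i).trans hn
      rwa [abs_le] at this
    simp only [Function.comp, φ, Fin.prod_univ_three, Matrix.cons_val_zero, Matrix.cons_val_one,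
      Matrix.cons_val, indicator_of_mem (hi _), mul_one]
    have a0 : 0 < |y 0| := abs_pos.2 hy.1
    have a1 : 0 < |y 1| := abs_pos.2 hy.2
    rw [← mul_rpow a0.le a1.le, rpow_neg (by positivity), ← sqrt_eq_rpow]
    apply inv_anti₀ (by positivity)
    unfold rc; apply sqrt_le_sqrt; nlinarith [sq_nonneg (|y 0| - |y 1|), sq_abs (y 0), sq_abs (y 1)]
  · rw [indicator_of_notMem hm]; exact pos

def νI (R : ℝ) : ℝ := ∫ x, nb R x

lemma νI_nonneg (R : ℝ) : 0 ≤ νI R := integral_nonneg (nb_nonneg R)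

lemma nb_of_le {R : ℝ} {x : E3} (h : ‖x‖ ≤ R) : nb R x = (rc x)⁻¹ :=
  indicator_of_mem (by simpa using h) _

abbrev mT (T : ℝ) : Measure (E3 × ℝ) := (volume : Measure E3).prod (volume.restrict (Ioo 0 T))

structure FL (T M : ℝ) (f0 : E3 → ℝ) (f : E3 → ℝ → ℝ) (u : E3 → ℝ → E3) : Prop where
  T0 : 0 < T
  M1 : 1 ≤ M
  f0i : Integrable f0
  fm : AEStronglyMeasurable (fun p : E3 × ℝ => f p.1 p.2) (mT T)
  um : AEStronglyMeasurable (fun p : E3 × ℝ => u p.1 p.2) (mT T)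
  fb : ∀ x t, |f x t| ≤ M * (rc x)⁻¹
  gf : ∀ t, GF Cv M (fun y => f y t) (fun y => u y t)
  weak : ∀ (φ : E3 → ℝ) (θ : ℝ → ℝ), CD φ → HasCompactSupport φ →
    CD θ → HasCompactSupport θ → tsupport θ ⊆ Iio T →
    (∫ p, f p.1 p.2 * (φ p.1 * deriv θ p.2 + fderiv ℝ φ p.1 (u p.1 p.2) * θ p.2) ∂(mT T))
      + (∫ x, f0 x * φ x) * θ 0 = 0

lemma mT_eq (T : ℝ) : (volume : Measure (E3 × ℝ)).restrict (univ ×ˢ Ioo 0 T) = mT T := by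
  rw [Measure.volume_eq_prod, ← Measure.prod_restrict, Measure.restrict_univ]

lemma Cv_pos : 0 < Cv := by have := κ3_nonneg; unfold Cv; linarith

lemma GF_zero {M : ℝ} (hM : 0 ≤ M) : GF Cv M (fun _ => 0) (fun _ => 0) := by
  have := Cv_pos
  refine ⟨fun x => by simp; positivity, fun x x' κ h1 h2 => ?_, fun c => by simp, fun ρ D R c x h1 h2 h3 h4 => ?_⟩
  · have : 0 ≤ log (1 / κ) := log_nonneg (by rw [le_div_iff₀ h1]; linarith)
    rw [sub_self, norm_zero]; positivity
  · have : 0 < D := by linarith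
    simp; positivity

theorem FL.of_sol {T : ℝ} (hT : 0 < T) {ω₀ : E3 → ℝ} {u : E3 → ℝ → E3} {ω : E3 → ℝ → ℝ}
    (h0 : Integrable (fun x => ω₀ x / rc x)) (h : IsYudovichSolution T ω₀ u ω) :
    ∃ M f u', FL T M (fun x => ω₀ x / rc x) f u' := by
  obtain ⟨M0, hM0⟩ := h.bounded; obtain ⟨Ur, Uz, hsw⟩ := h.no_swirl; set M := max M0 1 with hM; have M1 : 1 ≤ M := le_max_right _ _
  have Mp : 0 ≤ M := by linarith
  have um0 : AEStronglyMeasurable (fun p : E3 × ℝ => u p.1 p.2) (mT T) := by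
    rw [← mT_eq]; exact h.u_loc.aestronglyMeasurable
  have fm0 : AEStronglyMeasurable (fun p : E3 × ℝ => ω p.1 p.2 / rc p.1) (mT T) := by
    have := h.relvort_loc.aestronglyMeasurable.mono_measure
      (Measure.restrict_mono (prod_mono_right (s := univ) Ioo_subset_Ico_self) le_rfl)
    rwa [mT_eq] at this
  have fm1 : ∀ᵐ t ∂(volume.restrict (Ioo 0 T)), AEStronglyMeasurable (fun x => ω x t / rc x) volume := by
    exact fm0.prod_swap.prodMk_left
  have good : ∀ᵐ t ∂(volume.restrict (Ioo 0 T)), SW M (fun y => ω y t) (fun y => u y t) := by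
    filter_upwards [hM0, h.biot_savart, fm1] with t ht hb hm
    have hm' : AEStronglyMeasurable (fun x => ω x t) volume := by
      have := hm.mul (rc_cont.aestronglyMeasurable (μ := volume))
      refine this.congr ?_
      filter_upwards [rc_ae] with x hx
      simp only [Pi.mul_apply]; field_simp
    have hle : ENNReal.ofReal M0 ≤ ENNReal.ofReal M := ENNReal.ofReal_le_ofReal (le_max_left _ _)
    have hint : Integrable (fun x => ω x t) := by
      rw [← memLp_one_iff_integrable]; exact ⟨hm', ht.2.trans_lt ENNReal.ofReal_lt_top⟩
    refine ⟨⟨Mp, hint, ?_, ?_⟩, ⟨fun a b => Ur a b t, fun a b => Uz a b t, fun x => hsw x t⟩, hb⟩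
    · have h1 := ht.1.trans hle
      rw [eLpNorm_exponent_top] at h1
      filter_upwards [enorm_ae_le_eLpNormEssSup (fun x => ω x t) volume] with x hx
      have := hx.trans h1
      rwa [Real.enorm_eq_ofReal_abs, ENNReal.ofReal_le_ofReal_iff Mp] at this
    · have h1 := ht.2.trans hle
      rw [eLpNorm_one_eq_lintegral_enorm, ← ofReal_integral_norm_eq_lintegral_enorm hint,
        ENNReal.ofReal_le_ofReal_iff Mp] at h1
      exact h1
  classical
  set G : Set ℝ := {t | SW M (fun y => ω y t) (fun y => u y t)} with hG
  let f : E3 → ℝ → ℝ := fun x t => if t ∈ G then max (-(M * (rc x)⁻¹)) (min (ω x t / rc x) (M * (rc x)⁻¹)) else 0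
  let u' : E3 → ℝ → E3 := fun x t => if t ∈ G then u x t else 0
  have hGp : ∀ᵐ p ∂(mT T), p.2 ∈ G := Measure.quasiMeasurePreserving_snd.ae good
  have Mr : ∀ x : E3, 0 ≤ M * (rc x)⁻¹ := fun x => mul_nonneg Mp (inv_nonneg.2 (rc_nonneg x))
  have feq : ∀ t ∈ G, ∀ᵐ x, f x t = ω x t / rc x := by
    intro t ht
    filter_upwards [ht.vb.2.2.1] with x hx
    have h1 : |ω x t / rc x| ≤ M * (rc x)⁻¹ := by
      rw [abs_div, abs_of_nonneg (rc_nonneg x), div_eq_mul_inv]; exact mlr hx (inv_nonneg.2 (rc_nonneg x))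
    rw [abs_le] at h1; simp only [f, if_pos ht, min_eq_left h1.2, max_eq_right h1.1]
  have cm : AEStronglyMeasurable (fun p : E3 × ℝ => max (-(M * (rc p.1)⁻¹)) (min (ω p.1 p.2 / rc p.1) (M * (rc p.1)⁻¹))) (mT T) := by
    have hr : AEStronglyMeasurable (fun p : E3 × ℝ => M * (rc p.1)⁻¹) (mT T) :=
      ((rc_cont.measurable.comp measurable_fst).inv.const_mul M).aestronglyMeasurable
    exact hr.neg.sup (fm0.inf hr)
  have fm : AEStronglyMeasurable (fun p : E3 × ℝ => f p.1 p.2) (mT T) := by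
    refine cm.congr ?_
    filter_upwards [hGp] with p hp
    simp only [f, if_pos hp]
  have fae : ∀ᵐ p ∂(mT T), f p.1 p.2 = ω p.1 p.2 / rc p.1 := by
    have hz : ∀ᵐ p ∂(mT T), f p.1 p.2 - ω p.1 p.2 / rc p.1 = 0 := by
      have hs : AEStronglyMeasurable (fun p : E3 × ℝ => f p.1 p.2 - ω p.1 p.2 / rc p.1) (mT T) := fm.sub fm0
      have hsw := hs.prod_swap
      have key : ∀ᵐ q ∂((volume.restrict (Ioo 0 T)).prod (volume : Measure E3)),
          f q.2 q.1 - ω q.2 q.1 / rc q.2 = 0 := by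
        have hl : ∫⁻ q, ‖f q.2 q.1 - ω q.2 q.1 / rc q.2‖ₑ ∂((volume.restrict (Ioo 0 T)).prod (volume : Measure E3)) = 0 := by
          rw [lintegral_prod _ (by exact hsw.enorm)]
          rw [lintegral_eq_zero_of_ae_eq_zero]
          filter_upwards [good] with t ht
          rw [Pi.zero_apply]; apply lintegral_eq_zero_of_ae_eq_zero
          filter_upwards [feq t ht] with x hx
          simp [hx]
        rw [lintegral_eq_zero_iff' (by exact hsw.enorm)] at hl
        filter_upwards [hl] with q hq
        simpa using hq
      have := (Measure.measurePreserving_swap (μ := (volume : Measure E3)) (ν := volume.restrict (Ioo 0 T))).quasiMeasurePreserving.ae key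
      exact this
    filter_upwards [hz] with p hp
    linarith
  refine ⟨M, f, u', hT, M1, h0, fm, ?_, ?_, ?_, ?_⟩
  · refine um0.congr ?_
    filter_upwards [hGp] with p hp
    simp only [u', if_pos hp]
  · intro x t; simp only [f]
    split_ifs with ht
    · rw [abs_le]; exact ⟨le_max_left _ _, max_le (by linarith [Mr x]) (min_le_right _ _)⟩
    · simpa using Mr x
  · intro t
    by_cases ht : t ∈ G
    · have := SW.gf ht
      have e : (fun y => u' y t) = fun y => u y t := by ext1 y; simp only [u', if_pos ht]
      rw [e]; refine ⟨this.bd, this.lip, this.ax, ?_⟩; intro ρ D R c x h1 h2 h3 h4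
      have e2 : (∫ y, f y t * Gk ρ R (y - mk3 0 0 c)) = ∫ y, ω y t / rc y * Gk ρ R (y - mk3 0 0 c) := by
        apply integral_congr_ae
        filter_upwards [feq t ht] with y hy
        simp only [hy]
      rw [e2]; exact this.exp ρ D R c x h1 h2 h3 h4
    · have e : (fun y => u' y t) = fun y => 0 := by ext1 y; simp only [u', if_neg ht]
      have e2 : (fun y => f y t) = fun y => 0 := by ext1 y; simp only [f, if_neg ht]
      rw [e, e2]; exact GF_zero Mp
  · intro φ θ hφ cφ hθ cθ sθ; have key := h.transport (fun p => φ p.1 * θ p.2) ((hφ.comp contDiff_fst).mul (hθ.comp contDiff_snd)) ?_ ?_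
    · rw [mT_eq] at key; refine Eq.trans ?_ key; congr 1
      · apply integral_congr_ae
        filter_upwards [fae, hGp] with p hp hpG
        simp only [hp, u', if_pos hpG]; have e1 : deriv (fun s => φ p.1 * θ s) p.2 = φ p.1 * deriv θ p.2 :=
          deriv_const_mul _ (hθ.differentiable (by simp)).differentiableAt
        have e2 : fderiv ℝ (fun y => φ y * θ p.2) p.1 = θ p.2 • fderiv ℝ φ p.1 :=
          fderiv_mul_const (hφ.differentiable (by simp)).differentiableAt _
        rw [e1, e2]; simp only [smul_apply, smul_eq_mul]; ring
      · rw [← integral_mul_const]; congr 1; ext x; ring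
    · refine HasCompactSupport.of_support_subset_isCompact (cφ.isCompact.prod cθ.isCompact) ?_
      intro p hp; simp only [Function.mem_support] at hp; exact ⟨subset_tsupport _ (left_ne_zero_of_mul hp), subset_tsupport _ (right_ne_zero_of_mul hp)⟩
    · have : tsupport (fun p : E3 × ℝ => φ p.1 * θ p.2) ⊆ univ ×ˢ tsupport θ := by
        refine closure_minimal ?_ (isClosed_univ.prod (isClosed_tsupport _))
        intro p hp; simp only [Function.mem_support] at hp; exact ⟨trivial, subset_tsupport _ (right_ne_zero_of_mul hp)⟩
      exact this.trans (prod_mono_right sθ)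

lemma abs_int_le {α : Type*} [MeasurableSpace α] {μ : Measure α} {a b : α → ℝ} (hb : Integrable b μ)
    (h : ∀ x, |a x| ≤ b x) : |∫ x, a x ∂μ| ≤ ∫ x, b x ∂μ :=
  by rw [← norm_eq_abs]; exact norm_integral_le_of_norm_le hb (Eventually.of_forall h)
lemma abs_ii_le {a : ℝ → ℝ} {c s t : ℝ} (h : ∀ x, |a x| ≤ c) : |∫ x in s..t, a x| ≤ c * |t - s| :=
  by rw [← norm_eq_abs]; exact intervalIntegral.norm_integral_le_of_norm_le_const fun x _ => h x

structure TF (R l : ℝ) (φ : E3 → ℝ) : Prop where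
  sm : CD φ
  sp : ∀ x, R < ‖x‖ → φ x = 0
  l1 : ∀ x, ‖fderiv ℝ φ x‖ ≤ l

lemma TF.cs {R l φ} (h : TF R l φ) : HasCompactSupport φ :=
  HasCompactSupport.intro (isCompact_closedBall (0 : E3) R) (fun x hx => h.sp x (by simpa using hx))

lemma TF.sp' {R l φ} (h : TF R l φ) (x : E3) (hx : R < ‖x‖) : fderiv ℝ φ x = 0 := by
  have : φ =ᶠ[nhds x] fun _ => 0 := by
    filter_upwards [(isOpen_lt continuous_const continuous_norm).mem_nhds hx] with y hy using h.sp y hy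
  rw [this.fderiv_eq]; simp

lemma TF.diff {R l φ} (h : TF R l φ) : Differentiable ℝ φ := h.sm.differentiable (by simp)
lemma TF.l0 {R l φ} (h : TF R l φ) : 0 ≤ l := (norm_nonneg _).trans (h.l1 0)
lemma TF.cfd {R l φ} (h : TF R l φ) : Continuous (fderiv ℝ φ) := h.sm.continuous_fderiv (by simp)

lemma TF.bd {R l φ} (h : TF R l φ) : ∃ N, ∀ x, |φ x| ≤ N := by
  obtain ⟨N, hN⟩ := h.cs.exists_bound_of_continuous h.sm.continuous; exact ⟨N, hN⟩

def Ff (f : E3 → ℝ → ℝ) (φ : E3 → ℝ) (s : ℝ) : ℝ := ∫ x, f x s * φ x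
def Hf (f : E3 → ℝ → ℝ) (u : E3 → ℝ → E3) (φ : E3 → ℝ) (s : ℝ) : ℝ := ∫ x, f x s * fderiv ℝ φ x (u x s)
def Ee (f0 : E3 → ℝ) (f : E3 → ℝ → ℝ) (u : E3 → ℝ → E3) (φ : E3 → ℝ) (t : ℝ) : ℝ :=
  (∫ x, f0 x * φ x) + ∫ s in (0:ℝ)..t, Hf f u φ s

section
variable {T M : ℝ} {f0 : E3 → ℝ} {f : E3 → ℝ → ℝ} {u : E3 → ℝ → E3}

lemma FL.fk (h : FL T M f0 f u) {R N : ℝ} {x : E3} {k s : ℝ} (hk : |k| ≤ N) (hs : R < ‖x‖ → k = 0) :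
    |f x s * k| ≤ M * N * nb R x := by
  by_cases hx : ‖x‖ ≤ R
  · rw [nb_of_le hx, abs_mul]; have := mul_le_mul (h.fb x s) hk (abs_nonneg _) (mul_nonneg (by linarith [h.M1]) (inv_nonneg.2 (rc_nonneg x)))
    linarith
  · rw [hs (not_le.1 hx)]; have h1 : 0 ≤ N := (abs_nonneg _).trans hk; have := nb_nonneg R x; have := h.M1; simp; positivity

lemma FL.int (h : FL T M f0 f u) {R N : ℝ} {k : E3 × ℝ → ℝ} (hm : AEStronglyMeasurable k (mT T))
    (hk : ∀ p, |k p| ≤ N) (hs : ∀ p, R < ‖p.1‖ → k p = 0) :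
    Integrable (fun p => f p.1 p.2 * k p) (mT T) := by
  have hi : Integrable (fun p : E3 × ℝ => M * N * nb R p.1) (mT T) :=
    ((nb_int R).const_mul (M * N)).comp_fst _
  refine hi.mono' (h.fm.mul hm) (Eventually.of_forall fun p => ?_)
  exact h.fk (hk p) (hs p)

lemma FL.ub (h : FL T M f0 f u) (x : E3) (s : ℝ) : ‖u x s‖ ≤ Cv * M := (h.gf s).bd x

lemma TF.fd_bd (h : FL T M f0 f u) {R l φ} (hφ : TF R l φ) (x : E3) (s : ℝ) :
    |fderiv ℝ φ x (u x s)| ≤ l * (Cv * M) := by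
  have := (fderiv ℝ φ x).le_opNorm (u x s)
  rw [norm_eq_abs] at this; exact this.trans (mul_le_mul (hφ.l1 x) (h.ub x s) (norm_nonneg _) hφ.l0)

lemma FL.fd_meas (h : FL T M f0 f u) {φ : E3 → ℝ} (hφ : Continuous (fderiv ℝ φ)) :
    AEStronglyMeasurable (fun p : E3 × ℝ => fderiv ℝ φ p.1 (u p.1 p.2)) (mT T) := by
  have := (isBoundedBilinearMap_apply (𝕜 := ℝ) (E := E3) (F := ℝ)).continuous.comp_aestronglyMeasurable
    ((hφ.comp continuous_fst).aestronglyMeasurable.prodMk h.um)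
  exact this

lemma FL.intF (h : FL T M f0 f u) {R l φ} (hφ : TF R l φ) :
    Integrable (fun p => f p.1 p.2 * φ p.1) (mT T) := by
  obtain ⟨N, hN⟩ := hφ.bd; exact h.int (k := fun p => φ p.1) (hφ.sm.continuous.comp continuous_fst).aestronglyMeasurable (fun p => hN p.1)
    (fun p hp => hφ.sp _ hp)

lemma FL.intH (h : FL T M f0 f u) {R l φ} (hφ : TF R l φ) :
    Integrable (fun p => f p.1 p.2 * fderiv ℝ φ p.1 (u p.1 p.2)) (mT T) :=
  h.int (k := fun p => fderiv ℝ φ p.1 (u p.1 p.2)) (h.fd_meas hφ.cfd) (fun p => hφ.fd_bd h p.1 p.2)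
    (fun p hp => by rw [hφ.sp' _ hp]; simp)

lemma FL.F_int (h : FL T M f0 f u) {R l φ} (hφ : TF R l φ) : IntegrableOn (Ff f φ) (Ioo 0 T) :=
  (h.intF hφ).integral_prod_right
lemma FL.H_int (h : FL T M f0 f u) {R l φ} (hφ : TF R l φ) : IntegrableOn (Hf f u φ) (Ioo 0 T) :=
  (h.intH hφ).integral_prod_right

lemma FL.H_bd (h : FL T M f0 f u) {R l φ} (hφ : TF R l φ) (s : ℝ) :
    |Hf f u φ s| ≤ M * (l * (Cv * M)) * νI R := by
  unfold Hf νI; rw [← integral_const_mul]; exact abs_int_le ((nb_int R).const_mul _) (fun x =>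
    h.fk (hφ.fd_bd h x s) (fun hx => by rw [hφ.sp' _ hx]; simp))

lemma FL.H_ii (h : FL T M f0 f u) {R l φ} (hφ : TF R l φ) {a b : ℝ} (ha : a ∈ Ico 0 T) (hb : b ∈ Ico 0 T) :
    IntervalIntegrable (Hf f u φ) volume a b := by
  rw [intervalIntegrable_iff]; refine (h.H_int hφ).mono_set ?_; intro x hx; rw [uIoc, mem_Ioc] at hx
  exact ⟨lt_of_le_of_lt (le_min ha.1 hb.1) hx.1, lt_of_le_of_lt hx.2 (max_lt ha.2 hb.2)⟩

lemma FL.E_lip (h : FL T M f0 f u) {R l φ} (hφ : TF R l φ) {a b : ℝ} (ha : a ∈ Ico 0 T) (hb : b ∈ Ico 0 T) :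
    |Ee f0 f u φ b - Ee f0 f u φ a| ≤ M * (l * (Cv * M)) * νI R * |b - a| := by
  have z : (0:ℝ) ∈ Ico 0 T := ⟨le_rfl, h.T0⟩
  have e : Ee f0 f u φ b - Ee f0 f u φ a = ∫ s in a..b, Hf f u φ s := by
    unfold Ee; rw [← intervalIntegral.integral_interval_sub_left (h.H_ii hφ z hb) (h.H_ii hφ z ha)]; ring
  rw [e]; exact abs_ii_le fun s => h.H_bd hφ s

lemma FL.weak1 (h : FL T M f0 f u) {R l φ} (hφ : TF R l φ) {θ : ℝ → ℝ} (hθ : CD θ)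
    (cθ : HasCompactSupport θ) (sθ : tsupport θ ⊆ Iio T) :
    (∫ s in Ioo 0 T, (Ff f φ s * deriv θ s + Hf f u φ s * θ s)) + (∫ x, f0 x * φ x) * θ 0 = 0 := by
  refine Eq.trans ?_ (h.weak φ θ hφ.sm hφ.cs hθ cθ sθ)
  congr 1
  have i : Integrable (fun p : E3 × ℝ => f p.1 p.2 * (φ p.1 * deriv θ p.2 + fderiv ℝ φ p.1 (u p.1 p.2) * θ p.2)) (mT T) := by
    obtain ⟨N, hN⟩ := hφ.bd; obtain ⟨N1, hN1⟩ := cθ.exists_bound_of_continuous hθ.continuous; have cd : Continuous (deriv θ) := hθ.continuous_deriv (by simp)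
    obtain ⟨N2, hN2⟩ := cθ.deriv.exists_bound_of_continuous cd; refine h.int (R := R) (N := N * N2 + l * (Cv * M) * N1)
      (((hφ.sm.continuous.comp continuous_fst).mul (cd.comp continuous_snd)).aestronglyMeasurable.add
        ((h.fd_meas hφ.cfd).mul (hθ.continuous.comp continuous_snd).aestronglyMeasurable)) (fun p => ?_) (fun p hp => ?_)
    · refine (abs_add_le _ _).trans ?_
      rw [abs_mul, abs_mul]; have a1 := hN2 p.2; have a2 := hN1 p.2; rw [norm_eq_abs] at a1 a2
      exact add_le_add (mul_le_mul (hN _) a1 (abs_nonneg _) ((abs_nonneg _).trans (hN 0)))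
        (mul_le_mul (hφ.fd_bd h _ _) a2 (abs_nonneg _) ((abs_nonneg _).trans (hφ.fd_bd h 0 0)))
    · rw [hφ.sp _ hp, hφ.sp' _ hp]; simp
  rw [integral_prod_symm _ i]; apply integral_congr_ae
  filter_upwards [(h.intF hφ).prod_left_ae, (h.intH hφ).prod_left_ae] with s h1 h2
  simp only [Ff, Hf]; rw [← integral_mul_const, ← integral_mul_const, ← integral_add (h1.mul_const _) (h2.mul_const _)]; congr 1; ext x; ring

lemma prim_test {T : ℝ} {g : ℝ → ℝ} (hT : 0 < T) (hg : CD g) (cg : HasCompactSupport g)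
    (sg : tsupport g ⊆ Ioo 0 T) : ∃ θ : ℝ → ℝ, CD θ ∧ HasCompactSupport θ ∧ tsupport θ ⊆ Iio T ∧
      (∀ s ∈ Ico 0 T, θ s = - ∫ t in s..T, g t) ∧ ∀ s ∈ Ioo 0 T, deriv θ s = g s := by
  have hg0 : ∀ t, t ∉ Ioo 0 T → g t = 0 := fun t ht => image_eq_zero_of_notMem_tsupport (fun h => ht (sg h))
  obtain ⟨b, hb, hbg⟩ : ∃ b < T, ∀ t, b < t → g t = 0 := by
    rcases (tsupport g).eq_empty_or_nonempty with he | hne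
    · exact ⟨0, hT, fun t _ => image_eq_zero_of_notMem_tsupport (by simp [he])⟩
    · obtain ⟨b, hb, hmax⟩ := cg.isCompact.exists_isGreatest hne
      exact ⟨b, (sg hb).2, fun t ht => image_eq_zero_of_notMem_tsupport (fun h => absurd (hmax h) (not_le.2 ht))⟩
  set θ0 : ℝ → ℝ := fun s => ∫ t in T..s, g t with hθ0
  have hd : ∀ s, HasDerivAt θ0 (g s) s := fun s =>
    intervalIntegral.integral_hasDerivAt_right (hg.continuous.intervalIntegrable _ _)
      hg.continuous.stronglyMeasurable.stronglyMeasurableAtFilter hg.continuous.continuousAt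
  have sm0 : CD θ0 := by
    rw [contDiff_infty_iff_deriv]; refine ⟨fun s => (hd s).differentiableAt, ?_⟩
    rwa [show deriv θ0 = g from funext fun s => (hd s).deriv]
  have smc : CD (fun s : ℝ => Real.smoothTransition (s + 2)) :=
    Real.smoothTransition.contDiff.comp (contDiff_id.add contDiff_const)
  have z : ∀ s, b < s → θ0 s = 0 := by
    intro s hs; simp only [hθ0]; apply intervalIntegral.integral_zero_ae; refine Eventually.of_forall fun t ht => hbg t ?_
    rw [uIoc, mem_Ioc] at ht; exact lt_trans (lt_min hb hs) ht.1
  have ev : ∀ s, -1 < s → (fun s => Real.smoothTransition (s + 2) * θ0 s) =ᶠ[nhds s] θ0 := by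
    intro s hs
    filter_upwards [isOpen_Ioi.mem_nhds hs] with t ht
    rw [Real.smoothTransition.one_of_one_le (by linarith [mem_Ioi.1 ht]), one_mul]
  have sub : Function.support (fun s => Real.smoothTransition (s + 2) * θ0 s) ⊆ Icc (-2) b := by
    intro s hs; rw [Function.mem_support] at hs
    by_contra hc
    rw [mem_Icc, not_and_or, not_le, not_le] at hc
    rcases hc with hc | hc
    · exact hs (by rw [Real.smoothTransition.zero_of_nonpos (by linarith), zero_mul])
    · exact hs (by rw [z s hc, mul_zero])
  refine ⟨fun s => Real.smoothTransition (s + 2) * θ0 s, smc.mul sm0, ?_, ?_, ?_, ?_⟩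
  · exact HasCompactSupport.of_support_subset_isCompact isCompact_Icc sub
  · exact (closure_minimal sub isClosed_Icc).trans (fun x hx => lt_of_le_of_lt hx.2 hb)
  · intro s hs; refine (ev s (by linarith [hs.1])).eq_of_nhds.trans ?_
    simp only [hθ0]; rw [intervalIntegral.integral_symm]
  · intro s hs; rw [(ev s (by linarith [hs.1])).deriv_eq, (hd s).deriv]

lemma fub {T : ℝ} {H g : ℝ → ℝ} (hH : IntegrableOn H (Ioo 0 T)) (hg : IntegrableOn g (Ioo 0 T)) :
    ∫ s in Ioo 0 T, H s * ∫ t in s..T, g t = ∫ t in Ioo 0 T, g t * ∫ s in (0:ℝ)..t, H s := by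
  have i : Integrable (Function.uncurry fun a b => indicator {p : ℝ × ℝ | p.1 < p.2} (fun p => H p.1 * g p.2) (a, b))
      ((volume.restrict (Ioo 0 T)).prod (volume.restrict (Ioo 0 T))) :=
    (hH.mul_prod hg).indicator (measurableSet_lt measurable_fst measurable_snd)
  have := integral_integral_swap i
  refine Eq.trans ?_ (this.trans ?_)
  · refine setIntegral_congr_fun measurableSet_Ioo fun s hs => ?_
    rw [intervalIntegral.integral_of_le hs.2.le, ← integral_Ioc_eq_integral_Ioo]
    rw [show (fun t => indicator {p : ℝ × ℝ | p.1 < p.2} (fun p => H p.1 * g p.2) (s, t)) =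
      indicator (Ioi s) (fun t => H s * g t) by ext t; simp [indicator]]
    rw [setIntegral_indicator measurableSet_Ioi, ← integral_const_mul]; congr 2
    ext t; simp; grind
  · refine setIntegral_congr_fun measurableSet_Ioo fun t ht => ?_
    rw [intervalIntegral.integral_of_le ht.1.le, ← integral_const_mul]
    rw [show (fun s => indicator {p : ℝ × ℝ | p.1 < p.2} (fun p => H p.1 * g p.2) (s, t)) =
      indicator (Iio t) (fun s => g t * H s) by ext s; simp [indicator, mul_comm]]
    rw [setIntegral_indicator measurableSet_Iio, integral_Ioc_eq_integral_Ioo]; congr 2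
    ext s; simp; grind

theorem FL.FE (h : FL T M f0 f u) {R l φ} (hφ : TF R l φ) :
    ∀ᵐ s, s ∈ Ioo 0 T → Ff f φ s = Ee f0 f u φ s := by
  have z : (0:ℝ) ∈ Ico 0 T := ⟨le_rfl, h.T0⟩
  have Ec : ContinuousOn (Ee f0 f u φ) (Ico 0 T) := by
    have : LipschitzOnWith (Real.toNNReal (M * (l * (Cv * M)) * νI R)) (Ee f0 f u φ) (Ico 0 T) := by
      apply LipschitzOnWith.of_dist_le_mul; intro x hx y hy; rw [Real.dist_eq, Real.dist_eq, Real.coe_toNNReal']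
      exact (h.E_lip hφ hy hx).trans (mlr (le_max_left _ _) (abs_nonneg _))
    exact this.continuousOn
  have Ecc := Ec.mono (Ioo_subset_Ico_self)
  have Ei : LocallyIntegrableOn (Ee f0 f u φ) (Ioo 0 T) := Ecc.locallyIntegrableOn measurableSet_Ioo
  have := isOpen_Ioo.ae_eq_zero_of_integral_contDiff_smul_eq_zero
    ((h.F_int hφ).locallyIntegrableOn.sub Ei) ?_
  · filter_upwards [this] with s hs hm
    have := hs hm
    simp only [Pi.sub_apply] at this; linarith
  intro g hg cg sg; have hg0 : ∀ t, t ∉ Ioo 0 T → g t = 0 := fun t ht => image_eq_zero_of_notMem_tsupport (fun h => ht (sg h))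
  obtain ⟨θ, hθ, cθ, sθ, θ1, θ2⟩ := prim_test h.T0 hg cg sg; have w := h.weak1 hφ hθ cθ sθ
  have gi : IntegrableOn g (Ioo 0 T) := (hg.continuous.integrable_of_hasCompactSupport cg).integrableOn
  obtain ⟨Ng, hNg⟩ := cg.exists_bound_of_continuous hg.continuous; obtain ⟨Nθ, hNθ⟩ := cθ.exists_bound_of_continuous hθ.continuous
  have i1 : IntegrableOn (fun s => Ff f φ s * g s) (Ioo 0 T) :=
    (h.F_int hφ).mul_bdd (c := Ng) hg.continuous.aestronglyMeasurable (Eventually.of_forall hNg)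
  have i2 : IntegrableOn (fun s => Hf f u φ s * θ s) (Ioo 0 T) :=
    (h.H_int hφ).mul_bdd (c := Nθ) hθ.continuous.aestronglyMeasurable (Eventually.of_forall hNθ)
  have e1 : (∫ s in Ioo 0 T, (Ff f φ s * deriv θ s + Hf f u φ s * θ s)) =
      (∫ s in Ioo 0 T, Ff f φ s * g s) - ∫ t in Ioo 0 T, g t * ∫ s in (0:ℝ)..t, Hf f u φ s := by
    rw [← fub (h.H_int hφ) gi, sub_eq_add_neg, ← integral_neg]
    have : ∫ s in Ioo 0 T, (-(Hf f u φ s * ∫ t in s..T, g t)) = ∫ s in Ioo 0 T, Hf f u φ s * θ s := by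
      refine setIntegral_congr_fun measurableSet_Ioo fun s hs => ?_
      rw [θ1 s (Ioo_subset_Ico_self hs)]; ring
    rw [this, ← integral_add i1 i2]; refine setIntegral_congr_fun measurableSet_Ioo fun s hs => ?_
    rw [θ2 s hs]
  rw [e1, θ1 0 z, intervalIntegral.integral_of_le h.T0.le, integral_Ioc_eq_integral_Ioo] at w
  have i3 : IntegrableOn (fun t => g t * ∫ s in (0:ℝ)..t, Hf f u φ s) (Ioo 0 T) := by
    have hc : ContinuousOn (fun t => ∫ s in (0:ℝ)..t, Hf f u φ s) (Ioo 0 T) := by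
      refine (Ecc.sub (continuousOn_const (c := ∫ x, f0 x * φ x))).congr fun t _ => ?_
      simp [Ee]
    refine gi.mul_bdd (c := M * (l * (Cv * M)) * νI R * T) (hc.aestronglyMeasurable measurableSet_Ioo) ?_
    rw [ae_restrict_iff' measurableSet_Ioo]; refine Eventually.of_forall fun t ht => ?_
    have := abs_ii_le (s := 0) (t := t) fun s => h.H_bd hφ s
    refine this.trans ?_
    have hc : 0 ≤ M * (l * (Cv * M)) * νI R := (abs_nonneg _).trans (h.H_bd hφ 0)
    refine mll ?_ hc
    rw [sub_zero, abs_of_pos ht.1]; exact ht.2.le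
  have e2 : ∫ t, g t • (Ff f φ - Ee f0 f u φ) t = ∫ t in Ioo 0 T, g t • (Ff f φ - Ee f0 f u φ) t := by
    rw [setIntegral_eq_integral_of_forall_compl_eq_zero]; intro t ht; rw [hg0 t ht, zero_smul]
  rw [e2]; have e3 : ∫ t in Ioo 0 T, g t • (Ff f φ - Ee f0 f u φ) t =
      (∫ s in Ioo 0 T, Ff f φ s * g s) - (∫ t in Ioo 0 T, g t * ∫ s in (0:ℝ)..t, Hf f u φ s)
        - ∫ t in Ioo 0 T, (∫ x, f0 x * φ x) * g t := by
    rw [← integral_sub i1 i3]; have i13 : IntegrableOn (fun s => Ff f φ s * g s - g s * ∫ s in (0:ℝ)..s, Hf f u φ s) (Ioo 0 T) := i1.sub i3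
    rw [← integral_sub i13 (gi.const_mul _)]; congr 1; ext t; simp only [Ee, Pi.sub_apply, smul_eq_mul]; ring
  rw [e3, integral_const_mul]; linarith

lemma FL.F_bd (h : FL T M f0 f u) {R l φ} (hφ : TF R l φ) (s : ℝ) :
    |Ff f φ s| ≤ M * ∫ x, |φ x| * (rc x)⁻¹ := by
  obtain ⟨N, hN⟩ := hφ.bd; have hi : Integrable (fun x => |φ x| * (rc x)⁻¹) := by
    refine ((nb_int R).const_mul N).mono' (hφ.sm.continuous.abs.aestronglyMeasurable.mul
      (rc_cont.measurable.inv).aestronglyMeasurable) (Eventually.of_forall fun x => ?_)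
    rw [norm_eq_abs, abs_mul, abs_abs, abs_of_nonneg (inv_nonneg.2 (rc_nonneg x))]
    by_cases hx : ‖x‖ ≤ R
    · rw [nb_of_le hx]; exact mlr (hN x) (inv_nonneg.2 (rc_nonneg x))
    · rw [hφ.sp _ (not_le.1 hx)]; simp; exact mul_nonneg ((abs_nonneg _).trans (hN 0)) (nb_nonneg _ _)
  unfold Ff; rw [← integral_const_mul]; refine abs_int_le (hi.const_mul _) (fun x => ?_)
  rw [abs_mul]; have := mll (h.fb x s) (abs_nonneg (φ x)); linarith

theorem FL.E_bd (h : FL T M f0 f u) {R l φ} (hφ : TF R l φ) {t : ℝ} (ht : t ∈ Ico 0 T) :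
    |Ee f0 f u φ t| ≤ M * ∫ x, |φ x| * (rc x)⁻¹ := by
  refine le_of_forall_pos_le_add fun ε hε => ?_
  set B := M * (l * (Cv * M)) * νI R with hB; have hB0 : 0 ≤ B := (abs_nonneg _).trans (h.H_bd hφ 0); set d := min (T - t) (ε / (B + 1)) with hd
  have hd0 : 0 < d := lt_min (by linarith [ht.2]) (by positivity)
  have : ∃ s ∈ Ioo t (t + d), s ∈ Ioo 0 T → Ff f φ s = Ee f0 f u φ s := by
    by_contra hc
    push Not at hc; have hv : volume (Ioo t (t + d)) = 0 := measure_mono_null (fun s hs => by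
      have := hc s hs
      simp only [mem_compl_iff, mem_ofPred_eq]; exact fun hh => this.2 (hh this.1)) (mem_ae_iff.1 (h.FE hφ))
    rw [Real.volume_Ioo] at hv; simp at hv; linarith
  obtain ⟨s, hs, he⟩ := this; have h1 : d ≤ T - t := min_le_left _ _; have h2 : d ≤ ε / (B + 1) := min_le_right _ _
  have hsT : s ∈ Ioo 0 T := ⟨by linarith [ht.1, hs.1], by linarith [hs.2]⟩
  have e := he hsT
  have b1 := h.F_bd hφ s
  rw [e] at b1; have b2 := h.E_lip hφ (Ioo_subset_Ico_self hsT) ht; have b3 : B * |t - s| ≤ ε := by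
    have : |t - s| ≤ ε / (B + 1) := by rw [abs_sub_comm, abs_of_pos (by linarith [hs.1])]; linarith [hs.2]
    calc B * |t - s| ≤ (B + 1) * (ε / (B + 1)) := by gcongr; linarith
      _ = ε := by field_simp
  have := abs_add_le (Ee f0 f u φ t - Ee f0 f u φ s) (Ee f0 f u φ s)
  rw [sub_add_cancel] at this; linarith
end

def i1 : E3 → ℝ := indicator (Metric.closedBall 0 1) (fun _ => 1)
lemma i1_int : Integrable i1 :=
  (integrable_indicator_iff Metric.isClosed_closedBall.measurableSet).2
    (integrableOn_const (hs := (isCompact_closedBall (0:E3) 1).measure_lt_top.ne))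
lemma i1_nonneg (x : E3) : 0 ≤ i1 x := indicator_nonneg (fun _ _ => zero_le_one) x
lemma i1_one {x : E3} (h : ‖x‖ ≤ 1) : i1 x = 1 := indicator_of_mem (by simpa using h) _
def V1 : ℝ := ∫ x, i1 x
lemma V1_nonneg : 0 ≤ V1 := integral_nonneg i1_nonneg

lemma i1_shift (x : E3) : Integrable (fun t => i1 (x - t)) ∧ ∫ t, i1 (x - t) = V1 :=
  ⟨i1_int.comp_sub_left x, integral_sub_left_eq_self i1 volume x⟩

lemma L1lip {G : Type*} [NormedAddCommGroup G] {g : E3 → G} {K : ℝ} (hK0 : 0 ≤ K)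
    (hK : ∀ p q, ‖g p - g q‖ ≤ K * ‖p - q‖)
    (hs : ∀ p, 1 < ‖p‖ → g p = 0) (x x' t : E3) :
    ‖g (x - t) - g (x' - t)‖ ≤ K * ‖x - x'‖ * (i1 (x - t) + i1 (x' - t)) := by
  have h0 := i1_nonneg (x - t)
  have h1 := i1_nonneg (x' - t)
  have hn : 0 ≤ K * ‖x - x'‖ := by positivity
  have hk := hK (x - t) (x' - t)
  rw [sub_sub_sub_cancel_right] at hk
  by_cases h : ‖x - t‖ ≤ 1
  · rw [i1_one h]; nlinarith
  · by_cases h' : ‖x' - t‖ ≤ 1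
    · rw [i1_one h']; nlinarith
    · rw [hs _ (not_le.1 h), hs _ (not_le.1 h')]; simp; positivity

lemma eta_exists : ∃ η : E3 → ℝ, CD η ∧ HasCompactSupport η ∧ (∀ x, 0 ≤ η x) ∧
    (∫ x, η x = 1) ∧ (∀ x, 1 < ‖x‖ → η x = 0) := by
  let b : ContDiffBump (0 : E3) := ⟨1/2, 1, by norm_num, by norm_num⟩
  refine ⟨b.normed volume, b.contDiff_normed, b.hasCompactSupport_normed, fun x => b.nonneg_normed x,
    b.integral_normed, fun x hx => ?_⟩
  have := b.support_normed_eq (μ := volume)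
  by_contra hc
  have hm : x ∈ Function.support (b.normed volume) := hc
  rw [this] at hm; simp [b] at hm; linarith

open ContinuousLinearMap Convolution in
lemma moll1 : ∃ C1 C2 : ℝ, 1 ≤ C1 ∧ 0 ≤ C2 ∧ ∀ (v : E3 → E3) (U a b : ℝ), 0 ≤ a → 0 ≤ b → Continuous v →
    (∀ x, ‖v x‖ ≤ U) → (∀ x x', ‖v x - v x'‖ ≤ a * ‖x - x'‖ + b) →
    ∃ w : E3 → E3, CD w ∧ (∀ x, ‖w x‖ ≤ U) ∧ (∀ x, ‖w x - v x‖ ≤ a + b) ∧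
      (∀ x x', ‖w x - w x'‖ ≤ C1 * (a + b) * ‖x - x'‖) ∧
      (∀ x x', ‖fderiv ℝ w x - fderiv ℝ w x'‖ ≤ C2 * U * ‖x - x'‖) := by
  obtain ⟨η, hη, cη, η0, ηi, ηs⟩ := eta_exists; have hc1 : ContDiff ℝ 1 η := hη.of_le (by norm_cast)
  have hc2 : ContDiff ℝ 1 (fderiv ℝ η) := hη.fderiv_right (by norm_cast)
  obtain ⟨K1, hK1⟩ := hc1.lipschitzWith_of_hasCompactSupport cη (by norm_num)
  obtain ⟨K2, hK2⟩ := hc2.lipschitzWith_of_hasCompactSupport (cη.fderiv ℝ) (by norm_num)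
  have hs2 : ∀ p, 1 < ‖p‖ → fderiv ℝ η p = 0 := by
    intro x hx; have : η =ᶠ[nhds x] fun _ => 0 := by
      filter_upwards [(isOpen_lt continuous_const continuous_norm).mem_nhds hx] with y hy using ηs y hy
    rw [this.fderiv_eq]; simp
  have lip1 : ∀ p q, ‖η p - η q‖ ≤ K1 * ‖p - q‖ := fun p q => by
    have := hK1.dist_le_mul p q; rwa [dist_eq_norm, dist_eq_norm] at this
  have lip2 : ∀ p q, ‖fderiv ℝ η p - fderiv ℝ η q‖ ≤ K2 * ‖p - q‖ := fun p q => by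
    have := hK2.dist_le_mul p q; rwa [dist_eq_norm, dist_eq_norm] at this
  let L := (lsmul ℝ ℝ : ℝ →L[ℝ] E3 →L[ℝ] E3)
  have V0 := V1_nonneg
  have ηint : Integrable η := hη.continuous.integrable_of_hasCompactSupport cη
  refine ⟨1 + 2 * K1 * (2 * V1), ‖precompL E3 L‖ * (K2 * (2 * V1)), ?_, by positivity, ?_⟩
  · have : 0 ≤ 2 * K1 * (2 * V1) := by positivity
    linarith
  intro v U a b ha hb hv hU hab; have U0 : 0 ≤ U := (norm_nonneg _).trans (hU 0); have vl : LocallyIntegrable v volume := hv.locallyIntegrable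
  let w : E3 → E3 := η ⋆[L, volume] v
  have wd : ∀ x, w x = ∫ t, η t • v (x - t) := fun x => rfl
  have ws : ∀ x, w x = ∫ t, η (x - t) • v t := fun x => by
    show (η ⋆[L, volume] v) x = _
    rw [convolution_eq_swap]; rfl
  have bi : ∀ (h : E3 → E3), Continuous h → Integrable (fun t => η t • h t) := fun h hh =>
    (hη.continuous.smul hh).integrable_of_hasCompactSupport cη.smul_right
  have bi2 : ∀ (x : E3) (h : E3 → E3), Continuous h → Integrable (fun t => η (x - t) • h t) := fun x h hh => by
    have := (bi (fun t => h (x - t)) (by fun_prop)).comp_sub_left x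
    simpa using this
  have mean : ∀ (x : E3) (q : E3) (r : ℝ), (∀ t, ‖t‖ ≤ 1 → ‖v (x - t) - q‖ ≤ r) → ‖w x - q‖ ≤ r := by
    intro x q r hr; have e : w x - q = ∫ t, η t • (v (x - t) - q) := by
      simp_rw [smul_sub]
      rw [integral_sub (bi _ (by fun_prop)) (bi _ continuous_const), integral_smul_const, ηi, one_smul, wd]
    rw [e]; have : ‖∫ t, η t • (v (x - t) - q)‖ ≤ ∫ t, η t * r := by
      refine norm_integral_le_of_norm_le (ηint.mul_const r) (Eventually.of_forall fun t => ?_)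
      rw [norm_smul, norm_eq_abs, abs_of_nonneg (η0 t)]
      by_cases ht : ‖t‖ ≤ 1
      · exact mll (hr t ht) (η0 t)
      · rw [ηs t (not_le.1 ht)]; simp
    rwa [integral_mul_const, ηi, one_mul] at this
  have wsm : CD w := cη.contDiff_convolution_left L hη vl
  have wv : ∀ x, ‖w x - v x‖ ≤ a + b := fun x => mean x _ _ (fun t ht => by
    refine (hab _ _).trans ?_
    rw [sub_sub_cancel_left, norm_neg]; nlinarith)
  refine ⟨w, wsm, fun x => ?_, wv, fun x x' => ?_, fun x x' => ?_⟩
  · have := mean x 0 U (fun t _ => by rw [sub_zero]; exact hU _)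
    rwa [sub_zero] at this
  · have hd : 0 ≤ ‖x - x'‖ := norm_nonneg _
    have e : w x - w x' = ∫ t, (η (x - t) - η (x' - t)) • (v t - v x) := by
      have e1 : ∀ y : E3, ∫ t, η (y - t) • (v t - v x) = w y - v x := by
        intro y
        simp_rw [smul_sub]
        rw [integral_sub (bi2 _ _ hv) (bi2 _ _ continuous_const), integral_smul_const,
          integral_sub_left_eq_self η volume y, ηi, one_smul, ws]
      simp_rw [sub_smul (η _)]
      rw [integral_sub (bi2 _ _ (by fun_prop)) (bi2 _ _ (by fun_prop)), e1, e1]; abel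
    rcases le_or_gt ‖x - x'‖ 1 with h1 | h1
    · rw [e]; have : ‖∫ t, (η (x - t) - η (x' - t)) • (v t - v x)‖ ≤
          ∫ t, (K1 * ‖x - x'‖ * (2 * (a + b))) * (i1 (x - t) + i1 (x' - t)) := by
        refine norm_integral_le_of_norm_le (((i1_shift x).1.add (i1_shift x').1).const_mul _)
          (Eventually.of_forall fun t => ?_)
        rw [norm_smul]; have l := L1lip (K := (K1:ℝ)) K1.coe_nonneg lip1 ηs x x' t
        by_cases ht : ‖x - t‖ ≤ 1 ∨ ‖x' - t‖ ≤ 1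
        · have hxt : ‖t - x‖ ≤ 2 := by
            rcases ht with ht | ht
            · rw [norm_sub_rev]; linarith
            · have := norm_sub_le_norm_sub_add_norm_sub x x' t
              rw [norm_sub_rev]; linarith
          have hv2 : ‖v t - v x‖ ≤ 2 * (a + b) := (hab t x).trans (by nlinarith)
          refine (mul_le_mul l hv2 (norm_nonneg _) ((norm_nonneg _).trans l)).trans (le_of_eq (by ring))
        · push Not at ht; rw [ηs _ ht.1, ηs _ ht.2]; simp; have := i1_nonneg (x - t); have := i1_nonneg (x' - t); positivity
      rw [integral_const_mul, integral_add (i1_shift x).1 (i1_shift x').1, (i1_shift x).2, (i1_shift x').2] at this; refine this.trans ?_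
      have : 0 ≤ (a + b) * ‖x - x'‖ := by positivity
      nlinarith
    · have : ‖w x - w x'‖ ≤ a * ‖x - x'‖ + b := by
        have e2 : w x - w x' = ∫ t, η t • (v (x - t) - v (x' - t)) := by
          simp_rw [smul_sub]
          rw [integral_sub (bi _ (by fun_prop)) (bi _ (by fun_prop)), wd, wd]
        rw [e2]; have : ‖∫ t, η t • (v (x - t) - v (x' - t))‖ ≤ ∫ t, η t * (a * ‖x - x'‖ + b) := by
          refine norm_integral_le_of_norm_le (ηint.mul_const _) (Eventually.of_forall fun t => ?_)
          rw [norm_smul, norm_eq_abs, abs_of_nonneg (η0 t)]; refine mll ?_ (η0 t); have := hab (x - t) (x' - t)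
          rwa [sub_sub_sub_cancel_right] at this
        rwa [integral_mul_const, ηi, one_mul] at this
      refine this.trans ?_
      have p1 : 0 ≤ 2 * (K1:ℝ) * (2 * V1) * ((a + b) * ‖x - x'‖) := by positivity
      have p2 : b ≤ b * ‖x - x'‖ := by nlinarith
      nlinarith
  · have fd : ∀ y, fderiv ℝ w y = ∫ t, (precompL E3 L) (fderiv ℝ η (y - t)) (v t) := by
      intro y; have := (cη.hasFDerivAt_convolution_left L hc1 vl y).fderiv; rw [convolution_eq_swap] at this; exact this
    have fi : ∀ y, Integrable (fun t => (precompL E3 L) (fderiv ℝ η (y - t)) (v t)) := by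
      intro y; have cc : Continuous fun t => (precompL E3 L) (fderiv ℝ η (y - t)) (v t) := by
        have : Continuous (fderiv ℝ η) := hc2.continuous
        fun_prop
      refine cc.integrable_of_hasCompactSupport ?_
      refine HasCompactSupport.intro (isCompact_closedBall y 1) fun t ht => ?_
      rw [hs2 _ (by simpa [dist_eq_norm, norm_sub_rev] using ht)]; simp
    rw [fd, fd, ← integral_sub (fi x) (fi x')]; have : ‖∫ t, ((precompL E3 L) (fderiv ℝ η (x - t)) (v t) - (precompL E3 L) (fderiv ℝ η (x' - t)) (v t))‖ ≤
          ∫ t, (‖precompL E3 L‖ * (K2 * ‖x - x'‖) * U) * (i1 (x - t) + i1 (x' - t)) := by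
      refine norm_integral_le_of_norm_le (((i1_shift x).1.add (i1_shift x').1).const_mul _)
        (Eventually.of_forall fun t => ?_)
      rw [← sub_apply, ← map_sub]; refine (le_opNorm₂ _ _ _).trans ?_; have l := L1lip (K := (K2:ℝ)) K2.coe_nonneg lip2 hs2 x x' t
      calc _ ≤ ‖precompL E3 L‖ * (K2 * ‖x - x'‖ * (i1 (x - t) + i1 (x' - t))) * U := by
            refine mul_le_mul (mll l (norm_nonneg (precompL E3 L))) (hU t) (norm_nonneg _) ?_
            exact mul_nonneg (norm_nonneg (precompL E3 L)) ((norm_nonneg _).trans l)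
        _ = _ := by ring
    rw [integral_const_mul, integral_add (i1_shift x).1 (i1_shift x').1, (i1_shift x).2, (i1_shift x').2] at this; refine this.trans (le_of_eq (by ring))

lemma moll : ∃ C1 C2 : ℝ, 1 ≤ C1 ∧ 0 ≤ C2 ∧ ∀ (v : E3 → E3) (U a b κ : ℝ), 0 ≤ a → 0 ≤ b → 0 < κ → Continuous v →
    (∀ x, ‖v x‖ ≤ U) → (∀ x x', ‖v x - v x'‖ ≤ a * ‖x - x'‖ + b) →
    ∃ w : E3 → E3, CD w ∧ (∀ x, ‖w x‖ ≤ U) ∧ (∀ x, ‖w x - v x‖ ≤ a * κ + b) ∧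
      (∀ x x', ‖w x - w x'‖ ≤ C1 * (a + b / κ) * ‖x - x'‖) ∧
      (∀ x x', ‖fderiv ℝ w x - fderiv ℝ w x'‖ ≤ C2 * U / κ ^ 2 * ‖x - x'‖) := by
  obtain ⟨C1, C2, h1, h2, H⟩ := moll1; refine ⟨C1, C2, h1, h2, fun v U a b κ ha hb hκ hv hU hab => ?_⟩
  obtain ⟨w, w1, w2, w3, w4, w5⟩ := H (fun x => v (κ • x)) U (a * κ) b (by positivity) hb
    (hv.comp (continuous_const_smul κ)) (fun x => hU _) (fun x x' => by
      refine (hab _ _).trans (le_of_eq ?_)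
      rw [← smul_sub, norm_smul, norm_eq_abs, abs_of_pos hκ]; ring)
  have nk : ∀ x x' : E3, ‖κ⁻¹ • x - κ⁻¹ • x'‖ = κ⁻¹ * ‖x - x'‖ := fun x x' => by
    rw [← smul_sub, norm_smul, norm_eq_abs, abs_of_pos (inv_pos.2 hκ)]
  refine ⟨fun x => w (κ⁻¹ • x), w1.comp (contDiff_const_smul _), fun x => w2 _, fun x => ?_, fun x x' => ?_, fun x x' => ?_⟩
  · have := w3 (κ⁻¹ • x)
    rwa [smul_inv_smul₀ hκ.ne'] at this
  · refine (w4 _ _).trans (le_of_eq ?_)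
    rw [nk]; field_simp
  · have fd : ∀ y, fderiv ℝ (fun x => w (κ⁻¹ • x)) y = κ⁻¹ • fderiv ℝ w (κ⁻¹ • y) := fun y => by
      rw [fderiv_comp_smul]
    have e : κ⁻¹ • fderiv ℝ w (κ⁻¹ • x) - κ⁻¹ • fderiv ℝ w (κ⁻¹ • x') =
        κ⁻¹ • (fderiv ℝ w (κ⁻¹ • x) - fderiv ℝ w (κ⁻¹ • x')) := by ext v; simp [mul_sub]
    rw [fd, fd, e, norm_smul, norm_eq_abs, abs_of_pos (inv_pos.2 hκ)]
    calc _ ≤ κ⁻¹ * (C2 * U * ‖κ⁻¹ • x - κ⁻¹ • x'‖) := by gcongr; exact w5 _ _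
      _ = _ := by rw [nk]; field_simp

structure TC (R l k : ℝ) (φ : E3 → ℝ) : Prop extends TF R l φ where
  l2 : ∀ x y, ‖fderiv ℝ φ x - fderiv ℝ φ y‖ ≤ k * ‖x - y‖

lemma nb_mono {R R' : ℝ} (h : R ≤ R') (x : E3) : nb R x ≤ nb R' x :=
  indicator_le_indicator_of_subset (Metric.closedBall_subset_closedBall h)
    (fun x => inv_nonneg.2 (rc_nonneg x)) x
lemma νI_mono {R R' : ℝ} (h : R ≤ R') : νI R ≤ νI R' :=
  integral_mono (nb_int R) (nb_int R') (nb_mono h)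

lemma TF.mono {R R' l l' φ} (h : TF R l φ) (hR : R ≤ R') (hl : l ≤ l') : TF R' l' φ :=
  ⟨h.sm, fun x hx => h.sp x (hR.trans_lt hx), fun x => (h.l1 x).trans hl⟩

lemma TF.mk' {R : ℝ} {φ : E3 → ℝ} (sm : CD φ) (sp : ∀ x, R < ‖x‖ → φ x = 0) :
    ∃ l, TF R l φ := by
  have hc : HasCompactSupport φ :=
    HasCompactSupport.intro (isCompact_closedBall (0 : E3) R) (fun x hx => sp x (by simpa using hx))
  obtain ⟨N, hN⟩ := (hc.fderiv ℝ).exists_bound_of_continuous (sm.continuous_fderiv (by simp))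
  exact ⟨N, sm, sp, hN⟩

lemma TF.nbi {R l φ} (h : TF R l φ) {N : ℝ} (hN : ∀ x, |φ x| ≤ N) :
    ∫ x, |φ x| * (rc x)⁻¹ ≤ N * νI R := by
  unfold νI; rw [← integral_const_mul]; refine integral_mono_of_nonneg (Eventually.of_forall fun x => mul_nonneg (abs_nonneg _) (inv_nonneg.2 (rc_nonneg x)))
    ((nb_int R).const_mul N) (Eventually.of_forall fun x => ?_)
  simp only
  by_cases hx : ‖x‖ ≤ R
  · rw [nb_of_le hx]; exact mlr (hN x) (inv_nonneg.2 (rc_nonneg x))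
  · rw [h.sp _ (not_le.1 hx)]; simp; exact mul_nonneg ((abs_nonneg _).trans (hN 0)) (nb_nonneg R x)

section
variable {T M : ℝ} {f0 : E3 → ℝ} {f : E3 → ℝ → ℝ} {u : E3 → ℝ → E3}

lemma FL.f0φ (h : FL T M f0 f u) {R l φ} (hφ : TF R l φ) : Integrable (fun x => f0 x * φ x) := by
  obtain ⟨N, hN⟩ := hφ.bd; exact h.f0i.mul_bdd (c := N) hφ.sm.continuous.aestronglyMeasurable (Eventually.of_forall hN)

lemma FL.E_lin (h : FL T M f0 f u) {R l φ R' l' ψ} (hφ : TF R l φ) (hψ : TF R' l' ψ) (c : ℝ) {t : ℝ}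
    (ht : t ∈ Ico 0 T) :
    Ee f0 f u (fun x => φ x + c * ψ x) t = Ee f0 f u φ t + c * Ee f0 f u ψ t := by
  unfold Ee; have h0 : (0:ℝ) ∈ Ico 0 T := ⟨le_rfl, h.T0⟩; have e1 : ∫ x, f0 x * (φ x + c * ψ x) = (∫ x, f0 x * φ x) + c * ∫ x, f0 x * ψ x := by
    rw [← integral_const_mul, ← integral_add (h.f0φ hφ) ((h.f0φ hψ).const_mul c)]; congr 1; ext x; ring
  have e2 : ∫ s in (0:ℝ)..t, Hf f u (fun x => φ x + c * ψ x) s =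
      (∫ s in (0:ℝ)..t, Hf f u φ s) + c * ∫ s in (0:ℝ)..t, Hf f u ψ s := by
    rw [← intervalIntegral.integral_const_mul, ← intervalIntegral.integral_add (h.H_ii hφ h0 ht)
      ((h.H_ii hψ h0 ht).const_mul c)]
    apply intervalIntegral.integral_congr_ae; have a1 := (ae_restrict_iff' measurableSet_Ioo).1 (h.intH hφ).prod_left_ae
    have a2 := (ae_restrict_iff' measurableSet_Ioo).1 (h.intH hψ).prod_left_ae
    filter_upwards [a1, a2] with s h1 h2 hs
    rw [uIoc_of_le ht.1] at hs; have hs' : s ∈ Ioo 0 T := ⟨hs.1, hs.2.trans_lt ht.2⟩; unfold Hf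
    rw [← integral_const_mul, ← integral_add (h1 hs') ((h2 hs').const_mul c)]; congr 1; ext x
    have : fderiv ℝ (fun x => φ x + c * ψ x) x = fderiv ℝ φ x + c • fderiv ℝ ψ x := by
      rw [fderiv_fun_add hφ.diff.differentiableAt (hψ.diff.differentiableAt.const_mul c),
        fderiv_const_mul hψ.diff.differentiableAt]
    rw [this]; simp; ring
  rw [e1, e2]; ring

lemma FL.dev_ii (h : FL T M f0 f u) (R : ℝ) {w : E3 → E3} (hw : Continuous w) {U : ℝ} (hU : ∀ x, ‖w x‖ ≤ U) :
    Integrable (fun p : E3 × ℝ => nb R p.1 * ‖u p.1 p.2 - w p.1‖) (mT T) := by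
  refine (((nb_int R).mul_const (Cv * M + U)).comp_fst (volume.restrict (Ioo 0 T))).mono'
    ((nb_int R).comp_fst _ |>.1.mul (h.um.sub (hw.comp continuous_fst).aestronglyMeasurable).norm)
    (Eventually.of_forall fun p => ?_)
  rw [norm_eq_abs, abs_mul, abs_of_nonneg (nb_nonneg R _), abs_norm]; exact mll ((norm_sub_le _ _).trans (add_le_add (h.ub _ _) (hU _))) (nb_nonneg R _)

def Dv (u : E3 → ℝ → E3) (R : ℝ) (w : E3 → E3) (s : ℝ) : ℝ := ∫ x, nb R x * ‖u x s - w x‖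

lemma FL.step (h : FL T M f0 f u) {R Rb l k L L2 hh t : ℝ} {ψ : E3 → ℝ} (hψ : TC R l k ψ)
    {w : E3 → E3} (ws : CD w) (wU : ∀ x, ‖w x‖ ≤ Cv * M)
    (wL : ∀ x y, ‖w x - w y‖ ≤ L * ‖x - y‖) (wL2 : ∀ x y, ‖fderiv ℝ w x - fderiv ℝ w y‖ ≤ L2 * ‖x - y‖)
    (hh0 : 0 ≤ hh) (hRb : R + hh * (Cv * M) ≤ Rb) (ht : t ∈ Ico 0 T) (hth : t + hh ∈ Ico 0 T)
    (hL : 0 ≤ L) (hL2 : 0 ≤ L2) (hk : 0 ≤ k) :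
    TC (R + hh * (Cv * M)) (l * (1 + hh * L)) (k * (1 + hh * L) ^ 2 + l * (hh * L2)) (fun x => ψ (x + hh • w x)) ∧
    |Ee f0 f u ψ (t + hh) - Ee f0 f u (fun x => ψ (x + hh • w x)) t| ≤
      l * M * (∫ s in t..t+hh, Dv u Rb w s) +
      hh ^ 2 * (M * νI Rb * ((k * (Cv * M) + l * L) * (Cv * M) + k * (Cv * M) ^ 2)) := by
  set U := Cv * M with hUd; have hM : 0 ≤ M := by linarith [h.M1]
  have hU : 0 ≤ U := mul_nonneg Cv_pos.le hM
  have hl : 0 ≤ l := hψ.l0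
  have hhU : 0 ≤ hh * U := by positivity
  have wd : Differentiable ℝ w := ws.differentiable (by simp)
  have fwL : ∀ x, ‖fderiv ℝ w x‖ ≤ L := fun x => by
    have : LipschitzWith L.toNNReal w := LipschitzWith.of_dist_le_mul fun a b => by
      rw [dist_eq_norm, dist_eq_norm, Real.coe_toNNReal _ hL]; exact wL a b
    have := norm_fderiv_le_of_lipschitz ℝ this (x₀ := x)
    rwa [Real.coe_toNNReal _ hL] at this
  -- composed function
  have Φd : ∀ x, HasFDerivAt (fun x => x + hh • w x) (ContinuousLinearMap.id ℝ E3 + hh • fderiv ℝ w x) x :=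
    fun x => (hasFDerivAt_id x).add ((wd x).hasFDerivAt.const_smul hh)
  have cd : ∀ x, fderiv ℝ (fun x => ψ (x + hh • w x)) x =
      (fderiv ℝ ψ (x + hh • w x)).comp (ContinuousLinearMap.id ℝ E3 + hh • fderiv ℝ w x) := fun x =>
    ((hψ.diff (x + hh • w x)).hasFDerivAt.comp x (Φd x)).fderiv
  have An : ∀ x, ‖ContinuousLinearMap.id ℝ E3 + hh • fderiv ℝ w x‖ ≤ 1 + hh * L := fun x => by
    refine (norm_add_le _ _).trans (add_le_add ContinuousLinearMap.norm_id_le ?_)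
    rw [norm_smul, norm_eq_abs, abs_of_nonneg hh0]; exact mll (fwL x) hh0
  have csm : CD (fun x => ψ (x + hh • w x)) :=
    hψ.sm.comp (contDiff_id.add (ws.const_smul hh))
  have csp : ∀ x, R + hh * U < ‖x‖ → ψ (x + hh • w x) = 0 := fun x hx => by
    apply hψ.sp; have := norm_sub_norm_le x (-(hh • w x)); rw [sub_neg_eq_add, norm_neg, norm_smul, norm_eq_abs, abs_of_nonneg hh0] at this
    have := mll (wU x) hh0
    linarith
  have C1 : TC (R + hh * U) (l * (1 + hh * L)) (k * (1 + hh * L) ^ 2 + l * (hh * L2)) (fun x => ψ (x + hh • w x)) := by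
    refine ⟨⟨csm, csp, fun x => ?_⟩, fun x y => ?_⟩
    · rw [cd]; exact (ContinuousLinearMap.opNorm_comp_le _ _).trans (mul_le_mul (hψ.l1 _) (An x) (norm_nonneg _) hl)
    · rw [cd, cd]; set A := ContinuousLinearMap.id ℝ E3 + hh • fderiv ℝ w x with hA; set B := ContinuousLinearMap.id ℝ E3 + hh • fderiv ℝ w y with hB
      have e : (fderiv ℝ ψ (x + hh • w x)).comp A - (fderiv ℝ ψ (y + hh • w y)).comp B =
        (fderiv ℝ ψ (x + hh • w x) - fderiv ℝ ψ (y + hh • w y)).comp A + (fderiv ℝ ψ (y + hh • w y)).comp (A - B) := by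
        ext v; simp
      rw [e]; have AB : ‖A - B‖ ≤ hh * (L2 * ‖x - y‖) := by
        have : A - B = hh • (fderiv ℝ w x - fderiv ℝ w y) := by ext v; simp [hA, hB]; ring
        rw [this, norm_smul, norm_eq_abs, abs_of_nonneg hh0]; exact mll (wL2 x y) hh0
      have xy : ‖(x + hh • w x) - (y + hh • w y)‖ ≤ (1 + hh * L) * ‖x - y‖ := by
        have : (x + hh • w x) - (y + hh • w y) = (x - y) + hh • (w x - w y) := by module
        rw [this]; refine (norm_add_le _ _).trans ?_; rw [norm_smul, norm_eq_abs, abs_of_nonneg hh0]; linarith [mll (wL x y) hh0]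
      have s1 := (ContinuousLinearMap.opNorm_comp_le (fderiv ℝ ψ (x + hh • w x) - fderiv ℝ ψ (y + hh • w y)) A).trans
        (mul_le_mul ((hψ.l2 _ _).trans (mll xy hk)) (An x) (norm_nonneg _) (by positivity))
      have s2 := (ContinuousLinearMap.opNorm_comp_le (fderiv ℝ ψ (y + hh • w y)) (A - B)).trans
        (mul_le_mul (hψ.l1 _) AB (norm_nonneg _) hl)
      refine (norm_add_le _ _).trans ((add_le_add s1 s2).trans (le_of_eq (by ring)))
  refine ⟨C1, ?_⟩
  -- g
  set g : E3 → ℝ := fun x => fderiv ℝ ψ x (w x) with hg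
  have gsm : CD g := (hψ.sm.fderiv_right (by simp)).clm_apply ws
  have gT : TF R (k * U + l * L) g := by
    refine ⟨gsm, fun x hx => by simp [hg, hψ.sp' x hx], fun x => ?_⟩
    have : LipschitzWith (k * U + l * L).toNNReal g := LipschitzWith.of_dist_le_mul fun a b => by
      rw [dist_eq_norm, dist_eq_norm, Real.coe_toNNReal _ (by positivity)]
      have e : g a - g b = (fderiv ℝ ψ a - fderiv ℝ ψ b) (w a) + fderiv ℝ ψ b (w a - w b) := by simp [hg]
      rw [e]; have s1 := ((fderiv ℝ ψ a - fderiv ℝ ψ b).le_opNorm (w a)).trans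
        (mul_le_mul (hψ.l2 a b) (wU a) (norm_nonneg _) (by positivity))
      have s2 := ((fderiv ℝ ψ b).le_opNorm (w a - w b)).trans
        (mul_le_mul (hψ.l1 b) (wL a b) (norm_nonneg _) hl)
      refine (norm_add_le _ _).trans ((add_le_add s1 s2).trans (le_of_eq (by ring)))
    have := norm_fderiv_le_of_lipschitz ℝ this (x₀ := x)
    rwa [Real.coe_toNNReal _ (by positivity)] at this
  -- remainder
  set Rm : E3 → ℝ := fun x => ψ (x + hh • w x) + (-1) * (ψ x + hh * g x) with hRm
  have Rsm : CD Rm := csm.add (contDiff_const.mul (hψ.sm.add (contDiff_const.mul gsm)))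
  have pT : TF R (l + hh * (k * U + l * L)) (fun x => ψ x + hh * g x) := by
    refine ⟨hψ.sm.add (contDiff_const.mul gsm), fun x hx => by rw [hψ.sp x hx, gT.sp x hx]; simp, fun x => ?_⟩
    rw [fderiv_fun_add hψ.diff.differentiableAt (gT.diff.differentiableAt.const_mul hh),
        fderiv_const_mul gT.diff.differentiableAt]
    refine (norm_add_le _ _).trans (add_le_add (hψ.l1 x) ?_)
    rw [norm_smul, norm_eq_abs, abs_of_nonneg hh0]; exact mll (gT.l1 x) hh0
  have Rsp : ∀ x, R + hh * U < ‖x‖ → Rm x = 0 := fun x hx => by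
    simp only [hRm]; rw [csp x hx, pT.sp x (by linarith)]; simp
  obtain ⟨lR, RT⟩ := TF.mk' Rsm Rsp; have Rb1 : ∀ x, |Rm x| ≤ k * (hh * U) ^ 2 := fun x => by
    have hn : ‖hh • w x‖ ≤ hh * U := by
      rw [norm_smul, norm_eq_abs, abs_of_nonneg hh0]; exact mll (wU x) hh0
    have := (convex_closedBall x (hh * U)).norm_image_sub_le_of_norm_hasFDerivWithin_le' (f := ψ)
      (f' := fderiv ℝ ψ) (C := k * (hh * U)) (φ := fderiv ℝ ψ x) (x := x) (y := x + hh • w x)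
      (fun y _ => (hψ.diff y).hasFDerivAt.hasFDerivWithinAt) (fun y hy => (hψ.l2 y x).trans
        (mll (by simpa [dist_eq_norm] using hy) hk)) (by simp [hhU]) (by simpa using hn)
    rw [add_sub_cancel_left] at this; have e : Rm x = ψ (x + hh • w x) - ψ x - (fderiv ℝ ψ x) (hh • w x) := by
      simp [hRm, hg]; ring
    rw [e, ← norm_eq_abs]; refine this.trans ((mll hn (by positivity)).trans (le_of_eq (by ring)))
  have ER : |Ee f0 f u Rm t| ≤ M * (k * (hh * U) ^ 2 * νI Rb) := by
    refine (h.E_bd RT ht).trans (mll ((RT.nbi Rb1).trans ?_) hM)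
    exact mll (νI_mono hRb) (by positivity)
  have Elin : Ee f0 f u Rm t = Ee f0 f u (fun x => ψ (x + hh • w x)) t + (-1) * (Ee f0 f u ψ t + hh * Ee f0 f u g t) := by
    rw [hRm, h.E_lin C1.toTF pT (-1) ht, h.E_lin hψ.toTF gT hh ht]
  have ii := h.H_ii hψ.toTF ht hth
  have E1 : Ee f0 f u ψ (t + hh) = Ee f0 f u ψ t + ∫ s in t..t+hh, Hf f u ψ s := by
    unfold Ee; have h0 : (0:ℝ) ∈ Ico 0 T := ⟨le_rfl, h.T0⟩; rw [add_assoc, intervalIntegral.integral_add_adjacent_intervals (h.H_ii hψ.toTF h0 ht) ii]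
  have E2 : hh * Ee f0 f u g t = ∫ s in t..t+hh, Ee f0 f u g t := by simp
  have key : |∫ s in t..t+hh, (Hf f u ψ s - Ee f0 f u g t)| ≤
      ∫ s in t..t+hh, (l * M * Dv u Rb w s + M * ((k * U + l * L) * U) * νI Rb * hh) := by
    rw [← norm_eq_abs]; have sub : Ioc t (t + hh) ⊆ Ioo 0 T ∪ {0} := fun s hs => by
      left; exact ⟨by linarith [hs.1, ht.1], by linarith [hs.2, hth.2]⟩
    have Di : IntervalIntegrable (Dv u Rb w) volume t (t + hh) := by
      have : IntegrableOn (Dv u Rb w) (Ioo 0 T) := (h.dev_ii Rb ws.continuous wU).integral_prod_right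
      rw [intervalIntegrable_iff, uIoc_of_le (by linarith)]
      refine this.mono_set fun s hs => ⟨by linarith [hs.1, ht.1], by linarith [hs.2, hth.2]⟩
    refine intervalIntegral.norm_integral_le_of_norm_le (by linarith) ?_ ((Di.const_mul _).add (by simp))
    have a1 := (ae_restrict_iff' measurableSet_Ioo).1 (h.intH hψ.toTF).prod_left_ae
    have a2 := (ae_restrict_iff' measurableSet_Ioo).1 (h.intF gT).prod_left_ae
    have a3 := (ae_restrict_iff' measurableSet_Ioo).1 (h.dev_ii Rb ws.continuous wU).prod_left_ae
    filter_upwards [a1, a2, a3, h.FE gT] with s h1 h2 h3 h4 hs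
    have hs' : s ∈ Ioo 0 T := ⟨by linarith [hs.1, ht.1], by linarith [hs.2, hth.2]⟩
    have s1 : |Hf f u ψ s - Ff f g s| ≤ l * M * Dv u Rb w s := by
      unfold Hf Ff Dv; rw [← integral_sub (h1 hs') (h2 hs'), ← integral_const_mul]; refine abs_int_le ((h3 hs').const_mul _) fun x => ?_
      have e : f x s * fderiv ℝ ψ x (u x s) - f x s * g x = f x s * fderiv ℝ ψ x (u x s - w x) := by simp [hg]; ring
      rw [e]; have hb : |fderiv ℝ ψ x (u x s - w x)| ≤ l * ‖u x s - w x‖ :=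
        ((fderiv ℝ ψ x).le_opNorm _).trans (mlr (hψ.l1 x) (norm_nonneg _))
      refine (h.fk (R := R) hb (fun hx => by rw [hψ.sp' _ hx]; simp)).trans ?_
      have := mll (nb_mono (by linarith : R ≤ Rb) x)
        (by positivity : 0 ≤ M * (l * ‖u x s - w x‖))
      linarith
    have s2 := h.E_lip gT ht ⟨hs'.1.le, hs'.2⟩
    have s3 : M * ((k * U + l * L) * U) * νI R * |s - t| ≤ M * ((k * U + l * L) * U) * νI Rb * hh := by
      refine mul_le_mul (mll (νI_mono (by linarith)) (by positivity)) ?_ (abs_nonneg _) ?_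
      · rw [abs_of_nonneg (by linarith [hs.1])]; linarith [hs.2]
      · have := νI_nonneg Rb; positivity
    rw [← h4 hs'] at s2; rw [norm_eq_abs]; have := abs_sub_le (Hf f u ψ s) (Ff f g s) (Ee f0 f u g t); linarith
  have Di : IntervalIntegrable (Dv u Rb w) volume t (t + hh) := by
    have : IntegrableOn (Dv u Rb w) (Ioo 0 T) := (h.dev_ii Rb ws.continuous wU).integral_prod_right
    rw [intervalIntegrable_iff, uIoc_of_le (by linarith)]
    refine this.mono_set fun s hs => ⟨by linarith [hs.1, ht.1], by linarith [hs.2, hth.2]⟩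
  rw [intervalIntegral.integral_sub ii (by simp), ← E2,
    intervalIntegral.integral_add (Di.const_mul _) (by simp), intervalIntegral.integral_const_mul] at key
  simp only [intervalIntegral.integral_const, smul_eq_mul, add_sub_cancel_left] at key
  have e : Ee f0 f u ψ (t + hh) - Ee f0 f u (fun x => ψ (x + hh • w x)) t =
     ((∫ s in t..t+hh, Hf f u ψ s) - hh * Ee f0 f u g t) - Ee f0 f u Rm t := by rw [E1, Elin]; ring
  rw [e]; refine (abs_sub _ _).trans ((add_le_add key ER).trans (le_of_eq (by ring)))
end

lemma GF.cont {C M : ℝ} {g : E3 → ℝ} {v : E3 → E3} (h : GF C M g v) : Continuous v := by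
  rw [Metric.continuous_iff]; intro x ε hε; have h0 : 0 ≤ C * M := (norm_nonneg _).trans (h.bd 0); set κ := min 1 (ε / (2 * (C * M + 1))) with hκ
  have κ0 : 0 < κ := by positivity
  have κ1 : κ ≤ 1 := min_le_left _ _
  have κ2 : κ * (2 * (C * M + 1)) ≤ ε := by
    rw [← le_div_iff₀ (by positivity)]; exact min_le_right _ _
  have hl : 0 ≤ log (1 / κ) := log_nonneg (by rw [le_div_iff₀ κ0]; linarith)
  refine ⟨ε / (2 * ((C * M + 1) * (1 + log (1 / κ)))), by positivity, fun y hy => ?_⟩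
  rw [dist_eq_norm] at hy ⊢; refine (h.lip y x κ κ0 κ1).trans_lt ?_; rw [lt_div_iff₀ (by positivity)] at hy
  have : 0 ≤ ‖y - x‖ * (1 + log (1 / κ)) := by positivity
  nlinarith

lemma samp {a : ℝ → ℝ} {α β : ℝ} (hab : α < β) (ha : IntegrableOn a (Ioo α β)) {N : Set ℝ} (hN : volume N = 0) :
    ∃ s ∈ Ioo α β, s ∉ N ∧ (β - α) * a s ≤ ∫ s in α..β, a s := by
  have hv : (volume.restrict (Ioo α β)) ≠ 0 := by
    intro h; have := congrArg (fun μ => μ univ) h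
    simp at this; linarith
  have hN' : (volume.restrict (Ioo α β)) (N ∪ (Ioo α β)ᶜ) = 0 := by
    refine measure_union_null ?_ ?_
    · exact le_antisymm ((Measure.restrict_apply_le _ _).trans hN.le) zero_le
    · rw [Measure.restrict_apply measurableSet_Ioo.compl]; simp
  obtain ⟨s, hs, he⟩ := exists_notMem_null_le_average hv ha hN'; simp only [mem_union, not_or, mem_compl_iff, not_not] at hs; refine ⟨s, hs.2, hs.1, ?_⟩
  rw [average_eq, intervalIntegral.integral_of_le hab.le, integral_Ioc_eq_integral_Ioo] at *; have e : (volume.restrict (Ioo α β)).real univ = β - α := by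
    simp [Measure.real]; linarith
  rw [e, smul_eq_mul] at he; have := mll he (by linarith : 0 ≤ β - α)
  rwa [mul_inv_cancel_left₀ (by linarith : β - α ≠ 0)] at this

section
variable {T M : ℝ} {f0 : E3 → ℝ} {f : E3 → ℝ → ℝ} {u : E3 → ℝ → E3}

lemma FL.approx (h : FL T M f0 f u) (R : ℝ) {ε : ℝ} (hε : 0 < ε) :
    ∃ g : E3 × ℝ → E3, Continuous g ∧ HasCompactSupport g ∧
      Integrable (fun p : E3 × ℝ => nb R p.1 * ‖u p.1 p.2 - g p‖) (mT T) ∧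
      ∫ p, nb R p.1 * ‖u p.1 p.2 - g p‖ ∂(mT T) ≤ ε := by
  let d : E3 × ℝ → NNReal := fun p => (nb R p.1).toNNReal
  have dm : Measurable d := ((nb_meas R).comp measurable_fst).real_toNNReal
  have dc : ∀ p, (d p : ℝ) = nb R p.1 := fun p => Real.coe_toNNReal _ (nb_nonneg R _)
  let μ := (mT T).withDensity (fun p => (d p : ℝ≥0∞))
  have ni : Integrable (fun p : E3 × ℝ => nb R p.1) (mT T) := (nb_int R).comp_fst _
  have : IsFiniteMeasure μ := isFiniteMeasure_withDensity (by
    have := ni.lintegral_lt_top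
    exact this.ne)
  have ui : Integrable (fun p : E3 × ℝ => u p.1 p.2) μ :=
    Integrable.of_bound (h.um.mono_ac (withDensity_absolutelyContinuous _ _)) (Cv * M)
      (Eventually.of_forall fun p => h.ub _ _)
  obtain ⟨g, cg, hg, hc, gi⟩ := ui.exists_hasCompactSupport_integral_sub_le hε; obtain ⟨G, hG⟩ := cg.exists_bound_of_continuous hc; refine ⟨g, hc, cg, ?_, ?_⟩
  · refine (((nb_int R).mul_const (Cv * M + G)).comp_fst (volume.restrict (Ioo 0 T))).mono'
      (ni.1.mul (h.um.sub hc.aestronglyMeasurable).norm) (Eventually.of_forall fun p => ?_)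
    rw [norm_eq_abs, abs_mul, abs_of_nonneg (nb_nonneg R _), abs_norm]; exact mll ((norm_sub_le _ _).trans (add_le_add (h.ub _ _) (hG _))) (nb_nonneg R _)
  · rw [integral_withDensity_eq_integral_smul dm] at hg; simp only [NNReal.smul_def, dc, smul_eq_mul] at hg; exact hg

/-- iterate of Euler maps -/
def XX (h : ℝ) (w : ℕ → E3 → E3) : ℕ → E3 → E3
  | 0 => id
  | m + 1 => fun y => XX h w m y + h • w m (XX h w m y)

lemma XX_cont {h : ℝ} {w : ℕ → E3 → E3} (hw : ∀ m, Continuous (w m)) (m : ℕ) : Continuous (XX h w m) := by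
  induction m with
  | zero => exact continuous_id
  | succ m ih => exact ih.add (((hw m).comp ih).const_smul h)

lemma FL.dual (h : FL T M f0 f u) {Rb L L2 hh lb kb : ℝ} {w : ℕ → E3 → E3}
    (ws : ∀ m, CD (w m)) (wU : ∀ m x, ‖w m x‖ ≤ Cv * M)
    (wL : ∀ m x y, ‖w m x - w m y‖ ≤ L * ‖x - y‖) (wL2 : ∀ m x y, ‖fderiv ℝ (w m) x - fderiv ℝ (w m) y‖ ≤ L2 * ‖x - y‖)
    (hh0 : 0 ≤ hh) (hL : 0 ≤ L) (hL2 : 0 ≤ L2) (m : ℕ) :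
    ∀ (ψ : E3 → ℝ) (R l k : ℝ), TC R l k ψ → 0 ≤ k → R + m * hh * (Cv * M) ≤ Rb → m * hh < T →
      l * (1 + hh * L) ^ m ≤ lb → (1 + hh * L) ^ (2 * m) * (k + m * (hh * L2) * l) ≤ kb →
      |Ee f0 f u ψ (m * hh) - ∫ y, f0 y * ψ (XX hh w m y)| ≤
        ∑ i ∈ Finset.range m, (lb * M * (∫ s in (i*hh)..(i*hh+hh), Dv u Rb (w i) s) +
          hh ^ 2 * (M * νI Rb * ((kb * (Cv * M) + lb * L) * (Cv * M) + kb * (Cv * M) ^ 2))) := by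
  have hM : 0 ≤ M := by linarith [h.M1]
  have hU : 0 ≤ Cv * M := mul_nonneg Cv_pos.le hM
  have hν := νI_nonneg Rb
  induction m with
  | zero => intro ψ R l k hψ hk h1 h2 h3 h4; simp [Ee, XX]
  | succ m ih =>
    intro ψ R l k hψ hk h1 h2 h3 h4
    push_cast at h1 h2 h4; have hl := hψ.l0; have hhL : 0 ≤ hh * L := by positivity
    have mh : 0 ≤ m * hh := by positivity
    have q1 : 1 ≤ 1 + hh * L := by linarith
    have hm : 0 ≤ m * hh * (Cv * M) := by positivity
    obtain ⟨c1, c2⟩ := h.step (Rb := Rb) (t := m * hh) hψ (ws m) (wU m) (wL m) (wL2 m) hh0 (by linarith)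
      ⟨mh, by linarith⟩ ⟨by linarith, by linarith⟩ hL hL2 hk
    have hlb : l ≤ lb := le_trans (by
      have := mll (one_le_pow₀ q1 (n := m + 1)) hl; linarith) h3
    have hkb : k ≤ kb := le_trans (by
      have e1 := one_le_pow₀ q1 (n := 2 * (m + 1))
      have e2 : 0 ≤ (m + 1) * (hh * L2) * l := by positivity
      have := mul_le_mul e1 (by linarith : k ≤ k + (m + 1) * (hh * L2) * l) hk (zero_le_one.trans e1)
      linarith) h4
    have c3 := ih _ _ _ _ c1 (add_nonneg (mul_nonneg hk (sq_nonneg _)) (mul_nonneg hl (mul_nonneg hh0 hL2))) (by linarith) (by linarith)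
      (le_trans (le_of_eq (by ring)) h3) (le_trans (by
        set q := 1 + hh * L; set p := hh * L2 with hp; have hp0 : 0 ≤ p := by positivity
        have e : q ^ (2 * (m + 1)) = q ^ (2 * m) * q ^ 2 := by ring
        have q0 : 0 ≤ q := by linarith
        rw [e, mul_assoc (q ^ (2 * m)) (q ^ 2)]; refine mll ?_ (pow_nonneg q0 (2 * m))
        have b1 : l * p ≤ l * p * q ^ 2 := le_mul_of_one_le_right (by positivity) (one_le_pow₀ q1)
        have b2 : (m:ℝ) * p * l * q ≤ m * p * l * q ^ 2 :=
          mll (by nlinarith) (by positivity)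
        linarith) h4)
    rw [Finset.sum_range_succ]; have e : ((m + 1 : ℕ) : ℝ) * hh = m * hh + hh := by push_cast; ring
    rw [e]; have sub := abs_sub_le (Ee f0 f u ψ (m * hh + hh)) (Ee f0 f u (fun x => ψ (x + hh • w m x)) (m * hh))
      (∫ y, f0 y * ψ (XX hh w (m + 1) y))
    have D0 : 0 ≤ ∫ s in (m*hh)..(m*hh+hh), Dv u Rb (w m) s := by
      apply intervalIntegral.integral_nonneg (by linarith)
      intro s _; exact integral_nonneg fun x => mul_nonneg (nb_nonneg _ _) (norm_nonneg _)
    have c2' : l * M * (∫ s in (m*hh)..(m*hh+hh), Dv u Rb (w m) s) +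
      hh ^ 2 * (M * νI Rb * ((k * (Cv * M) + l * L) * (Cv * M) + k * (Cv * M) ^ 2)) ≤
      lb * M * (∫ s in (m*hh)..(m*hh+hh), Dv u Rb (w m) s) +
      hh ^ 2 * (M * νI Rb * ((kb * (Cv * M) + lb * L) * (Cv * M) + kb * (Cv * M) ^ 2)) := by gcongr
    have c3' : |Ee f0 f u (fun x => ψ (x + hh • w m x)) (m * hh) - ∫ y, f0 y * ψ (XX hh w (m + 1) y)| ≤ _ := c3
    linarith
end

lemma exp_est (n : ℝ) (hn : 0 ≤ n) : exp (-n) * (2 + n) * exp ((2 + n) / 4) ≤ 80 / (2 + n) := by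
  set x := 2 + n with hx; have hx0 : 0 < x := by linarith
  have e1 : exp (-n) = exp 1 * exp 1 * exp (-x) := by rw [← exp_add, ← exp_add]; congr 1; linarith
  have e2 : exp 1 * exp 1 ≤ 10 := by
    have := Real.exp_one_lt_d9
    have h0 := Real.exp_pos 1
    nlinarith
  have e3 : x / 4 ≤ exp (x / 4) := by linarith [add_one_le_exp (x / 4)]
  have e4 : x / 2 ≤ exp (x / 2) := by linarith [add_one_le_exp (x / 2)]
  have e5 : exp (-x) * exp (x / 4) * exp (x / 4) * exp (x / 2) = 1 := by
    rw [← exp_add, ← exp_add, ← exp_add, ← exp_zero]; congr 1; ring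
  rw [le_div_iff₀ hx0, e1]; have p : 0 ≤ exp (-x) * exp (x / 4) := by positivity
  calc exp 1 * exp 1 * exp (-x) * x * exp (x / 4) * x
      = (exp 1 * exp 1) * 8 * ((exp (-x) * exp (x / 4)) * ((x / 4) * (x / 2))) := by ring
    _ ≤ 10 * 8 * ((exp (-x) * exp (x / 4)) * (exp (x / 4) * exp (x / 2))) := by gcongr
    _ = 80 := by rw [← mul_assoc (exp (-x) * exp (x / 4)), e5]; norm_num

def MollC (C1 C2 : ℝ) : Prop := ∀ (v : E3 → E3) (U a b κ : ℝ), 0 ≤ a → 0 ≤ b → 0 < κ → Continuous v →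
    (∀ x, ‖v x‖ ≤ U) → (∀ x x', ‖v x - v x'‖ ≤ a * ‖x - x'‖ + b) →
    ∃ w : E3 → E3, CD w ∧ (∀ x, ‖w x‖ ≤ U) ∧ (∀ x, ‖w x - v x‖ ≤ a * κ + b) ∧
      (∀ x x', ‖w x - w x'‖ ≤ C1 * (a + b / κ) * ‖x - x'‖) ∧
      (∀ x x', ‖fderiv ℝ w x - fderiv ℝ w x'‖ ≤ C2 * U / κ ^ 2 * ‖x - x'‖)

section
variable {T M : ℝ} {f0 : E3 → ℝ} {f : E3 → ℝ → ℝ} {u : E3 → ℝ → E3}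

lemma FL.pick {C1 C2 : ℝ} (H : MollC C1 C2) (h : FL T M f0 f u) (R n : ℝ) (hn : 0 ≤ n)
    {g : E3 × ℝ → E3}
    (gi : Integrable (fun p : E3 × ℝ => nb R p.1 * ‖u p.1 p.2 - g p‖) (mT T)) {hh t ε : ℝ}
    (gu : ∀ x s s', |s - s'| ≤ hh → ‖g (x, s) - g (x, s')‖ ≤ ε)
    (ht : 0 ≤ t) (hh0 : 0 < hh) (htT : t + hh < T) {N : Set ℝ} (hN : volume N = 0) :
    ∃ (s : ℝ) (w : E3 → E3), s ∈ Ioo t (t + hh) ∧ s ∉ N ∧ CD w ∧ (∀ x, ‖w x‖ ≤ Cv * M) ∧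
      (∀ x, ‖w x - u x s‖ ≤ Cv * M * (exp (-n) * (2 + n))) ∧
      (∀ x x', ‖w x - w x'‖ ≤ C1 * (Cv * M) * (2 + n) * ‖x - x'‖) ∧
      (∀ x x', ‖fderiv ℝ w x - fderiv ℝ w x'‖ ≤ C2 * (Cv * M) / (exp (-n)) ^ 2 * ‖x - x'‖) ∧
      ∫ s in t..t+hh, Dv u R w s ≤ 2 * (∫ s in t..t+hh, ∫ x, nb R x * ‖u x s - g (x, s)‖) +
        hh * (νI R * (ε + Cv * M * (exp (-n) * (2 + n)))) := by
  set a : ℝ → ℝ := fun s => ∫ x, nb R x * ‖u x s - g (x, s)‖ with ha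
  have hM : 0 ≤ M := by linarith [h.M1]
  have hU : 0 ≤ Cv * M := mul_nonneg Cv_pos.le hM
  have ai : IntegrableOn a (Ioo 0 T) := gi.integral_prod_right
  have sub : Ioo t (t + hh) ⊆ Ioo 0 T := fun s hs => ⟨by linarith [hs.1], by linarith [hs.2]⟩
  have ga := (ae_restrict_iff' measurableSet_Ioo).1 gi.prod_left_ae
  obtain ⟨s, hs, hsN, he⟩ := samp (by linarith : t < t + hh) (ai.mono_set sub)
    (measure_union_null hN (ae_iff.1 ga))
  simp only [mem_union, not_or, mem_ofPred_eq, not_not] at hsN; have gs := hsN.2 (sub hs); rw [add_sub_cancel_left] at he; have κ0 := exp_pos (-n)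
  have lg : log (1 / exp (-n)) = n := by rw [one_div, ← exp_neg, neg_neg, log_exp]
  obtain ⟨w, w1, w2, w3, w4, w5⟩ := H (fun x => u x s) (Cv * M) (Cv * M * (1 + n)) (Cv * M * exp (-n)) (exp (-n))
    (by positivity) (by positivity) κ0 (h.gf s).cont (fun x => h.ub x s) (fun x x' => by
      refine ((h.gf s).lip x x' (exp (-n)) κ0 (exp_le_one_iff.2 (by linarith))).trans (le_of_eq ?_)
      rw [lg]; ring)
  have w3' : ∀ x, ‖w x - u x s‖ ≤ Cv * M * (exp (-n) * (2 + n)) := fun x =>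
    (w3 x).trans (le_of_eq (by ring))
  refine ⟨s, w, hs, hsN.1, w1, w2, w3', fun x x' => (w4 x x').trans (le_of_eq ?_), w5, ?_⟩
  · rw [mul_div_assoc, div_self κ0.ne']; ring
  set E := Cv * M * (exp (-n) * (2 + n)) with hE; have Di : IntervalIntegrable (Dv u R w) volume t (t + hh) := by
    have : IntegrableOn (Dv u R w) (Ioo 0 T) := (h.dev_ii R w1.continuous w2).integral_prod_right
    rw [intervalIntegrable_iff, uIoc_of_le (by linarith)]
    refine this.mono_set fun s hs => ⟨by linarith [hs.1], by linarith [hs.2]⟩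
  have aii : IntervalIntegrable a volume t (t + hh) := by
    rw [intervalIntegrable_iff, uIoc_of_le (by linarith)]
    refine ai.mono_set fun s hs => ⟨by linarith [hs.1], by linarith [hs.2]⟩
  have key : ∫ s in t..t+hh, Dv u R w s ≤ ∫ s' in t..t+hh, (a s' + (a s + νI R * (ε + E))) := by
    refine intervalIntegral.integral_mono_ae_restrict (by linarith) Di (aii.add (by simp)) ?_
    have a3 := (ae_restrict_iff' measurableSet_Ioo).1 (h.dev_ii R w1.continuous w2).prod_left_ae
    rw [EventuallyLE, ae_restrict_iff' measurableSet_Icc]; have nt : ∀ᵐ s' : ℝ, s' ≠ t := by simp [ae_iff]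
    filter_upwards [ga, a3, nt] with s' g1 d1 hne hs'
    have hs'' : s' ∈ Ioo 0 T := ⟨lt_of_le_of_lt ht (lt_of_le_of_ne hs'.1 hne.symm), by linarith [hs'.2]⟩
    have g1 := g1 hs''
    simp only [ha, νI]; unfold Dv; have gg : Integrable (fun x => nb R x * ‖u x s - g (x, s)‖ + nb R x * (ε + E)) := gs.add ((nb_int R).mul_const _)
    rw [← integral_mul_const, ← integral_add gs ((nb_int R).mul_const _), ← integral_add g1 gg]; refine integral_mono (d1 hs'') (g1.add gg) fun x => ?_
    rw [← mul_add, ← mul_add]; refine mll ?_ (nb_nonneg R x)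
    have e : u x s' - w x = (u x s' - g (x, s')) + (g (x, s') - g (x, s)) - (u x s - g (x, s)) - (w x - u x s) := by abel
    rw [e]; have n1 := norm_sub_le ((u x s' - g (x, s')) + (g (x, s') - g (x, s)) - (u x s - g (x, s))) (w x - u x s)
    have n2 := norm_sub_le ((u x s' - g (x, s')) + (g (x, s') - g (x, s))) (u x s - g (x, s))
    have n3 := norm_add_le (u x s' - g (x, s')) (g (x, s') - g (x, s))
    have n4 := gu x s' s (by rw [abs_le]; constructor <;> linarith [hs'.1, hs'.2, hs.1, hs.2])
    linarith [w3' x]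
  rw [intervalIntegral.integral_add aii (by simp)] at key
  simp only [intervalIntegral.integral_const, smul_eq_mul, add_sub_cancel_left] at key; linarith
end

set_option maxHeartbeats 1000000 in
theorem flowD : ∃ C1 : ℝ, 1 ≤ C1 ∧ ∀ {T M : ℝ} {f0 : E3 → ℝ} {f : E3 → ℝ → ℝ} {u : E3 → ℝ → E3},
    FL T M f0 f u → ∀ τ : ℝ, 0 < τ → τ < T → C1 * (Cv * M) * τ ≤ 1 / 4 → ∀ (R δ : ℝ), 0 < δ → ∀ (K0 : ℕ) (N : Set ℝ),
    volume N = 0 → ∃ (K : ℕ) (s : ℕ → ℝ) (X : ℕ → E3 → E3), K0 ≤ K ∧ 0 < K ∧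
      (∀ m < K, s m ∈ Ioo (m * (τ / K)) ((m + 1) * (τ / K)) ∧ s m ∉ N) ∧ (∀ m, Continuous (X m)) ∧
      (∀ y, X 0 y = y) ∧
      (∀ m < K, ∀ y, ‖X (m + 1) y - X m y - (τ / K) • u (X m y) (s m)‖ ≤ (τ / K) * δ) ∧
      ∀ ψ, TC R δ⁻¹ δ⁻¹ ψ → ∀ m ≤ K, |Ee f0 f u ψ (m * (τ / K)) - ∫ y, f0 y * ψ (X m y)| ≤ δ := by
  obtain ⟨C1, C2, hC1, hC2, H0⟩ := moll; have H : MollC C1 C2 := H0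
  clear H0; refine ⟨C1, hC1, fun {T M f0 f u} h τ τ0 τT hτ R δ hδ K0 N hN => ?_⟩
  have hM : 1 ≤ M := h.M1
  have hM0 : 0 ≤ M := by linarith
  set U := Cv * M with hUd; have hU : 0 ≤ U := mul_nonneg Cv_pos.le hM0; set Rb := R + τ * U with hRb; have hν := νI_nonneg Rb
  -- choose n
  set A := U + δ⁻¹ * M * τ * νI Rb * U with hA; have hA0 : 0 ≤ A := by positivity
  set n := 320 * A / δ with hn; have hn0 : 0 ≤ n := by positivity
  set P := exp (-n) * (2 + n) * exp ((2 + n) / 4) with hP; have hP0 : 0 ≤ P := by positivity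
  have hAP : A * P ≤ δ / 4 := by
    have := mll (exp_est n hn0) hA0
    refine this.trans ?_
    rw [← mul_div_assoc, div_le_iff₀ (by linarith)]
    have : 320 * A = n * δ := by rw [hn]; field_simp
    linarith
  have hEP : U * (exp (-n) * (2 + n)) ≤ U * P := by
    refine mll ?_ hU
    exact le_mul_of_one_le_right (by positivity) (one_le_exp (by linarith))
  set E := U * (exp (-n) * (2 + n)) with hE; have hE0 : 0 ≤ E := by positivity
  have hEδ : E ≤ δ := by
    have : 0 ≤ δ⁻¹ * M * τ * νI Rb * U * P := by positivity
    have e : A * P = U * P + δ⁻¹ * M * τ * νI Rb * U * P := by rw [hA]; ring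
    linarith
  set lb := δ⁻¹ * exp ((2 + n) / 4) with hlb; have lb0 : 0 < lb := by positivity
  have hB1 : lb * M * (τ * (νI Rb * E)) ≤ δ / 4 := by
    have : lb * M * (τ * (νI Rb * E)) = δ⁻¹ * M * τ * νI Rb * U * P := by rw [hlb, hE, hP]; ring
    rw [this]; have : 0 ≤ U * P := by positivity
    have e : A * P = U * P + δ⁻¹ * M * τ * νI Rb * U * P := by rw [hA]; ring
    linarith
  set L := C1 * U * (2 + n) with hLd; have hL : 0 ≤ L := by positivity
  set L2 := C2 * U / (exp (-n)) ^ 2 with hL2d; have hL2 : 0 ≤ L2 := by positivity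
  set kb := exp ((2 + n) / 2) * (δ⁻¹ + τ * L2 * δ⁻¹) with hkb; have kb0 : 0 ≤ kb := by positivity
  -- ε
  set ε := δ / (4 * (lb * M * (2 + τ * νI Rb) + 1)) with hε; have ε0 : 0 < ε := by positivity
  have hB2 : lb * M * (2 * ε + τ * (νI Rb * ε)) ≤ δ / 4 := by
    have : ε * (4 * (lb * M * (2 + τ * νI Rb) + 1)) = δ := by rw [hε]; field_simp
    linarith
  clear_value ε P A; obtain ⟨g, gc, gs, gi, ge⟩ := h.approx Rb ε0
  obtain ⟨η, η0, hη⟩ := Metric.uniformContinuous_iff.1 (gs.uniformContinuous_of_continuous gc) ε ε0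
  set Cc := M * νI Rb * ((kb * U + lb * L) * U + kb * U ^ 2) with hCc; have Cc0 : 0 ≤ Cc := by positivity
  clear_value kb lb n; obtain ⟨K1, hK1⟩ := exists_nat_gt (τ / η); obtain ⟨K2, hK2⟩ := exists_nat_gt (4 * τ * τ * Cc / δ); set K := K0 + K1 + K2 + 1 with hK
  have Kc : (K : ℝ) = K0 + K1 + K2 + 1 := by rw [hK]; push_cast; ring
  have nn0 : (0:ℝ) ≤ K0 := Nat.cast_nonneg _
  have nn1 : (0:ℝ) ≤ K1 := Nat.cast_nonneg _
  have nn2 : (0:ℝ) ≤ K2 := Nat.cast_nonneg _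
  have K0' : (0:ℝ) < K := by linarith
  set hh := τ / K with hhd; have hh0 : 0 < hh := by positivity
  have Khh : K * hh = τ := by rw [hhd]; field_simp
  have hhη : hh < η := by
    rw [hhd, div_lt_iff₀ K0']; rw [div_lt_iff₀ η0] at hK1; refine hK1.trans_le ?_; rw [mul_comm η]; exact mlr (by linarith) η0.le
  have hB3 : τ * hh * Cc ≤ δ / 4 := by
    rw [div_lt_iff₀ hδ] at hK2; have k2 : (K2:ℝ) * δ ≤ K * δ := mlr (by linarith) hδ.le
    have : 4 * (τ * τ * Cc) ≤ K * δ := by linarith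
    have : τ * hh * Cc = τ * τ * Cc / K := by rw [hhd]; ring
    rw [this, div_le_iff₀ K0']; linarith
  have mhτ : ∀ m : ℕ, m ≤ K → m * hh ≤ τ := fun m hm => by
    rw [← Khh]; exact mlr (by exact_mod_cast hm) hh0.le
  have gu : ∀ x s s', |s - s'| ≤ hh → ‖g (x, s) - g (x, s')‖ ≤ ε := fun x s s' hs => by
    rw [← dist_eq_norm]; refine (hη ?_).le; rw [Prod.dist_eq]; simp [Real.dist_eq]; exact hs.trans_lt hhη
  set a : ℝ → ℝ := fun s => ∫ x, nb Rb x * ‖u x s - g (x, s)‖ with ha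
  have ex : ∀ m : ℕ, ∃ (s : ℝ) (w : E3 → E3), CD w ∧ (∀ x, ‖w x‖ ≤ Cv * M) ∧
      (∀ x x', ‖w x - w x'‖ ≤ L * ‖x - x'‖) ∧
      (∀ x x', ‖fderiv ℝ w x - fderiv ℝ w x'‖ ≤ L2 * ‖x - x'‖) ∧
      (m < K → (s ∈ Ioo (m * hh) ((m + 1) * hh) ∧ s ∉ N) ∧ (∀ x, ‖w x - u x s‖ ≤ E) ∧
      ∫ s in m*hh..m*hh+hh, Dv u Rb w s ≤ 2 * (∫ s in m*hh..m*hh+hh, a s) + hh * (νI Rb * (ε + E))) := by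
    intro m
    by_cases hm : m < K
    · have : (m + 1 : ℝ) * hh ≤ τ := by have := mhτ (m + 1) hm; push_cast at this; exact this
      obtain ⟨s, w, b1, b2, b3, b4, b5, b6, b7, b8⟩ := h.pick H Rb n hn0 gi gu (by positivity : 0 ≤ (m:ℝ) * hh) hh0 (by linarith) hN
      refine ⟨s, w, b3, b4, b6, b7, fun _ => ⟨⟨⟨b1.1, by linarith [b1.2]⟩, b2⟩, b5, b8⟩⟩
    · refine ⟨0, fun _ => 0, contDiff_const, fun x => by simpa using hU, fun x x' => by simp; positivity,
        fun x x' => by simp; positivity, fun h => absurd h hm⟩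
  choose s w w1 w2 w3 w4 w5 using ex
  refine ⟨K, s, XX hh w, by omega, by omega, fun m hm => (w5 m hm).1, XX_cont fun m => (w1 m).continuous,
    fun y => rfl, fun m hm y => ?_, fun ψ hψ m hm => ?_⟩
  · have : XX hh w (m + 1) y - XX hh w m y - hh • u (XX hh w m y) (s m) = hh • (w m (XX hh w m y) - u (XX hh w m y) (s m)) := by
      show XX hh w m y + hh • w m (XX hh w m y) - _ - _ = _
      module
    rw [this, norm_smul, norm_eq_abs, abs_of_pos hh0]; exact mll (((w5 m hm).2.1 _).trans hEδ) hh0.le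
  · have q0 : 0 ≤ 1 + hh * L := by positivity
    have q1 : 1 + hh * L ≤ exp (hh * L) := by linarith [add_one_le_exp (hh * L)]
    have mh := mhτ m hm
    have mh0 : 0 ≤ m * hh := by positivity
    have ex1 : m * (hh * L) ≤ (2 + n) / 4 := by
      have e : τ * L ≤ (2 + n) / 4 := by
        have : τ * L = C1 * U * τ * (2 + n) := by rw [hLd]; ring
        rw [this]; have := mlr hτ (by linarith : 0 ≤ 2 + n)
        linarith
      have := mlr mh hL
      linarith
    have qm : (1 + hh * L) ^ m ≤ exp ((2 + n) / 4) := by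
      refine (pow_le_pow_left₀ q0 q1 m).trans ?_
      rw [← exp_nat_mul]; exact exp_le_exp.2 ex1
    have q2m : (1 + hh * L) ^ (2 * m) ≤ exp ((2 + n) / 2) := by
      refine (pow_le_pow_left₀ q0 q1 (2 * m)).trans ?_
      rw [← exp_nat_mul]; refine exp_le_exp.2 ?_
      push_cast; linarith
    have D := h.dual (Rb := Rb) (lb := lb) (kb := kb) w1 w2 w3 w4 hh0.le hL hL2 m ψ R δ⁻¹ δ⁻¹ hψ (by positivity)
      (by rw [hRb]; linarith [mlr mh hU]) (by linarith)
      (by rw [hlb]; exact mll qm (by positivity)) (by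
        rw [hkb]; refine mul_le_mul q2m ?_ (by positivity) (by positivity)
        have := mlr mh (by positivity : 0 ≤ L2 * δ⁻¹)
        linarith)
    refine D.trans ?_
    have aI : ∀ i < m, IntervalIntegrable a volume ((i : ℕ) * hh) ((i + 1 : ℕ) * hh) := fun i hi => by
      have i1 := mhτ (i + 1) (by omega)
      push_cast at i1 ⊢; rw [intervalIntegrable_iff, uIoc_of_le (by linarith)]
      have : 0 ≤ (i:ℝ) * hh := by positivity
      refine IntegrableOn.mono_set (t := Ioo 0 T) gi.integral_prod_right fun s hs => ⟨by linarith [hs.1], by linarith [hs.2]⟩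
    have sumA : ∑ i ∈ Finset.range m, ∫ s in (i*hh)..(i*hh+hh), a s ≤ ε := by
      have := intervalIntegral.sum_integral_adjacent_intervals aI
      have e : ∀ i : ℕ, ((i + 1 : ℕ) : ℝ) * hh = i * hh + hh := fun i => by push_cast; ring
      simp only [e] at this; rw [this]; refine le_trans ?_ ge; rw [integral_prod_symm _ gi]; rw [intervalIntegral.integral_of_le (by simpa using mh0)]
      refine setIntegral_mono_set gi.integral_prod_right (Eventually.of_forall fun s =>
        integral_nonneg fun x => mul_nonneg (nb_nonneg _ _) (norm_nonneg _)) ?_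
      refine LE.le.eventuallyLE fun s hs => ⟨by simpa using hs.1, by linarith [hs.2]⟩
    have each : ∀ i ∈ Finset.range m, (lb * M * (∫ s in (i*hh)..(i*hh+hh), Dv u Rb (w i) s) + hh ^ 2 * Cc) ≤
        lb * M * 2 * (∫ s in (i*hh)..(i*hh+hh), a s) + (lb * M * (hh * (νI Rb * (ε + E))) + hh ^ 2 * Cc) := by
      intro i hi; rw [Finset.mem_range] at hi; have := mll (w5 i (by omega)).2.2 (by positivity : 0 ≤ lb * M)
      linarith
    refine (Finset.sum_le_sum each).trans ?_
    rw [Finset.sum_add_distrib, ← Finset.mul_sum, Finset.sum_const, Finset.card_range, nsmul_eq_mul]; have t1 := mll sumA (by positivity : 0 ≤ lb * M * 2)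
    have t2 := mlr mh (by positivity : 0 ≤ lb * M * (νI Rb * (ε + E)) + hh * Cc)
    linarith

lemma Gk_zero {ρ R : ℝ} {q : E3} (hρ : 0 < ρ) (h : ‖q‖ ≤ ρ) : Gk ρ R q = 0 := by
  unfold Gk; rw [cutθ_zero hρ h, mul_zero]
lemma Gk_zero' {ρ R : ℝ} {q : E3} (hR : 0 < R) (h : 2 * R ≤ ‖q‖) : Gk ρ R q = 0 := by
  unfold Gk; rw [cutθ_zero' hR h, mul_zero]

lemma Gk_pre {q : E3} (h : q 2 ≤ 0) :
    0 ≤ -(3 / (8 * π)) * (q 0 ^ 2 + q 1 ^ 2) * q 2 * (‖q‖ ^ 5)⁻¹ := by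
  have h1 : 0 ≤ (3 / (8 * π)) * (q 0 ^ 2 + q 1 ^ 2) * (-q 2) * (‖q‖ ^ 5)⁻¹ :=
    mul_nonneg (mul_nonneg (by positivity) (by linarith)) (by positivity)
  linarith

lemma Gk_nonneg {ρ R : ℝ} {q : E3} (h : q 2 ≤ 0) : 0 ≤ Gk ρ R q :=
  mul_nonneg (Gk_pre h) (cutθ_nonneg _ _ _)

lemma Gk_anti {ρ ρ' R : ℝ} {q : E3} (hρ : 0 < ρ) (h' : ρ ≤ ρ') (h : q 2 ≤ 0) :
    Gk ρ' R q ≤ Gk ρ R q :=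
  mll (cutθ_anti hρ h') (Gk_pre h)

lemma Gk_bd {ρ R : ℝ} (hρ : 0 < ρ) (q : E3) : |Gk ρ R q| ≤ (ρ ^ 2)⁻¹ := by
  rcases le_or_gt ‖q‖ ρ with h | h
  · rw [Gk_zero hρ h, abs_zero]; positivity
  have hq : 0 < ‖q‖ := hρ.trans h
  have h3 : |3 / (8 * π)| ≤ 1 := by
    rw [abs_of_pos (by positivity), div_le_one (by positivity)]
    linarith [pi_gt_three]
  have h4 : |q 0 ^ 2 + q 1 ^ 2| ≤ ‖q‖ ^ 2 := by
    rw [abs_of_nonneg (by positivity), nsq]; linarith [sq_nonneg (q 2)]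
  have h5 : |cutθ ρ R q| ≤ 1 := by rw [abs_of_nonneg (cutθ_nonneg _ _ _)]; exact cutθ_le _ _ _
  unfold Gk; rw [abs_mul, abs_mul, abs_mul, abs_mul, abs_neg, abs_inv, abs_pow, abs_norm]
  calc _ ≤ 1 * ‖q‖ ^ 2 * ‖q‖ * (‖q‖ ^ 5)⁻¹ * 1 := by gcongr; exact coord_le q 2
    _ = (‖q‖ ^ 2)⁻¹ := by field_simp
    _ ≤ _ := by gcongr

lemma Gk_smooth {ρ R : ℝ} (hρ : 0 < ρ) : CD (Gk ρ R) := by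
  rw [contDiff_iff_contDiffAt]; intro q
  by_cases hq : q = 0
  · subst hq; have : Gk ρ R =ᶠ[nhds (0 : E3)] fun _ => 0 := by
      filter_upwards [Metric.ball_mem_nhds (0 : E3) hρ] with y hy
      exact Gk_zero hρ (mem_ball_zero_iff.1 hy).le
    exact contDiffAt_const.congr_of_eventuallyEq this
  · have hc (i : Fin 3) : CD (fun q : E3 => q i) := contDiff_euclidean.1 contDiff_id i
    have hn : ContDiffAt ℝ (⊤ : ℕ∞) (fun q : E3 => ‖q‖) q := contDiffAt_id.norm ℝ hq
    have hs : CD (fun q : E3 => ‖q‖ ^ 2) := contDiff_norm_sq ℝ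
    have ht : CD Real.smoothTransition := Real.smoothTransition.contDiff
    have hn0 : ‖q‖ ^ 5 ≠ 0 := by simpa using hq
    have hct : CD (cutθ ρ R) := by
      unfold cutθ; exact (ht.comp (((hs.div_const _).sub contDiff_const).div_const _)).mul
        (ht.comp (contDiff_const.sub (hs.div_const _)))
    unfold Gk; exact ((((contDiffAt_const.mul (((hc 0).pow 2).add ((hc 1).pow 2)).contDiffAt).mul
      (hc 2).contDiffAt).mul ((hn.pow 5).inv hn0)).mul hct.contDiffAt)

lemma Gk_cont {ρ R : ℝ} (hρ : 0 < ρ) : Continuous (Gk ρ R) := (Gk_smooth hρ).continuous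

lemma Gk_lower {ρ R s A B Λ : ℝ} {q : E3} (hρ : 0 < ρ) (hR : 0 < R) (hs : 0 < s) (hA : 1 ≤ A)
    (hB : 0 < B) (hΛ : 0 < Λ) (hAB : 1 / 2 ≤ B * A ^ 2) (h1 : A * s / 2 ≤ rc q)
    (h2 : B * s / 2 ≤ -q 2) (h3 : ‖q‖ ≤ 10 * Λ * s) (h4 : 2 * ρ ≤ ‖q‖) (h5 : ‖q‖ ≤ R) :
    (16 * 10 ^ 6 * Λ ^ 5 * s ^ 2)⁻¹ ≤ Gk ρ R q := by
  have hq : 0 < ‖q‖ := by linarith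
  have e : Gk ρ R q = (3 / (8 * π)) * rc q ^ 2 * (-q 2) * (‖q‖ ^ 5)⁻¹ := by
    unfold Gk; rw [cutθ_one hρ hR h4 h5, rc_sq]; ring
  have h6 : (1 : ℝ) / 10 ≤ 3 / (8 * π) := by
    rw [div_le_div_iff₀ (by norm_num) (by positivity)]
    linarith [pi_lt_d2]
  have h7 : (0:ℝ) < B * s / 2 := by positivity
  rw [e]
  calc (16 * 10 ^ 6 * Λ ^ 5 * s ^ 2)⁻¹ = 1 / 10 * (s ^ 3 / 8 * (1 / 2)) * ((10 * Λ * s) ^ 5)⁻¹ := by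
        field_simp; norm_num
    _ ≤ 1 / 10 * (s ^ 3 / 8 * (B * A ^ 2)) * ((10 * Λ * s) ^ 5)⁻¹ := by gcongr
    _ = 1 / 10 * (A * s / 2) ^ 2 * (B * s / 2) * ((10 * Λ * s) ^ 5)⁻¹ := by ring
    _ ≤ _ := by
      have h8 : 0 ≤ 3 / (8 * π) * rc q ^ 2 * -q 2 := mul_nonneg (by positivity) (h7.le.trans h2)
      gcongr

def Bp (r : ℝ) : Set E3 := {y | r ≤ rc y ∧ rc y ≤ 2 * r ∧ r ≤ -y 2 ∧ -y 2 ≤ 2 * r}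

lemma Bp_meas (r : ℝ) : MeasurableSet (Bp r) := by
  have h1 := rc_cont
  have h2 : Continuous (fun y : E3 => -y 2) := by fun_prop
  exact ((isClosed_le continuous_const h1).inter ((isClosed_le h1 continuous_const).inter
    ((isClosed_le continuous_const h2).inter (isClosed_le h2 continuous_const)))).measurableSet

structure Dat (c ρ : ℕ → ℝ) (Ib : ℝ) (f0 : E3 → ℝ) : Prop where
  ρ0 : ∀ j, 0 < ρ j
  ρ1 : ρ 0 ≤ 1
  gap : ∀ j : ℕ, 4 * ((j : ℝ) + 1) * ρ (j + 1) ≤ ρ j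
  c0 : ∀ j, 0 < c j
  c1 : ∀ j, c j ≤ 1
  I0 : 0 < Ib
  I1 : Ib ≤ 1
  f00 : ∀ y, 0 ≤ f0 y
  fi : Integrable f0
  fs : ∀ y, f0 y ≠ 0 → ∃ j, y ∈ Bp (ρ j)
  mass : ∀ j, c j * ρ j ^ 2 * Ib ≤ ∫ y in Bp (ρ j), f0 y

lemma Dat.gap4 {c ρ Ib f0} (D : Dat c ρ Ib f0) (j : ℕ) : 4 * ρ (j + 1) ≤ ρ j := by
  have h1 := D.gap j
  have h2 := mul_nonneg (Nat.cast_nonneg (α := ℝ) j) (D.ρ0 (j + 1)).le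
  linarith

lemma Dat.anti {c ρ Ib f0} (D : Dat c ρ Ib f0) : Antitone ρ :=
  antitone_nat_of_succ_le fun j => by linarith [D.gap4 j, D.ρ0 (j + 1)]

lemma Dat.lt4 {c ρ Ib f0} (D : Dat c ρ Ib f0) {i j : ℕ} (h : i < j) : 4 * ρ j ≤ ρ i := by
  have := D.anti (Nat.succ_le_of_lt h)
  have h4 := D.gap4 i
  simp only [Nat.succ_eq_add_one] at this; linarith

lemma Dat.disj {c ρ Ib f0} (D : Dat c ρ Ib f0) : Pairwise (fun i j => Disjoint (Bp (ρ i)) (Bp (ρ j))) := by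
  have key : ∀ i j, i < j → Disjoint (Bp (ρ i)) (Bp (ρ j)) := by
    intro i j h; rw [Set.disjoint_left]; rintro y ⟨a1, _⟩ ⟨_, b2, _⟩; linarith [D.lt4 h, D.ρ0 j]
  intro i j hij
  rcases lt_or_gt_of_ne hij with h | h
  · exact key i j h
  · exact (key j i h).symm

lemma Bp_norm {r : ℝ} {y : E3} (hr : 0 < r) (h : y ∈ Bp r) : ‖y‖ ≤ 3 * r := by
  obtain ⟨h1, h2, h3, h4⟩ := h; apply norm_le_of_sq (by positivity)
  rw [← rc_sq]; have a : rc y ^ 2 ≤ (2 * r) ^ 2 := by gcongr; exact rc_nonneg _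
  have b : (-y 2) ^ 2 ≤ (2 * r) ^ 2 := by gcongr; linarith
  have : 0 ≤ r ^ 2 := by positivity
  linarith [neg_sq (y 2)]

lemma geom1 {A s e a0 a1 p0 p1 : ℝ} (hs : 0 < s) (hA : 0 < A) (h1 : s ^ 2 ≤ a0 ^ 2 + a1 ^ 2)
    (h2 : a0 ^ 2 + a1 ^ 2 ≤ (2 * s) ^ 2) (he : e ≤ 1 / 32)
    (d0 : |p0 - A * a0| ≤ A * e * s) (d1 : |p1 - A * a1| ≤ A * e * s) :
    (A * s / 2) ^ 2 ≤ p0 ^ 2 + p1 ^ 2 ∧ p0 ^ 2 + p1 ^ 2 ≤ (3 * A * s) ^ 2 := by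
  have hAs : 0 < A * s := by positivity
  have f0 : |p0 - A * a0| ≤ A * s / 32 := by nlinarith
  have f1 : |p1 - A * a1| ≤ A * s / 32 := by nlinarith
  have b0 : |A * a0| ≤ 2 * (A * s) := by
    apply abs_le_of_sq_le_sq _ (by positivity)
    have := mll h2 (sq_nonneg A)
    nlinarith [sq_nonneg (A * a1)]
  have b1 : |A * a1| ≤ 2 * (A * s) := by
    apply abs_le_of_sq_le_sq _ (by positivity)
    have := mll h2 (sq_nonneg A)
    nlinarith [sq_nonneg (A * a0)]
  have h1' := mll h1 (sq_nonneg A)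
  have h2' := mll h2 (sq_nonneg A)
  have g0 : |(p0 - A * a0) * (A * a0)| ≤ A * s / 32 * (2 * (A * s)) := by
    rw [abs_mul]; gcongr
  have g1 : |(p1 - A * a1) * (A * a1)| ≤ A * s / 32 * (2 * (A * s)) := by
    rw [abs_mul]; gcongr
  have q0 : (p0 - A * a0) ^ 2 ≤ (A * s / 32) ^ 2 := by rw [← sq_abs]; gcongr
  have q1 : (p1 - A * a1) ^ 2 ≤ (A * s / 32) ^ 2 := by rw [← sq_abs]; gcongr
  rw [abs_le] at g0 g1; have z0 := sq_nonneg (p0 - A * a0); have z1 := sq_nonneg (p1 - A * a1); have z2 := sq_nonneg (A * s)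
  constructor <;> linarith [g0.1, g0.2, g1.1, g1.2]

def Sd (Λ : ℝ) (ρ : ℕ → ℝ) (f0 : E3 → ℝ) (Q : E3 → E3) (n : ℕ) : ℝ :=
  ∫ y, f0 y * Gk (ρ n) (10 * Λ) (Q y)

structure PD (N K : ℕ) (Λ h b Sb : ℝ) (ρ : ℕ → ℝ) (f0 : E3 → ℝ) (P : ℕ → E3 → E3) : Prop where
  L4 : 4 ≤ Λ
  h0 : 0 < h
  b0 : 0 ≤ b
  small : 32 * Λ ^ 2 * (K * h * b) ≤ 1
  nxt : 12 * Λ * ρ (N + 1) ≤ ρ N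
  Sbd : (ρ N ^ 2)⁻¹ * ∫ y, f0 y ≤ Sb
  hS : h * Sb ≤ 1 / 4
  hS2 : 10 * K * h ^ 2 * Sb ^ 2 ≤ 1
  cont : ∀ m, Continuous (P m)
  P0 : ∀ y, P 0 y = y
  step : ∀ n ≤ N, ∀ m < K, ∀ y, ‖P m y‖ ≤ 10 * Λ * ρ n →
    ‖P (m + 1) y - P m y - (h * Sd Λ ρ f0 (P m) n) • Jm (P m y)‖ ≤ h * b * ρ n

structure DInv (N : ℕ) (Λ h b Sb : ℝ) (ρ A B : ℕ → ℝ) (Q : E3 → E3) (m : ℕ) : Prop where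
  a1 : ∀ n ≤ N, 1 ≤ A n
  a2 : ∀ n ≤ N, A n ≤ A N
  b1 : ∀ n ≤ N, 0 < B n
  b2 : ∀ n ≤ N, B n * A n ^ 2 ≤ 1
  b3 : ∀ n ≤ N, 1 - 5 * m * h ^ 2 * Sb ^ 2 ≤ B n * A n ^ 2
  p0 : ∀ n ≤ N, ∀ y ∈ Bp (ρ n), |Q y 0 - A n * y 0| ≤ A n * (m * h * b) * ρ n
  p1 : ∀ n ≤ N, ∀ y ∈ Bp (ρ n), |Q y 1 - A n * y 1| ≤ A n * (m * h * b) * ρ n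
  p2 : ∀ n ≤ N, ∀ y ∈ Bp (ρ n), |Q y 2 - B n * y 2| ≤ B n * (8 * Λ ^ 2 * (m * h * b)) * ρ n
  cc : ∀ n, N < n → ∀ y ∈ Bp (ρ n), ‖Q y‖ ≤ A N * (3 * ρ (N + 1) + m * h * b * ρ N)

section
variable {N K m : ℕ} {Λ h b Sb Ib : ℝ} {c ρ A B : ℕ → ℝ} {f0 : E3 → ℝ} {P : ℕ → E3 → E3}

lemma PD.sm (p : PD N K Λ h b Sb ρ f0 P) (hm : m ≤ K) : 32 * Λ ^ 2 * (m * h * b) ≤ 1 := by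
  have : (m : ℝ) * h * b ≤ K * h * b := by
    have := p.h0; have := p.b0; gcongr
  have := mll this (by positivity : 0 ≤ 32 * Λ ^ 2)
  linarith [p.small]

lemma PD.sm' (p : PD N K Λ h b Sb ρ f0 P) (hm : m ≤ K) : (m * h * b) ≤ 1 / 512 := by
  have h1 := p.sm hm
  have h0 : 0 ≤ (m * h * b) := by have := p.h0; have := p.b0; positivity
  have : (4:ℝ) ^ 2 ≤ Λ ^ 2 := by gcongr; exact p.L4
  have := mlr this h0
  linarith

lemma DInv.AB (i : DInv N Λ h b Sb ρ A B (P m) m) (p : PD N K Λ h b Sb ρ f0 P) (hm : m ≤ K)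
    {n : ℕ} (hn : n ≤ N) : 1 / 2 ≤ B n * A n ^ 2 := by
  have h1 := i.b3 n hn
  have : (m : ℝ) * h ^ 2 * Sb ^ 2 ≤ K * h ^ 2 * Sb ^ 2 := by gcongr
  linarith [p.hS2]

lemma DInv.B1 (i : DInv N Λ h b Sb ρ A B (P m) m) {n : ℕ} (hn : n ≤ N) : B n ≤ 1 := by
  have h1 := i.b2 n hn
  have h2 : B n * 1 ^ 2 ≤ B n * A n ^ 2 := by
    have := i.b1 n hn; have := i.a1 n hn; gcongr
  linarith

lemma DInv.pos (i : DInv N Λ h b Sb ρ A B (P m) m) (p : PD N K Λ h b Sb ρ f0 P) (D : Dat c ρ Ib f0)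
    (hm : m ≤ K) (hA : A N ≤ 2 * Λ) {n : ℕ} (hn : n ≤ N) {y : E3} (hy : y ∈ Bp (ρ n)) :
    (A n * ρ n / 2 ≤ rc (P m y) ∧ rc (P m y) ≤ 3 * A n * ρ n) ∧
    (B n * ρ n / 2 ≤ -P m y 2 ∧ -P m y 2 ≤ 3 * B n * ρ n) ∧ ‖P m y‖ ≤ 10 * Λ * ρ n := by
  have hρ := D.ρ0 n
  have hA1 := i.a1 n hn
  have hA2 := (i.a2 n hn).trans hA
  have hA0 : 0 < A n := by linarith
  have hB0 := i.b1 n hn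
  have hB1 := i.B1 hn
  obtain ⟨y1, y2, y3, y4⟩ := id hy; have g := geom1 hρ hA0 (a0 := y 0) (a1 := y 1)
    (by rw [← rc_sq]; gcongr) (by rw [← rc_sq]; gcongr; exact rc_nonneg _)
    ((p.sm' hm).trans (by norm_num)) (i.p0 n hn y hy) (i.p1 n hn y hy)
  rw [← rc_sq] at g; have r1 : A n * ρ n / 2 ≤ rc (P m y) := sq_abs_le (rc_nonneg _) g.1; have r2 : rc (P m y) ≤ 3 * A n * ρ n := sq_abs_le (by positivity) g.2
  have z := i.p2 n hn y hy
  have hBρ : 0 < B n * ρ n := by positivity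
  have z' : |P m y 2 - B n * y 2| ≤ B n * ρ n / 4 := by
    refine z.trans ?_
    have := mll (p.sm hm) hBρ.le
    linarith
  rw [abs_le] at z'; have y3' := mll y3 hB0.le; have y4' := mll y4 hB0.le; have r3 : B n * ρ n / 2 ≤ -P m y 2 := by linarith [z'.2]
  have r4 : -P m y 2 ≤ 3 * B n * ρ n := by linarith [z'.1]
  refine ⟨⟨r1, r2⟩, ⟨r3, r4⟩, ?_⟩
  have hL := p.L4
  have hLρ : 4 * ρ n ≤ Λ * ρ n := by gcongr
  apply norm_le_of_sq (by positivity)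
  rw [← rc_sq]; have s1 : rc (P m y) ≤ 6 * (Λ * ρ n) := by
    have := mlr hA2 hρ.le
    linarith
  have s2 : -P m y 2 ≤ Λ * ρ n := by
    have := mlr hB1 hρ.le
    linarith
  have s3 : rc (P m y) ^ 2 ≤ (6 * (Λ * ρ n)) ^ 2 := by gcongr; exact rc_nonneg _
  have s4 : (-P m y 2) ^ 2 ≤ (Λ * ρ n) ^ 2 := by
    gcongr; linarith
  have := sq_nonneg (Λ * ρ n)
  rw [neg_sq] at s4; linarith

lemma DInv.pos' (i : DInv N Λ h b Sb ρ A B (P m) m) (p : PD N K Λ h b Sb ρ f0 P) (D : Dat c ρ Ib f0)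
    (hm : m ≤ K) (hA : A N ≤ 2 * Λ) {n : ℕ} (hn : N < n) {y : E3} (hy : y ∈ Bp (ρ n)) :
    ‖P m y‖ ≤ ρ N := by
  refine (i.cc n hn y hy).trans ?_
  have h0 : 0 ≤ (m * h * b) := by have := p.h0; have := p.b0; positivity
  have hL := p.L4
  have hρ := D.ρ0 N
  have hρ' := D.ρ0 (N + 1)
  have h1 := p.sm hm
  have h2 := p.nxt
  have h4 : 32 * 4 * Λ * (m * h * b) ≤ 1 := by
    have : 32 * 4 * Λ * (m * h * b) ≤ 32 * Λ * Λ * (m * h * b) := by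
      have : 32 * 4 * Λ ≤ 32 * Λ * Λ := by nlinarith
      gcongr
    linarith
  calc _ ≤ 2 * Λ * (3 * ρ (N + 1) + m * h * b * ρ N) := by gcongr
    _ = (12 * Λ * ρ (N + 1)) / 2 + (32 * 4 * Λ * (m * h * b)) / 64 * ρ N := by ring
    _ ≤ ρ N / 2 + 1 / 64 * ρ N := by gcongr
    _ ≤ _ := by linarith

/-- integrability -/
lemma PD.int (p : PD N K Λ h b Sb ρ f0 P) (D : Dat c ρ Ib f0) (n : ℕ) :
    Integrable (fun y => f0 y * Gk (ρ n) (10 * Λ) (P m y)) := by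
  apply D.fi.mul_bdd (c := (ρ n ^ 2)⁻¹)
  · exact ((Gk_cont (D.ρ0 n)).comp (p.cont m)).aestronglyMeasurable
  · exact ae_of_all _ fun y => Gk_bd (D.ρ0 n) _

lemma DInv.gk (i : DInv N Λ h b Sb ρ A B (P m) m) (p : PD N K Λ h b Sb ρ f0 P) (D : Dat c ρ Ib f0)
    (hm : m ≤ K) (hA : A N ≤ 2 * Λ) {n : ℕ} (hn : n ≤ N) (y : E3) (hy : f0 y ≠ 0) :
    0 ≤ Gk (ρ n) (10 * Λ) (P m y) ∧ Gk (ρ n) (10 * Λ) (P m y) ≤ Gk (ρ N) (10 * Λ) (P m y) := by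
  obtain ⟨j, hj⟩ := D.fs y hy
  rcases le_or_gt j N with hjN | hjN
  · have h1 := i.pos p D hm hA hjN hj
    have h2 : P m y 2 ≤ 0 := by
      have := i.b1 j hjN; have := D.ρ0 j
      have : 0 < B j * ρ j := by positivity
      linarith [h1.2.1.1]
    exact ⟨Gk_nonneg h2, Gk_anti (D.ρ0 N) (D.anti hn) h2⟩
  · have h1 := i.pos' p D hm hA hjN hj
    rw [Gk_zero (D.ρ0 N) h1, Gk_zero (D.ρ0 n) (h1.trans (D.anti hn))]; exact ⟨le_rfl, le_rfl⟩

lemma DInv.S (i : DInv N Λ h b Sb ρ A B (P m) m) (p : PD N K Λ h b Sb ρ f0 P) (D : Dat c ρ Ib f0)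
    (hm : m ≤ K) (hA : A N ≤ 2 * Λ) {n : ℕ} (hn : n ≤ N) :
    0 ≤ Sd Λ ρ f0 (P m) n ∧ Sd Λ ρ f0 (P m) n ≤ Sd Λ ρ f0 (P m) N := by
  constructor
  · apply integral_nonneg; intro y
    by_cases hy : f0 y = 0
    · simp [hy]
    · exact mul_nonneg (D.f00 y) (i.gk p D hm hA hn y hy).1
  · apply integral_mono (p.int D n) (p.int D N); intro y
    by_cases hy : f0 y = 0
    · simp [hy]
    · exact mll (i.gk p D hm hA hn y hy).2 (D.f00 y)

lemma PD.SN (p : PD N K Λ h b Sb ρ f0 P) (D : Dat c ρ Ib f0) : Sd Λ ρ f0 (P m) N ≤ Sb := by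
  refine le_trans ?_ p.Sbd
  rw [← integral_const_mul]; apply integral_mono (p.int D N) (D.fi.const_mul _); intro y; have := (le_abs_self _).trans (Gk_bd (R := 10 * Λ) (D.ρ0 N) (P m y))
  have := mll this (D.f00 y)
  simp only; linarith

lemma DInv.lower (i : DInv N Λ h b Sb ρ A B (P m) m) (p : PD N K Λ h b Sb ρ f0 P) (D : Dat c ρ Ib f0)
    (hm : m ≤ K) (hA : A N ≤ 2 * Λ) :
    (∑ j ∈ Finset.range N, c j) * Ib / (16 * 10 ^ 6 * Λ ^ 5) ≤ Sd Λ ρ f0 (P m) N := by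
  have hL : 0 < Λ := by linarith [p.L4]
  have hint := p.int (m := m) D N
  have hU : ∫ y in ⋃ j ∈ Finset.range N, Bp (ρ j), f0 y * Gk (ρ N) (10 * Λ) (P m y)
      ≤ Sd Λ ρ f0 (P m) N := by
    apply setIntegral_le_integral hint; refine ae_of_all _ fun y => ?_
    by_cases hy : f0 y = 0
    · simp [hy]
    · exact mul_nonneg (D.f00 y) (i.gk p D hm hA le_rfl y hy).1
  refine le_trans ?_ hU
  rw [integral_biUnion_finset _ (fun j _ => Bp_meas _) (fun i _ j _ hij => D.disj hij)
    (fun j _ => hint.integrableOn), Finset.sum_mul, Finset.sum_div]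
  apply Finset.sum_le_sum; intro j hj; have hjN : j < N := Finset.mem_range.1 hj; have hρ := D.ρ0 j
  have key : ∫ y in Bp (ρ j), f0 y * (16 * 10 ^ 6 * Λ ^ 5 * ρ j ^ 2)⁻¹ ≤
      ∫ y in Bp (ρ j), f0 y * Gk (ρ N) (10 * Λ) (P m y) := by
    apply setIntegral_mono_on (D.fi.mul_const _).integrableOn hint.integrableOn (Bp_meas _); intro y hy; apply mll _ (D.f00 y)
    have h1 := i.pos p D hm hA hjN.le hy
    have hA1 := i.a1 j hjN.le
    apply Gk_lower (D.ρ0 N) (by positivity) hρ hA1 (i.b1 j hjN.le) hL (i.AB p hm hjN.le)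
      h1.1.1 h1.2.1.1 h1.2.2
    · have := D.lt4 hjN
      have := mlr hA1 hρ.le
      linarith [h1.1.1, rc_le (P m y)]
    · refine h1.2.2.trans ?_
      have : ρ j ≤ 1 := (D.anti (Nat.zero_le j)).trans D.ρ1
      have := mll this hL.le
      linarith
  refine le_trans ?_ key
  rw [integral_mul_const]; have := mlr (D.mass j) (by positivity : 0 ≤ (16 * 10 ^ 6 * Λ ^ 5 * ρ j ^ 2)⁻¹)
  refine le_trans (le_of_eq ?_) this
  field_simp
end

lemma Jm_err {P P' : E3} {x e : ℝ} (h : ‖P' - P - x • Jm P‖ ≤ e) :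
    |P' 0 - (1 + x) * P 0| ≤ e ∧ |P' 1 - (1 + x) * P 1| ≤ e ∧ |P' 2 - (1 - 2 * x) * P 2| ≤ e := by
  have h0 := (coord_le _ 0).trans h
  have h1 := (coord_le _ 1).trans h
  have h2 := (coord_le _ 2).trans h
  simp only [PiLp.sub_apply, PiLp.smul_apply, Jm, mk3_0, mk3_1, mk3_2, smul_eq_mul] at h0 h1 h2; refine ⟨?_, ?_, ?_⟩
  · rwa [show P' 0 - (1 + x) * P 0 = P' 0 - P 0 - x * P 0 by ring]
  · rwa [show P' 1 - (1 + x) * P 1 = P' 1 - P 1 - x * P 1 by ring]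
  · rwa [show P' 2 - (1 - 2 * x) * P 2 = P' 2 - P 2 - x * (-2 * P 2) by ring]

lemma err_step {p p' A y k E e : ℝ} (hk : 0 ≤ k) (h : |p - A * y| ≤ E) (h' : |p' - k * p| ≤ e) :
    |p' - A * k * y| ≤ k * E + e := by
  have : p' - A * k * y = (p' - k * p) + k * (p - A * y) := by ring
  rw [this]; refine (abs_add_le _ _).trans ?_; rw [abs_mul, abs_of_nonneg hk]; have := mll h hk; linarith

lemma Jm_norm {P : E3} {x : ℝ} (h0 : 0 ≤ x) (h1 : x ≤ 1 / 4) : ‖P + x • Jm P‖ ≤ (1 + x) * ‖P‖ := by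
  apply norm_le_of_sq (by positivity)
  have e := nsq P
  rw [mul_pow, e]; simp only [PiLp.add_apply, PiLp.smul_apply, Jm, mk3_0, mk3_1, mk3_2, smul_eq_mul]
  have : (1 - 2 * x) ^ 2 ≤ (1 + x) ^ 2 := by gcongr <;> linarith
  have := mlr this (sq_nonneg (P 2))
  linarith

lemma BA_step {a x s : ℝ} (ha : 0 ≤ a) (ha1 : a ≤ 1) (h0 : 0 ≤ x) (h1 : x ≤ 1 / 4) (hs : x ≤ s) :
    a * ((1 - 2 * x) * (1 + x) ^ 2) ≤ 1 ∧ a - 5 * s ^ 2 ≤ a * ((1 - 2 * x) * (1 + x) ^ 2) := by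
  have e : (1 - 2 * x) * (1 + x) ^ 2 = 1 - (3 * x ^ 2 + 2 * x ^ 3) := by ring
  have h3 : 3 * x ^ 2 + 2 * x ^ 3 ≤ 5 * x ^ 2 := by
    have : x ^ 2 * x ≤ x ^ 2 * (1 / 4) := by gcongr
    have := sq_nonneg x
    linarith
  have h4 : x ^ 2 ≤ s ^ 2 := by gcongr
  have h5 : 0 ≤ 3 * x ^ 2 + 2 * x ^ 3 := by positivity
  have h6 := mul_nonneg ha h5
  have h7 := mlr ha1 h5
  rw [e]
  constructor <;> linarith

section
variable {N K m : ℕ} {Λ h b Sb Ib : ℝ} {c ρ A B : ℕ → ℝ} {f0 : E3 → ℝ} {P : ℕ → E3 → E3}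

lemma DInv.step (i : DInv N Λ h b Sb ρ A B (P m) m) (p : PD N K Λ h b Sb ρ f0 P)
    (D : Dat c ρ Ib f0) (hm : m < K) (hA : A N < Λ) :
    DInv N Λ h b Sb ρ (fun n => A n * (1 + h * Sd Λ ρ f0 (P m) n))
      (fun n => B n * (1 - 2 * (h * Sd Λ ρ f0 (P m) n))) (P (m + 1)) (m + 1) ∧
    A N * (1 + h * Sd Λ ρ f0 (P m) N) ≤ 2 * Λ := by
  have hL := p.L4
  have hA2 : A N ≤ 2 * Λ := by linarith
  have hh := p.h0
  have hb := p.b0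
  have hS : ∀ n ≤ N, 0 ≤ h * Sd Λ ρ f0 (P m) n ∧ h * Sd Λ ρ f0 (P m) n ≤ h * Sd Λ ρ f0 (P m) N ∧
      h * Sd Λ ρ f0 (P m) n ≤ h * Sb ∧ h * Sd Λ ρ f0 (P m) n ≤ 1 / 4 := by
    intro n hn; have h1 := i.S p D hm.le hA2 hn; have h2 := p.SN (m := m) D; have h3 : h * Sd Λ ρ f0 (P m) n ≤ h * Sb := mll (h1.2.trans h2) hh.le
    exact ⟨mul_nonneg hh.le h1.1, mll h1.2 hh.le, h3, h3.trans p.hS⟩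
  have hstep : ∀ n ≤ N, ∀ y, ‖P m y‖ ≤ 10 * Λ * ρ n →
    ‖P (m + 1) y - P m y - (h * Sd Λ ρ f0 (P m) n) • Jm (P m y)‖ ≤ h * b * ρ n :=
    fun n hn y hy => p.step n hn m hm y hy
  generalize Sd Λ ρ f0 (P m) = S at hS hstep ⊢
  have hcast : ((m + 1 : ℕ) : ℝ) = m + 1 := by push_cast; ring
  have hmb : 0 ≤ (m : ℝ) * h * b := by positivity
  have hAN : A N * (1 + h * S N) ≤ 2 * Λ := by
    have h1 := hS N le_rfl
    have : A N * (1 + h * S N) ≤ Λ * (1 + 1 / 4) := by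
      have := i.a1 N le_rfl
      exact mul_le_mul hA.le (by linarith) (by linarith) (by linarith)
    linarith
  have ha1 : ∀ n ≤ N, 1 ≤ A n * (1 + h * S n) := fun n hn => by
    have h1 := i.a1 n hn
    have h2 := (hS n hn).1
    have := mul_nonneg (by linarith : 0 ≤ A n) h2
    linarith
  have ha2 : ∀ n ≤ N, A n * (1 + h * S n) ≤ A N * (1 + h * S N) := fun n hn => by
    have h1 := i.a1 n hn
    have h2 := hS n hn
    have := i.a2 n hn
    exact mul_le_mul this (by linarith) (by linarith) (by linarith)
  have hbb : ∀ n ≤ N, 0 < B n * (1 - 2 * (h * S n)) := fun n hn => by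
    have h1 := i.b1 n hn
    have h2 := hS n hn
    exact mul_pos h1 (by linarith)
  have hBA : ∀ n ≤ N, (B n * (1 - 2 * (h * S n))) * (A n * (1 + h * S n)) ^ 2 ≤ 1 ∧
      1 - 5 * ((m + 1 : ℕ) : ℝ) * h ^ 2 * Sb ^ 2 ≤ (B n * (1 - 2 * (h * S n))) * (A n * (1 + h * S n)) ^ 2 := by
    intro n hn; have h2 := hS n hn; have h3 := i.b1 n hn; have := BA_step (a := B n * A n ^ 2) (by positivity) (i.b2 n hn) h2.1 h2.2.2.2 h2.2.2.1
    have e : (B n * (1 - 2 * (h * S n))) * (A n * (1 + h * S n)) ^ 2 =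
      (B n * A n ^ 2) * ((1 - 2 * (h * S n)) * (1 + h * S n) ^ 2) := by ring
    rw [e]; refine ⟨this.1, le_trans ?_ this.2⟩; have := i.b3 n hn; rw [hcast, mul_pow]; linarith
  have hBl : ∀ n ≤ N, 1 ≤ (B n * (1 - 2 * (h * S n))) * (8 * Λ ^ 2) := by
    intro n hn; have h1 := (hBA n hn).2; have h2 : ((m + 1 : ℕ) : ℝ) * h ^ 2 * Sb ^ 2 ≤ K * h ^ 2 * Sb ^ 2 := by
      gcongr; exact_mod_cast hm
    have h3 := p.hS2
    have h4 : (A n * (1 + h * S n)) ^ 2 ≤ (2 * Λ) ^ 2 := by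
      have := ha1 n hn
      have := (ha2 n hn).trans hAN
      gcongr
    have h5 := mll h4 (hbb n hn).le
    linarith
  have herr : ∀ n ≤ N, ∀ y ∈ Bp (ρ n), _ := fun n hn y hy =>
    Jm_err (hstep n hn y (i.pos p D hm.le hA2 hn hy).2.2)
  have hor : ∀ n ≤ N, ∀ q q' a : ℝ, |q - A n * a| ≤ A n * (m * h * b) * ρ n →
      |q' - (1 + h * S n) * q| ≤ h * b * ρ n →
      |q' - A n * (1 + h * S n) * a| ≤ A n * (1 + h * S n) * (((m + 1 : ℕ) : ℝ) * h * b) * ρ n := by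
    intro n hn q q' a h1 h2; have h3 := hS n hn; refine (err_step (by linarith) h1 h2).trans ?_
    have : 0 ≤ h * b * ρ n := mul_nonneg (by positivity) (D.ρ0 n).le
    have := mlr (ha1 n hn) this
    rw [hcast]; linarith
  refine ⟨⟨ha1, ha2, hbb, fun n hn => (hBA n hn).1, fun n hn => (hBA n hn).2, ?_, ?_, ?_, ?_⟩, hAN⟩
  · intro n hn y hy; exact hor n hn _ _ _ (i.p0 n hn y hy) (herr n hn y hy).1
  · intro n hn y hy; exact hor n hn _ _ _ (i.p1 n hn y hy) (herr n hn y hy).2.1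
  · intro n hn y hy; have h3 := hS n hn; refine (err_step (by linarith) (i.p2 n hn y hy) (herr n hn y hy).2.2).trans ?_
    have : 0 ≤ h * b * ρ n := mul_nonneg (by positivity) (D.ρ0 n).le
    have := mlr (hBl n hn) this
    rw [hcast]; linarith
  · intro n hn y hy; have h1 := i.pos' p D hm.le hA2 hn hy; have hρ := D.ρ0 N; have h2 := hstep N le_rfl y (h1.trans (by nlinarith))
    have h3 := hS N le_rfl
    have h4 := Jm_norm (P := P m y) h3.1 h3.2.2.2
    have h5 : ‖P (m + 1) y‖ ≤ ‖P (m + 1) y - P m y - (h * S N) • Jm (P m y)‖ +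
        ‖P m y + (h * S N) • Jm (P m y)‖ := by
      refine le_trans (le_of_eq ?_) (norm_add_le _ _)
      congr 1; abel
    have h6 := mll (i.cc n hn y hy) (by linarith : 0 ≤ 1 + h * S N)
    have : 0 ≤ h * b * ρ N := by positivity
    have := mlr (ha1 N le_rfl) this
    rw [hcast]; linarith

lemma PD.inv0 (p : PD N K Λ h b Sb ρ f0 P) (D : Dat c ρ Ib f0) :
    DInv N Λ h b Sb ρ (fun _ => 1) (fun _ => 1) (P 0) 0 := by
  refine ⟨?_, ?_, ?_, ?_, ?_, ?_, ?_, ?_, ?_⟩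
  any_goals simp [p.P0]
  intro n hn y hy; refine (Bp_norm (D.ρ0 n) hy).trans ?_; have := D.anti (Nat.succ_le_of_lt hn); simp only [Nat.succ_eq_add_one] at this; linarith

lemma DInv.good (i : DInv N Λ h b Sb ρ A B (P m) m) (p : PD N K Λ h b Sb ρ f0 P)
    (D : Dat c ρ Ib f0) (hm : m ≤ K) (hA : Λ ≤ A N) (hA2 : A N ≤ 2 * Λ) :
    ∀ y ∈ Bp (ρ N), Λ * ρ N / 2 ≤ rc (P m y) ∧ rc (P m y) ≤ 6 * Λ * ρ N ∧
      |P m y 2| ≤ 3 * ρ N / Λ ^ 2 := by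
  intro y hy; have h1 := i.pos p D hm hA2 le_rfl hy; have hρ := D.ρ0 N; have hL := p.L4; have hB := i.b1 N le_rfl; have hB2 : B N ≤ 1 / Λ ^ 2 := by
    rw [le_div_iff₀ (by positivity)]
    refine le_trans ?_ (i.b2 N le_rfl)
    gcongr
  refine ⟨?_, ?_, ?_⟩
  · refine le_trans ?_ h1.1.1
    gcongr
  · refine h1.1.2.trans ?_
    have := mlr hA2 hρ.le
    linarith
  · have h2 : 0 < B N * ρ N := by positivity
    rw [abs_of_nonpos (by linarith [h1.2.1.1])]
    refine h1.2.1.2.trans ?_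
    have := mlr hB2 hρ.le
    calc _ = 3 * (B N * ρ N) := by ring
      _ ≤ 3 * (1 / Λ ^ 2 * ρ N) := by linarith
      _ = _ := by ring

lemma PD.dyn (p : PD N K Λ h b Sb ρ f0 P) (D : Dat c ρ Ib f0)
    (hσ : Λ ≤ K * h * ((∑ j ∈ Finset.range N, c j) * Ib / (16 * 10 ^ 6 * Λ ^ 5))) :
    ∃ m ≤ K, ∀ y ∈ Bp (ρ N), Λ * ρ N / 2 ≤ rc (P m y) ∧ rc (P m y) ≤ 6 * Λ * ρ N ∧
      |P m y 2| ≤ 3 * ρ N / Λ ^ 2 := by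
  by_contra hcon
  push Not at hcon; set σ := (∑ j ∈ Finset.range N, c j) * Ib / (16 * 10 ^ 6 * Λ ^ 5) with hσd
  have main : ∀ m ≤ K, ∃ A B, DInv N Λ h b Sb ρ A B (P m) m ∧ A N < Λ ∧ 1 + m * h * σ ≤ A N := by
    intro m
    induction m with
    | zero =>
      intro _; exact ⟨_, _, p.inv0 D, by linarith [p.L4], by simp⟩
    | succ m ih =>
      intro hm; obtain ⟨A, B, i, hA, hlow⟩ := ih (by omega)
      obtain ⟨i', hA'⟩ := i.step p D (by omega) hA
      refine ⟨_, _, i', ?_, ?_⟩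
      · by_contra hge
        push Not at hge; obtain ⟨y, hy, hy2⟩ := hcon (m + 1) hm; have := i'.good p D hm hge hA' y hy
        exact absurd this.2.2 (not_le.2 (hy2 this.1 this.2.1))
      · have h1 := i.lower p D (by omega) (by linarith [p.L4])
        have h2 := i.S p D (by omega) (by linarith [p.L4]) (le_refl N)
        have h3 := i.a1 N le_rfl
        rw [← hσd] at h1; have h4 := mll h1 p.h0.le; have h5 := mlr h3 (mul_nonneg p.h0.le h2.1)
        push_cast; linarith
  obtain ⟨A, B, _, h1, h2⟩ := main K le_rfl; linarith
end

lemma TC.mono {R R' l l' φ} (h : TC R l l φ) (hR : R ≤ R') (hl : l ≤ l') : TC R' l' l' φ :=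
  ⟨h.toTF.mono hR hl, fun x y => (h.l2 x y).trans (by gcongr)⟩

lemma shiftTC {R : ℝ} {φ : E3 → ℝ} (sm : CD φ) (sp : ∀ x, R < ‖x‖ → φ x = 0) :
    ∃ k : ℝ, 0 ≤ k ∧ ∀ (c : E3) (R' : ℝ), R + ‖c‖ ≤ R' → TC R' k k (fun x => φ (x - c)) := by
  obtain ⟨l, hl⟩ := TF.mk' sm sp; have hc : HasCompactSupport (fderiv ℝ φ) := hl.cs.fderiv ℝ
  obtain ⟨C, hC⟩ := ContDiff.lipschitzWith_of_hasCompactSupport (𝕂 := ℝ) hc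
    (sm.fderiv_right (m := 1) (by norm_cast)) one_ne_zero
  refine ⟨max l C, le_max_of_le_right C.2, fun c R' hR' => ?_⟩
  have hf : ∀ x, fderiv ℝ (fun x => φ (x - c)) x = fderiv ℝ φ (x - c) := fun x => by
    rw [fderiv_comp_sub]
  refine ⟨⟨sm.comp (contDiff_id.sub contDiff_const), fun x hx => sp _ ?_, fun x => ?_⟩, fun x y => ?_⟩
  · have := norm_sub_norm_le x c
    linarith
  · rw [hf]; exact (hl.l1 _).trans (le_max_left _ _)
  · rw [hf, hf]; have := hC.dist_le_mul (x - c) (y - c); rw [dist_eq_norm, dist_eq_norm, sub_sub_sub_cancel_right] at this; refine this.trans ?_; gcongr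
    exact le_max_right _ _

def box (a b : ℝ) : Set E3 := {x | |x 0| ≤ a ∧ |x 1| ≤ a ∧ |x 2| ≤ b}

lemma box_vol {a b : ℝ} (ha : 0 ≤ a) (hb : 0 ≤ b) : volume (box a b) = ENNReal.ofReal ((2 * a) ^ 2 * (2 * b)) := by
  have e : box a b = (MeasurableEquiv.toLp 2 (Fin 3 → ℝ)).symm ⁻¹' (Icc ![-a, -a, -b] ![a, a, b]) := by
    ext x; simp only [box, mem_ofPred_eq, mem_preimage, mem_Icc, Pi.le_def, Fin.forall_fin_succ, abs_le]; simp
    tauto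
  rw [e, (EuclideanSpace.volume_preserving_symm_measurableEquiv_toLp (Fin 3)).measure_preimage
    measurableSet_Icc.nullMeasurableSet, Real.volume_Icc_pi, Fin.prod_univ_three]
  simp; rw [← ENNReal.ofReal_mul (by linarith), ← ENNReal.ofReal_mul (by nlinarith)]
  congr 1; ring

lemma testφ {a b d : ℝ} (ha : 0 < a) (hb : 0 < b) (hd : 0 < d) :
    ∃ φ : E3 → ℝ, CD φ ∧ (∀ x, 0 ≤ φ x) ∧
      (∀ x, 2 * a ≤ rc x → rc x ≤ b → |x 2| ≤ d → φ x = 1) ∧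
      (∀ x, 2 * b + 2 * d < ‖x‖ → φ x = 0) ∧
      ∫ x, |φ x| * (rc x)⁻¹ ≤ a⁻¹ * ((4 * b) ^ 2 * (4 * d)) := by
  have hc (i : Fin 3) : CD (fun q : E3 => q i) := contDiff_euclidean.1 contDiff_id i
  have ht : CD Real.smoothTransition := Real.smoothTransition.contDiff
  have hr : CD (fun q : E3 => q 0 ^ 2 + q 1 ^ 2) := ((hc 0).pow 2).add ((hc 1).pow 2)
  set φ : E3 → ℝ := fun x => Real.smoothTransition (((x 0 ^ 2 + x 1 ^ 2) / a ^ 2 - 1) / 3) *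
    Real.smoothTransition (2 - (x 0 ^ 2 + x 1 ^ 2) / b ^ 2) *
    Real.smoothTransition (2 - (x 2) ^ 2 / d ^ 2) with hφ
  have h0 : ∀ x, 0 ≤ φ x := fun x => mul_nonneg (mul_nonneg (smoothTransition.nonneg _)
    (smoothTransition.nonneg _)) (smoothTransition.nonneg _)
  have h1 : ∀ x, φ x ≤ 1 := fun x => mul_le_one₀ (mul_le_one₀ (smoothTransition.le_one _)
    (smoothTransition.nonneg _) (smoothTransition.le_one _)) (smoothTransition.nonneg _) (smoothTransition.le_one _)
  have hne : ∀ x, φ x ≠ 0 → a ≤ rc x ∧ rc x ≤ 2 * b ∧ |x 2| ≤ 2 * d := by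
    intro x hx; have n1 : Real.smoothTransition (((x 0 ^ 2 + x 1 ^ 2) / a ^ 2 - 1) / 3) ≠ 0 := fun h => hx (by simp [hφ, h])
    have n2 : Real.smoothTransition (2 - (x 0 ^ 2 + x 1 ^ 2) / b ^ 2) ≠ 0 := fun h => hx (by simp [hφ, h])
    have n3 : Real.smoothTransition (2 - (x 2) ^ 2 / d ^ 2) ≠ 0 := fun h => hx (by simp [hφ, h])
    rw [← rc_sq] at n1 n2; refine ⟨?_, ?_, ?_⟩ <;> by_contra hlt <;> push Not at hlt
    · apply n1; apply smoothTransition.zero_of_nonpos; have : rc x ^ 2 / a ^ 2 ≤ 1 := by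
        rw [div_le_one (by positivity)]; gcongr; exact rc_nonneg x
      linarith
    · apply n2; apply smoothTransition.zero_of_nonpos; have : 4 ≤ rc x ^ 2 / b ^ 2 := by
        rw [le_div_iff₀ (by positivity)]; nlinarith
      linarith
    · apply n3; apply smoothTransition.zero_of_nonpos; have : 4 ≤ x 2 ^ 2 / d ^ 2 := by
        rw [le_div_iff₀ (by positivity), ← sq_abs (x 2)]; nlinarith
      linarith
  refine ⟨φ, ?_, h0, ?_, ?_, ?_⟩
  · exact ((ht.comp (((hr.div_const _).sub contDiff_const).div_const _)).mul
      (ht.comp (contDiff_const.sub (hr.div_const _)))).mul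
      (ht.comp (contDiff_const.sub (((hc 2).pow 2).div_const _)))
  · intro x x1 x2 x3; simp only [hφ]; rw [← rc_sq, smoothTransition.one_of_one_le, smoothTransition.one_of_one_le, smoothTransition.one_of_one_le]
    · norm_num
    · have : x 2 ^ 2 / d ^ 2 ≤ 1 := by
        rw [div_le_one (by positivity), ← sq_abs (x 2)]; gcongr
      linarith
    · have : rc x ^ 2 / b ^ 2 ≤ 1 := by
        rw [div_le_one (by positivity)]; gcongr; exact rc_nonneg x
      linarith
    · have : 4 ≤ rc x ^ 2 / a ^ 2 := by
        rw [le_div_iff₀ (by positivity)]; nlinarith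
      linarith
  · intro x hx
    by_contra hn
    obtain ⟨n1, n2, n3⟩ := hne x hn; have : ‖x‖ ≤ 2 * b + 2 * d := by
      apply norm_le_of_sq (by positivity)
      rw [← rc_sq, ← sq_abs (x 2)]; have := rc_nonneg x; have := abs_nonneg (x 2); have : rc x ^ 2 ≤ (2 * b) ^ 2 := by gcongr
      have : |x 2| ^ 2 ≤ (2 * d) ^ 2 := by gcongr
      nlinarith
    linarith
  · have hbm : MeasurableSet (box (2 * b) (2 * d)) := by
      have h0 : Continuous (fun x : E3 => |x 0|) := by fun_prop
      have h1 : Continuous (fun x : E3 => |x 1|) := by fun_prop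
      have h2 : Continuous (fun x : E3 => |x 2|) := by fun_prop
      exact ((isClosed_le h0 continuous_const).inter ((isClosed_le h1 continuous_const).inter
        (isClosed_le h2 continuous_const))).measurableSet
    have hv := box_vol (a := 2 * b) (b := 2 * d) (by positivity) (by positivity)
    have hle : ∫ x, |φ x| * (rc x)⁻¹ ≤ ∫ x, indicator (box (2 * b) (2 * d)) (fun _ => a⁻¹) x := by
      apply integral_mono_of_nonneg
      · exact ae_of_all _ fun x => mul_nonneg (abs_nonneg _) (inv_nonneg.2 (rc_nonneg x))
      · rw [integrable_indicator_iff hbm]; exact integrableOn_const (by rw [hv]; exact ENNReal.ofReal_ne_top) (by simp)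
      · refine ae_of_all _ fun x => ?_
        simp only
        by_cases hx : φ x = 0
        · rw [hx, abs_zero, zero_mul]; exact indicator_nonneg (fun _ _ => by positivity) x
        · obtain ⟨n1, n2, n3⟩ := hne x hx; have hr2 : rc x ^ 2 = x 0 ^ 2 + x 1 ^ 2 := rc_sq x
          have m0 : |x 0| ≤ 2 * b := (abs_le_of_sq_le_sq (by nlinarith [sq_nonneg (x 1)]) (rc_nonneg x)).trans n2
          have m1 : |x 1| ≤ 2 * b := (abs_le_of_sq_le_sq (by nlinarith [sq_nonneg (x 0)]) (rc_nonneg x)).trans n2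
          rw [indicator_of_mem (show x ∈ box (2 * b) (2 * d) from ⟨m0, m1, n3⟩), abs_of_nonneg (h0 x)]
          calc φ x * (rc x)⁻¹ ≤ 1 * a⁻¹ := by
                gcongr
                · exact inv_nonneg.2 (rc_nonneg x)
                · exact h1 x
            _ = a⁻¹ := one_mul _
    refine hle.trans (le_of_eq ?_)
    rw [integral_indicator hbm, setIntegral_const, Measure.real, hv, ENNReal.toReal_ofReal (by positivity), smul_eq_mul]
    ring

lemma Jm_two (p : E3) : ‖Jm p‖ ≤ 2 * ‖p‖ := by
  apply norm_le_of_sq (by positivity)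
  rw [mul_pow, nsq]; simp only [Jm, mk3_0, mk3_1, mk3_2]; linarith [sq_nonneg (p 0), sq_nonneg (p 1)]

lemma mk00 (c : ℝ) : ‖mk3 0 0 c‖ = |c| := by
  have := mk3_norm_sq 0 0 c
  rw [← abs_of_nonneg (norm_nonneg (mk3 0 0 c))]; exact (sq_eq_sq_iff_abs_eq_abs _ _).1 (by rw [this]; ring)

lemma rc_sub00 (x : E3) (c : ℝ) : rc (x - mk3 0 0 c) = rc x := by
  simp [rc]

/-- one-step error -/
lemma step_err {X X' ζ ζ' v w : E3} {h F S δ e1 e2 : ℝ} (hh : 0 ≤ h)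
    (h1 : ‖X' - X - h • v‖ ≤ h * δ) (h2 : ‖ζ' - ζ - h • w‖ ≤ h * δ)
    (h3 : ‖v - w - F • Jm (X - ζ)‖ ≤ e1) (h4 : |F - S| ≤ e2) :
    ‖(X' - ζ') - (X - ζ) - (h * S) • Jm (X - ζ)‖ ≤ h * (2 * δ + e1 + e2 * (2 * ‖X - ζ‖)) := by
  have e : (X' - ζ') - (X - ζ) - (h * S) • Jm (X - ζ) =
    ((X' - X - h • v) - (ζ' - ζ - h • w)) + (h • (v - w - F • Jm (X - ζ)) + (h * (F - S)) • Jm (X - ζ)) := by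
    module
  have a1 : ‖h • (v - w - F • Jm (X - ζ))‖ ≤ h * e1 := by
    rw [norm_smul, Real.norm_of_nonneg hh]; gcongr
  have a2 : ‖(h * (F - S)) • Jm (X - ζ)‖ ≤ h * (e2 * (2 * ‖X - ζ‖)) := by
    rw [norm_smul, norm_eq_abs, abs_mul, abs_of_nonneg hh, mul_assoc]; have := Jm_two (X - ζ); have := (abs_nonneg _).trans h4; gcongr
  rw [e]; have b1 := norm_add_le ((X' - X - h • v) - (ζ' - ζ - h • w)) (h • (v - w - F • Jm (X - ζ)) + (h * (F - S)) • Jm (X - ζ))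
  have b2 := norm_sub_le (X' - X - h • v) (ζ' - ζ - h • w)
  have b3 := norm_add_le (h • (v - w - F • Jm (X - ζ))) ((h * (F - S)) • Jm (X - ζ))
  linarith

def FlowAt (f0 : E3 → ℝ) (f : E3 → ℝ → ℝ) (u : E3 → ℝ → E3) (τ : ℝ) : Prop :=
  ∀ (R δ : ℝ), 0 < δ → ∀ (K0 : ℕ) (N : Set ℝ),
    volume N = 0 → ∃ (K : ℕ) (s : ℕ → ℝ) (X : ℕ → E3 → E3), K0 ≤ K ∧ 0 < K ∧
      (∀ m < K, s m ∈ Ioo (m * (τ / K)) ((m + 1) * (τ / K)) ∧ s m ∉ N) ∧ (∀ m, Continuous (X m)) ∧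
      (∀ y, X 0 y = y) ∧
      (∀ m < K, ∀ y, ‖X (m + 1) y - X m y - (τ / K) • u (X m y) (s m)‖ ≤ (τ / K) * δ) ∧
      ∀ ψ, TC R δ⁻¹ δ⁻¹ ψ → ∀ m ≤ K, |Ee f0 f u ψ (m * (τ / K)) - ∫ y, f0 y * ψ (X m y)| ≤ δ

lemma zeta_ex (v : ℝ → ℕ → ℝ) {e : ℝ} (he : 0 < e) (h : ℝ) :
    ∃ z : ℕ → ℚ, z 0 = 0 ∧ ∀ m, |(z (m + 1) : ℝ) - z m - h * v (z m) m| ≤ e := by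
  have : ∀ x : ℝ, ∃ q : ℚ, |(q : ℝ) - x| ≤ e := fun x => by
    obtain ⟨q, h1, h2⟩ := exists_rat_btwn (show x < x + e by linarith)
    exact ⟨q, abs_le.2 ⟨by linarith, by linarith⟩⟩
  choose r hr using this
  refine ⟨fun m => Nat.rec 0 (fun m z => r ((z : ℝ) + h * v (z : ℝ) m)) m, rfl, fun m => ?_⟩
  have := hr (((Nat.rec 0 (fun m z => r ((z : ℝ) + h * v (z : ℝ) m)) m : ℚ) : ℝ) +
    h * v ((Nat.rec 0 (fun m z => r ((z : ℝ) + h * v (z : ℝ) m)) m : ℚ) : ℝ) m)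
  rw [← sub_sub] at this; exact this

set_option maxHeartbeats 1000000 in
lemma core {c ρ : ℕ → ℝ} {Ib : ℝ} {f0 : E3 → ℝ} (D : Dat c ρ Ib f0) {T M : ℝ} {f : E3 → ℝ → ℝ}
    {u : E3 → ℝ → E3} (H : FL T M f0 f u) {τ : ℝ} (τ0 : 0 < τ) (τT : τ < T) (hfl : FlowAt f0 f u τ)
    {N : ℕ} {Λ : ℝ} (hL : 4 ≤ Λ) (small : 32 * Λ ^ 2 * (τ * (Cv * M * (10 * Λ) ^ 4 + 1)) ≤ 1)
    (nxt : 12 * Λ * ρ (N + 1) ≤ ρ N) (hz : τ * (Cv * M + 1) ≤ 2)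
    (hσ : Λ ≤ τ * ((∑ j ∈ Finset.range N, c j) * Ib / (16 * 10 ^ 6 * Λ ^ 5))) :
    c N * ρ N ^ 2 * Ib / 2 ≤ 27648 * M * ρ N ^ 2 / Λ := by
  have hΛ : 0 < Λ := by linarith
  have hρ := D.ρ0 N
  have hρ1 : ρ N ≤ 1 := (D.anti (Nat.zero_le N)).trans D.ρ1
  have hM1 := H.M1
  have hU : 0 ≤ Cv * M := mul_nonneg Cv_pos.le (by linarith)
  obtain ⟨φ, φs, φ0, φ1, φz, φI⟩ := testφ (a := Λ * ρ N / 4) (b := 6 * Λ * ρ N) (d := 3 * ρ N / Λ ^ 2)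
    (by positivity) (by positivity) (by positivity)
  have φz' : ∀ x, 20 * Λ < ‖x‖ → φ x = 0 := fun x hx => φz x (lt_of_le_of_lt (by
    have h1 : 3 * ρ N / Λ ^ 2 ≤ 3 * 1 / 1 ^ 2 := by gcongr; linarith
    have h2 : Λ * ρ N ≤ Λ * 1 := by gcongr
    linarith) hx)
  obtain ⟨k0, hk0, hk0'⟩ := shiftTC φs φz'; have hG : ∀ n, ∃ k : ℝ, 0 ≤ k ∧ ∀ (c : E3) (R' : ℝ), 20 * Λ + ‖c‖ ≤ R' →
      TC R' k k (fun x => Gk (ρ n) (10 * Λ) (x - c)) := fun n =>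
    shiftTC (Gk_smooth (D.ρ0 n)) fun x hx => Gk_zero' (by positivity) (by linarith)
  choose k hk hk' using hG
  set R := 20 * Λ + 2 with hR; set l := (∑ n ∈ Finset.range (N + 1), k n) + k0 with hl; have hl0 : 0 ≤ l := add_nonneg (Finset.sum_nonneg fun n _ => hk n) hk0
  have hkl : ∀ n ≤ N, k n ≤ l := fun n hn => by
    have := Finset.single_le_sum (f := k) (fun n _ => hk n) (Finset.mem_range.2 (Nat.lt_succ_of_le hn))
    simp only [Nat.succ_eq_add_one] at this; linarith
  have hk0l : k0 ≤ l := by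
    have : 0 ≤ ∑ n ∈ Finset.range (N + 1), k n := Finset.sum_nonneg fun n _ => hk n
    linarith
  have TCG : ∀ n ≤ N, ∀ c : ℝ, |c| ≤ 2 → TC R l l (fun x => Gk (ρ n) (10 * Λ) (x - mk3 0 0 c)) :=
    fun n hn c hc => (hk' n (mk3 0 0 c) R (by rw [mk00]; linarith)).mono le_rfl (hkl n hn)
  have TCφ : ∀ c : ℝ, |c| ≤ 2 → TC R l l (fun x => φ (x - mk3 0 0 c)) :=
    fun c hc => (hk0' (mk3 0 0 c) R (by rw [mk00]; linarith)).mono le_rfl hk0l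
  obtain ⟨δ, hδ, d1, d2, d3, d4, d5⟩ : ∃ δ > 0, δ ≤ 1 ∧ δ ≤ ρ N / 4 ∧ δ ≤ (80 * Λ)⁻¹ ∧
      δ ≤ c N * ρ N ^ 2 * Ib / 2 ∧ l ≤ δ⁻¹ := by
    have := D.c0 N
    have := D.I0
    refine ⟨min 1 (min (ρ N / 4) (min (80 * Λ)⁻¹ (min (c N * ρ N ^ 2 * Ib / 2) (l + 1)⁻¹))), ?_, ?_, ?_, ?_, ?_, ?_⟩
    · have : 0 < (l + 1)⁻¹ := by positivity
      simp only [lt_min_iff, gt_iff_lt]; refine ⟨one_pos, by positivity, by positivity, by positivity, this⟩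
    · exact min_le_left _ _
    · exact (min_le_right _ _).trans (min_le_left _ _)
    · exact (min_le_right _ _).trans ((min_le_right _ _).trans (min_le_left _ _))
    · exact (min_le_right _ _).trans ((min_le_right _ _).trans ((min_le_right _ _).trans (min_le_left _ _)))
    · refine le_trans (by linarith : l ≤ l + 1) ?_
      rw [le_inv_comm₀ (by positivity)]
      · exact (min_le_right _ _).trans ((min_le_right _ _).trans ((min_le_right _ _).trans (min_le_right _ _)))
      · have : 0 < (l + 1)⁻¹ := by positivity
        simp only [lt_min_iff]; refine ⟨one_pos, by positivity, by positivity, by positivity, this⟩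
  clear_value l; have hae : ∀ᵐ s : ℝ, ∀ n : ℕ, ∀ z : ℚ, s ∈ Ioo 0 T →
      Ff f (fun x => Gk (ρ n) (10 * Λ) (x - mk3 0 0 z)) s = Ee f0 f u (fun x => Gk (ρ n) (10 * Λ) (x - mk3 0 0 z)) s := by
    rw [ae_all_iff]; intro n; rw [ae_all_iff]; intro z; exact H.FE (hk' n (mk3 0 0 z) _ le_rfl).toTF
  set W := M * (l * (Cv * M)) * νI R with hW; have hW0 : 0 ≤ W := mul_nonneg (mul_nonneg (by linarith) (mul_nonneg hl0 hU)) (νI_nonneg R)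
  set Sb := (ρ N ^ 2)⁻¹ * ∫ y, f0 y with hSb; have hSb0 : 0 ≤ Sb := mul_nonneg (by positivity) (integral_nonneg D.f00)
  obtain ⟨K0, hK0⟩ := exists_nat_ge (τ * (80 * Λ * W + 4 * Sb + 10 * τ * Sb ^ 2))
  obtain ⟨K, s, X, hK, hKp, hs, Xc, X0, Xs, XE⟩ := hfl R δ hδ K0 _ (ae_iff.1 hae); have hKR : (0:ℝ) < K := by exact_mod_cast hKp
  set h := τ / K with hh; have h0 : 0 < h := by positivity
  have hKh : K * h = τ := by rw [hh]; field_simp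
  have hV : h * (80 * Λ * W + 4 * Sb + 10 * τ * Sb ^ 2) ≤ 1 := by
    rw [hh, div_mul_eq_mul_div, div_le_one hKR]; exact hK0.trans (by exact_mod_cast hK)
  have hV1 : h * W ≤ (80 * Λ)⁻¹ := by
    rw [← one_div, le_div_iff₀ (by positivity)]
    have : 0 ≤ h * Sb := by positivity
    have : 0 ≤ h * (τ * Sb ^ 2) := by positivity
    linarith
  have hV2 : h * Sb ≤ 1 / 4 := by
    have : 0 ≤ h * (Λ * W) := by positivity
    have : 0 ≤ h * (τ * Sb ^ 2) := by positivity
    linarith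
  have hV3 : 10 * K * h ^ 2 * Sb ^ 2 ≤ 1 := by
    have e : 10 * K * h ^ 2 * Sb ^ 2 = h * (10 * (K * h) * Sb ^ 2) := by ring
    rw [e, hKh]; have : 0 ≤ h * (Λ * W) := by positivity
    have : 0 ≤ h * Sb := by positivity
    linarith
  clear_value h; obtain ⟨z, z0, zs⟩ := zeta_ex (fun x m => u (mk3 0 0 x) (s m) 2) (mul_pos h0 hδ) h
  have hmh : ∀ m ≤ K, (m : ℝ) * h ≤ τ := fun m hm => by
    rw [← hKh]; gcongr
  have zb : ∀ m : ℕ, |(z m : ℝ)| ≤ m * h * (Cv * M + 1) := by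
    intro m
    induction m with
    | zero => simp [z0]
    | succ m ih =>
      have h1 := zs m
      have h2 := (coord_le (u (mk3 0 0 (z m)) (s m)) 2).trans (H.ub _ _)
      have h3 : |h * u (mk3 0 0 (z m)) (s m) 2| ≤ h * (Cv * M) := by
        rw [abs_mul, abs_of_pos h0]; gcongr
      have h4 : h * δ ≤ h * 1 := by gcongr
      rw [abs_le] at ih h1 h3 ⊢
      push_cast
      constructor <;> linarith [ih.1, ih.2, h1.1, h1.2, h3.1, h3.2]
  have zb2 : ∀ m ≤ K, |(z m : ℝ)| ≤ 2 := fun m hm => by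
    refine (zb m).trans (le_trans ?_ hz)
    have := hmh m hm
    gcongr
  have zsn : ∀ m, ‖mk3 0 0 (z (m + 1)) - mk3 0 0 (z m) - h • u (mk3 0 0 (z m)) (s m)‖ ≤ h * δ := by
    intro m; have hax := (H.gf (s m)).ax (z m); have e : mk3 0 0 (z (m + 1)) - mk3 0 0 (z m) - h • u (mk3 0 0 (z m)) (s m) =
        mk3 0 0 (z (m + 1) - z m - h * u (mk3 0 0 (z m)) (s m) 2) := by
      ext i
      fin_cases i
      · simpa using Or.inr hax.1
      · simpa using Or.inr hax.2
      · simp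
    rw [e, mk00]; exact zs m
  set P : ℕ → E3 → E3 := fun m y => X m y - mk3 0 0 (z m) with hP
  have p : PD N K Λ h (Cv * M * (10 * Λ) ^ 4 + 1) Sb ρ f0 P := by
    refine ⟨hL, h0, by positivity, by rw [hKh]; exact small, nxt, le_rfl, hV2, hV3, fun m => (Xc m).sub continuous_const, ?_, ?_⟩
    · intro y; simp only [hP, X0, z0]
      ext i; fin_cases i <;> simp
    · intro n hn m hm y hy; obtain ⟨sm, sN⟩ := hs m hm; have hρn := D.ρ0 n; have hρNn := D.anti hn; have sT : s m ∈ Ioo 0 T := by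
        refine ⟨lt_of_le_of_lt (by positivity) sm.1, sm.2.trans_le (le_trans ?_ τT.le)⟩
        have := hmh (m + 1) hm
        push_cast at this; exact this
      have mT' : (m : ℝ) * h ∈ Ico 0 T := ⟨by positivity, (hmh m hm.le).trans_lt τT⟩
      have tc := TCG n hn (z m) (zb2 m hm.le)
      simp only [mem_ofPred_eq, not_not] at sN; have f1 := sN n (z m) sT; have f2 := H.E_lip tc.toTF mT' ⟨sT.1.le, sT.2⟩
      have f3 := XE _ (tc.mono le_rfl d5) m hm.le
      have f4 := (H.gf (s m)).exp (ρ n) (10 * Λ * ρ n) (10 * Λ) (z m) (X m y) hρn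
        (by nlinarith) (by linarith) hy
      have f5 : |s m - m * h| ≤ h := by
        rw [abs_of_nonneg (by linarith [sm.1])]; linarith [sm.2]
      have f6 : |Ff f (fun x => Gk (ρ n) (10 * Λ) (x - mk3 0 0 (z m))) (s m) - Sd Λ ρ f0 (P m) n| ≤ (40 * Λ)⁻¹ := by
        rw [f1]; have g1 : W * |s m - m * h| ≤ W * h := by gcongr
        have g2 := (abs_sub_le _ _ _).trans (add_le_add f2 f3)
        refine g2.trans ?_
        have : (40 * Λ)⁻¹ = (80 * Λ)⁻¹ + (80 * Λ)⁻¹ := by field_simp; norm_num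
        rw [this]; linarith
      have f7 := step_err h0.le (Xs m hm y) (zsn m) f4 f6
      refine f7.trans ?_
      rw [mul_assoc h]; apply mll _ h0.le; have e1 : Cv * M * (10 * Λ * ρ n) * (10 * Λ * ρ n / ρ n) ^ 3 = Cv * M * (10 * Λ) ^ 4 * ρ n := by
        field_simp
      have e2 : (40 * Λ)⁻¹ * (2 * ‖X m y - mk3 0 0 (z m)‖) ≤ ρ n / 2 := by
        calc _ ≤ (40 * Λ)⁻¹ * (2 * (10 * Λ * ρ n)) := by gcongr
          _ = _ := by field_simp; norm_num
      rw [e1]; linarith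
  obtain ⟨m, hm, hgood⟩ := p.dyn D (by rw [hKh]; exact hσ)
  have tc := TCφ (z m) (zb2 m hm)
  have f3 := XE _ (tc.mono le_rfl d5) m hm
  have f4 := H.E_bd tc.toTF (t := m * h) ⟨by positivity, (hmh m hm).trans_lt τT⟩
  have f5 : ∫ x, |φ (x - mk3 0 0 (z m))| * (rc x)⁻¹ = ∫ x, |φ x| * (rc x)⁻¹ := by
    rw [← integral_sub_right_eq_self (fun x => |φ x| * (rc x)⁻¹) (mk3 0 0 (z m))]
    simp only [rc_sub00]
  have f6 : c N * ρ N ^ 2 * Ib ≤ ∫ y, f0 y * φ (X m y - mk3 0 0 (z m)) := by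
    refine (D.mass N).trans ?_
    obtain ⟨B, hB⟩ := tc.toTF.bd; have hi : Integrable (fun y => f0 y * φ (X m y - mk3 0 0 (z m))) := by
      apply D.fi.mul_bdd (c := B)
      · exact (tc.sm.continuous.comp (Xc m)).aestronglyMeasurable
      · exact ae_of_all _ fun y => hB (X m y)
    refine le_trans ?_ (setIntegral_le_integral (s := Bp (ρ N)) hi (ae_of_all _ fun y => mul_nonneg (D.f00 y) (φ0 _)))
    apply setIntegral_mono_on D.fi.integrableOn hi.integrableOn (Bp_meas _); intro y hy; have := hgood y hy
    rw [φ1 _ (by linarith [this.1]) this.2.1 this.2.2, mul_one]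
  have f7 : M * ∫ x, |φ x| * (rc x)⁻¹ ≤ 27648 * M * ρ N ^ 2 / Λ := by
    refine (mll φI (by linarith)).trans (le_of_eq ?_)
    clear * - hΛ hρ; field_simp; ring
  rw [f5] at f4; rw [abs_le] at f3 f4; linarith [f3.1, f4.2]

lemma core_num {C1 U T M Ib cN Λ Q2 τ S : ℝ} (hC : 1 ≤ C1) (hU : 1 ≤ U) (hT : 0 < T) (hM : 1 ≤ M)
    (I0 : 0 < Ib) (I1 : Ib ≤ 1) (c0 : 0 < cN) (c1 : cN ≤ 1) (hQ : Q2 = 10 ^ 6 * C1 * U + 2 / T)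
    (hΛ : Λ = 10 ^ 5 * M / (cN * Ib)) (hτ : τ = (Q2 * Λ ^ 6)⁻¹)
    (hS : 16 * 10 ^ 6 * Q2 * Λ ^ 12 / Ib ≤ S) :
    4 ≤ Λ ∧ 0 < τ ∧ τ < T ∧ C1 * U * τ ≤ 1 / 4 ∧ 32 * Λ ^ 2 * (τ * (U * (10 * Λ) ^ 4 + 1)) ≤ 1 ∧
    τ * (U + 1) ≤ 2 ∧ Λ ≤ τ * (S * Ib / (16 * 10 ^ 6 * Λ ^ 5)) ∧ 12 * Λ ≤ S := by
  have hΛ5 : 10 ^ 5 ≤ Λ := by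
    rw [hΛ, le_div_iff₀ (by positivity)]
    have : cN * Ib ≤ 1 * 1 := by gcongr
    linarith
  have hΛ0 : 0 < Λ := by linarith
  have hΛ1 : 1 ≤ Λ := by linarith
  have hCU : 1 ≤ C1 * U := by nlinarith
  have hCU' : U ≤ C1 * U := by nlinarith
  have h2T : 0 < 2 / T := by positivity
  have hQ0 : 10 ^ 6 * (C1 * U) ≤ Q2 := by rw [hQ]; linarith
  have hQ1 : 2 / T ≤ Q2 := by rw [hQ]; nlinarith
  have hQp : 0 < Q2 := by linarith
  have hτ0 : 0 < τ := by rw [hτ]; positivity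
  have hL6 : 1 ≤ Λ ^ 6 := one_le_pow₀ hΛ1
  have e1 : τ * Q2 * Λ ^ 6 = 1 := by rw [hτ]; field_simp
  have hτQ : τ * Q2 ≤ 1 := by
    have : τ * Q2 * 1 ≤ τ * Q2 * Λ ^ 6 := by gcongr
    linarith
  have hτC : τ * (10 ^ 6 * (C1 * U)) ≤ 1 := le_trans (by gcongr) hτQ
  have hτC' : τ * 1 ≤ τ * (C1 * U) := by gcongr
  have hτU : τ * U ≤ τ * (C1 * U) := by gcongr
  have hτ1 : C1 * U * τ ≤ 1 / 4 := by linarith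
  refine ⟨by linarith, hτ0, ?_, hτ1, ?_, by linarith, ?_, ?_⟩
  · have : τ * (2 / T) ≤ 1 := le_trans (by gcongr) hτQ
    rw [mul_div_assoc', div_le_one hT] at this; linarith
  · have a1 : U * (10 * Λ) ^ 4 + 1 ≤ 20000 * (U * Λ ^ 4) := by
      have : 1 ≤ U * Λ ^ 4 := one_le_mul_of_one_le_of_one_le hU (one_le_pow₀ hΛ1)
      nlinarith
    calc _ ≤ 32 * Λ ^ 2 * (τ * (20000 * (U * Λ ^ 4))) := by gcongr
      _ = (τ * (640000 * U)) * Λ ^ 6 := by ring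
      _ ≤ (τ * Q2) * Λ ^ 6 := by gcongr; linarith
      _ = 1 := e1
  · have : 16 * 10 ^ 6 * Q2 * Λ ^ 12 ≤ S * Ib := by rwa [div_le_iff₀ I0] at hS
    calc Λ = τ * Q2 * Λ ^ 6 * Λ := by rw [e1, one_mul]
      _ = τ * ((16 * 10 ^ 6 * Q2 * Λ ^ 12) / (16 * 10 ^ 6 * Λ ^ 5)) := by field_simp
      _ ≤ _ := by gcongr
  · refine le_trans ?_ hS
    rw [le_div_iff₀ I0]; have b1 : 12 * Λ * Ib ≤ 12 * Λ * 1 := by gcongr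
    have b2 : Λ * 1 ≤ Λ * Λ ^ 11 := by gcongr; exact one_le_pow₀ hΛ1
    have b3 : 1 ≤ Q2 := by linarith
    have b4 : 1 * Λ ^ 12 ≤ Q2 * Λ ^ 12 := by gcongr
    have b5 : 0 ≤ Q2 * Λ ^ 12 := by positivity
    have b6 : Λ * Λ ^ 11 = Λ ^ 12 := by ring
    linarith

theorem noFL {c ρ : ℕ → ℝ} {Ib : ℝ} {f0 : E3 → ℝ} (D : Dat c ρ Ib f0)
    (hdiv : ∀ Q : ℝ, ∃ N : ℕ, Q * ((c N) ^ 12)⁻¹ ≤ ∑ j ∈ Finset.range N, c j)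
    {T M : ℝ} {f : E3 → ℝ → ℝ} {u : E3 → ℝ → E3} (H : FL T M f0 f u) : False := by
  obtain ⟨C1, hC1, flow⟩ := flowD; have hM := H.M1; have hI := D.I0; have hCv : 1 ≤ Cv := by unfold Cv; linarith [κ3_nonneg]
  have hU : 1 ≤ Cv * M := one_le_mul_of_one_le_of_one_le hCv hM
  obtain ⟨N, hN⟩ := hdiv (16 * 10 ^ 6 * (10 ^ 6 * C1 * (Cv * M) + 2 / T) * (10 ^ 5 * M / Ib) ^ 12 / Ib); have hc := D.c0 N; have hρ := D.ρ0 N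
  obtain ⟨n1, n2, n3, n4, n5, n6, n7, n8⟩ := core_num (S := ∑ j ∈ Finset.range N, c j) hC1 hU H.T0 hM
    hI D.I1 hc (D.c1 N) rfl rfl rfl (by
      refine le_trans (le_of_eq ?_) hN
      field_simp)
  set Λ := 10 ^ 5 * M / (c N * Ib) with hΛ; have hSN : ∑ j ∈ Finset.range N, c j ≤ N := by
    calc _ ≤ ∑ j ∈ Finset.range N, (1:ℝ) := Finset.sum_le_sum fun j _ => D.c1 j
      _ = N := by simp
  have hfl := flow H _ n2 n3 n4
  have nxt : 12 * Λ * ρ (N + 1) ≤ ρ N := by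
    refine le_trans ?_ (D.gap N)
    have := D.ρ0 (N + 1)
    have hNN : (0:ℝ) ≤ N := Nat.cast_nonneg N
    exact mlr (by linarith : 12 * Λ ≤ 4 * ((N:ℝ)+1)) this.le
  have fin := core D H n2 n3 hfl n1 n5 nxt n6 n7
  have e : 27648 * M * ρ N ^ 2 / Λ = 27648 / 10 ^ 5 * (c N * ρ N ^ 2 * Ib) := by
    rw [hΛ]; field_simp
  rw [e] at fin; have : 0 < c N * ρ N ^ 2 * Ib := by positivity
  linarith

lemma seq_ex : ∃ g : ℕ → ℝ, (∀ j, 0 < g j) ∧ (∀ j, g j ≤ 1) ∧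
    (∀ Q : ℝ, ∃ N : ℕ, Q * ((g N) ^ 12)⁻¹ ≤ ∑ j ∈ Finset.range N, g j) ∧
    ∀ q : ℝ, 1 < q → Summable fun j => (g j) ^ q := by
  have ht := tendsto_sum_range_one_div_nat_succ_atTop
  obtain ⟨J, hJ, hJ2⟩ := extraction_forall_of_eventually (P := fun n k => ((n:ℝ) + 1) ^ 13 ≤ ∑ i ∈ Finset.range k, (1 / (i + 1) : ℝ))
    fun n => ht.eventually_ge_atTop _
  set d : ℕ → ℝ := Function.extend J (fun i : ℕ => 1 / ((i:ℝ) + 1)) 0 with hd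
  have dJ (i : ℕ) : d (J i) = 1 / ((i:ℝ) + 1) := hJ.injective.extend_apply _ _ _
  have dn (j : ℕ) (h : ¬ ∃ i, J i = j) : d j = 0 := Function.extend_apply' _ _ _ h
  have p1 (i : ℕ) : 0 < 1 / ((i:ℝ) + 1) := by positivity
  have p2 (i : ℕ) : 1 / ((i:ℝ) + 1) ≤ 1 := by
    rw [div_le_one (by positivity)]; linarith [Nat.cast_nonneg (α := ℝ) i]
  have d0 (j : ℕ) : 0 ≤ d j := by
    by_cases h : ∃ i, J i = j
    · obtain ⟨i, rfl⟩ := h; rw [dJ]; exact (p1 i).le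
    · rw [dn j h]
  have d1 (j : ℕ) : d j ≤ 1 := by
    by_cases h : ∃ i, J i = j
    · obtain ⟨i, rfl⟩ := h; rw [dJ]; exact p2 i
    · rw [dn j h]; norm_num
  refine ⟨fun j => max (1 / ((j:ℝ) + 1)) (d j), fun j => lt_max_of_lt_left (p1 j), fun j => max_le (p2 j) (d1 j), ?_, ?_⟩
  · intro Q; obtain ⟨i, hi⟩ := exists_nat_ge Q; refine ⟨J i, ?_⟩
    have hm : 1 / ((i:ℝ) + 1) ≤ max (1 / ((J i:ℝ) + 1)) (d (J i)) := by rw [← dJ]; exact le_max_right _ _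
    have hip : (0:ℝ) < (i:ℝ) + 1 := by positivity
    calc Q * ((max (1 / ((J i:ℝ) + 1)) (d (J i))) ^ 12)⁻¹ ≤ ((i:ℝ) + 1) * ((1 / ((i:ℝ) + 1)) ^ 12)⁻¹ := by
          have h0 := p1 i
          have h3 : ((max (1 / ((J i:ℝ) + 1)) (d (J i))) ^ 12)⁻¹ ≤ ((1 / ((i:ℝ) + 1)) ^ 12)⁻¹ := by gcongr
          have h4 : 0 ≤ ((max (1 / ((J i:ℝ) + 1)) (d (J i))) ^ 12)⁻¹ := inv_nonneg.2 (pow_nonneg (h0.le.trans hm) _)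
          exact mul_le_mul (by linarith) h3 h4 hip.le
      _ = ((i:ℝ) + 1) ^ 13 := by field_simp
      _ ≤ _ := hJ2 i
      _ ≤ _ := Finset.sum_le_sum fun j _ => le_max_left _ _
  · intro q hq; have s1 : Summable fun j : ℕ => (1 / ((j:ℝ) + 1)) ^ q := by
      have := (summable_nat_add_iff 1).2 (Real.summable_one_div_nat_rpow.2 hq)
      refine this.congr fun j => ?_
      push_cast; rw [Real.div_rpow (by norm_num) (by positivity), Real.one_rpow]
    have s2 : Summable fun j : ℕ => (d j) ^ q := by
      refine (hJ.injective.summable_iff ?_).1 ?_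
      · intro j hj; rw [dn j (fun ⟨i, hi⟩ => hj ⟨i, hi⟩), Real.zero_rpow (by linarith)]
      · refine s1.congr fun j => ?_
        simp [dJ]
    refine Summable.of_nonneg_of_le (fun j => Real.rpow_nonneg (le_max_of_le_right (d0 j)) _) (fun j => ?_) (s1.add s2)
    beta_reduce
    rcases max_cases (1 / ((j:ℝ) + 1)) (d j) with ⟨h, _⟩ | ⟨h, _⟩ <;> rw [h]
    · linarith [Real.rpow_nonneg (d0 j) q]
    · linarith [Real.rpow_nonneg (p1 j).le q]

lemma bump_ex : ∃ b : E3 → ℝ, CD b ∧ (∀ x, 0 ≤ b x) ∧ (∀ x, b x ≤ 1) ∧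
    (∀ x, b x ≠ 0 → x ∈ Bp 1) ∧ 0 < ∫ x, b x ∧ Integrable b ∧ Axisym b := by
  have hc (i : Fin 3) : CD (fun q : E3 => q i) := contDiff_euclidean.1 contDiff_id i
  have ht : CD Real.smoothTransition := Real.smoothTransition.contDiff
  have hr : CD (fun q : E3 => q 0 ^ 2 + q 1 ^ 2) := ((hc 0).pow 2).add ((hc 1).pow 2)
  set b : E3 → ℝ := fun x => (Real.smoothTransition ((x 0 ^ 2 + x 1 ^ 2) - 1) *
    Real.smoothTransition (4 - (x 0 ^ 2 + x 1 ^ 2))) *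
    (Real.smoothTransition (-1 - x 2) * Real.smoothTransition (2 + x 2)) with hb
  have hs : CD b :=
    ((ht.comp (hr.sub contDiff_const)).mul (ht.comp (contDiff_const.sub hr))).mul
      ((ht.comp (contDiff_const.sub (hc 2))).mul (ht.comp (contDiff_const.add (hc 2))))
  have h0 : ∀ x, 0 ≤ b x := fun x => mul_nonneg (mul_nonneg (smoothTransition.nonneg _)
    (smoothTransition.nonneg _)) (mul_nonneg (smoothTransition.nonneg _) (smoothTransition.nonneg _))
  have h1 : ∀ x, b x ≤ 1 := fun x => mul_le_one₀ (mul_le_one₀ (smoothTransition.le_one _)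
    (smoothTransition.nonneg _) (smoothTransition.le_one _)) (mul_nonneg (smoothTransition.nonneg _) (smoothTransition.nonneg _))
    (mul_le_one₀ (smoothTransition.le_one _) (smoothTransition.nonneg _) (smoothTransition.le_one _))
  have hz {t : ℝ} (h : Real.smoothTransition t ≠ 0) : 0 < t := by
    by_contra hh
    exact h (smoothTransition.zero_of_nonpos (not_lt.1 hh))
  have hsup : ∀ x, b x ≠ 0 → x ∈ Bp 1 := by
    intro x hx; simp only [hb, mul_ne_zero_iff, ← rc_sq] at hx; obtain ⟨⟨n1, n2⟩, n3, n4⟩ := hx; have n1 := hz n1; have n2 := hz n2; have n3 := hz n3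
    have n4 := hz n4
    have := rc_nonneg x
    refine ⟨?_, ?_, by linarith, by linarith⟩
    · exact le_of_lt (by nlinarith)
    · exact le_of_lt (by nlinarith)
  have hcs : HasCompactSupport b := by
    apply HasCompactSupport.of_support_subset_isCompact (isCompact_closedBall (0 : E3) 3); intro x hx; simpa using Bp_norm one_pos (hsup x hx)
  refine ⟨b, hs, h0, h1, hsup, ?_, hs.continuous.integrable_of_hasCompactSupport hcs, ?_⟩
  · apply Continuous.integral_pos_of_hasCompactSupport_nonneg_nonzero hs.continuous hcs h0 (x := mk3 (3/2) 0 (-3/2))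
    have hp {t : ℝ} (h : 0 < t) : Real.smoothTransition t ≠ 0 := (smoothTransition.pos_of_pos h).ne'
    simp only [hb, mk3_0, mk3_1, mk3_2]; refine mul_ne_zero (mul_ne_zero (hp ?_) (hp ?_)) (mul_ne_zero (hp ?_) (hp ?_)) <;> norm_num
  · intro x y h1 h2; have e : x 2 = y 2 := h2; simp only [hb, ← rc_sq, h1, e]

def rho (j : ℕ) : ℝ := ((4:ℝ) ^ j * (j.factorial : ℝ))⁻¹

lemma rho_pos (j : ℕ) : 0 < rho j := by
  have := Nat.factorial_pos j
  unfold rho; positivity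

lemma rho_zero : rho 0 = 1 := by simp [rho]

lemma rho_gap (j : ℕ) : 4 * ((j:ℝ) + 1) * rho (j + 1) = rho j := by
  have : (0:ℝ) < j.factorial := by exact_mod_cast Nat.factorial_pos j
  unfold rho; rw [Nat.factorial_succ, pow_succ]
  push_cast; field_simp

lemma rho_gap4 (j : ℕ) : 4 * rho (j + 1) ≤ rho j := by
  have h1 := rho_gap j
  have h2 := mul_nonneg (Nat.cast_nonneg (α := ℝ) j) (rho_pos (j + 1)).le
  linarith

lemma rho_anti : Antitone rho :=
  antitone_nat_of_succ_le fun j => by linarith [rho_gap4 j, rho_pos (j + 1)]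

lemma rho_le_one (j : ℕ) : rho j ≤ 1 := by rw [← rho_zero]; exact rho_anti (Nat.zero_le j)

lemma rho_geom (j : ℕ) : rho j ≤ (1 / 4) ^ j := by
  induction j with
  | zero => simp [rho_zero]
  | succ k ih => rw [pow_succ]; linarith [rho_gap4 k]

lemma rho_lim : Tendsto rho atTop (nhds 0) :=
  squeeze_zero (fun j => (rho_pos j).le) rho_geom
    (tendsto_pow_atTop_nhds_zero_of_lt_one (by norm_num) (by norm_num))

lemma Bp_inj {i j : ℕ} {x : E3} (hi : x ∈ Bp (rho i)) (hj : x ∈ Bp (rho j)) : i = j := by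
  have key : ∀ i j, i < j → x ∈ Bp (rho i) → x ∈ Bp (rho j) → False := by
    rintro i j h ⟨a1, _⟩ ⟨_, b2, _⟩; have := rho_anti (Nat.succ_le_of_lt h); simp only [Nat.succ_eq_add_one] at this; linarith [rho_gap4 i, rho_pos j]
  rcases lt_trichotomy i j with h | h | h
  · exact (key i j h hi hj).elim
  · exact h
  · exact (key j i h hj hi).elim

lemma rc_smul {s : ℝ} (hs : 0 ≤ s) (x : E3) : rc (s • x) = s * rc x := by
  have h : (0:ℝ) ≤ s * rc x := mul_nonneg hs (rc_nonneg x)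
  apply (pow_left_inj₀ (rc_nonneg _) h two_ne_zero).1; rw [rc_sq, mul_pow, rc_sq]; simp; ring

lemma Bp_scale {r : ℝ} (hr : 0 < r) {x : E3} (h : r⁻¹ • x ∈ Bp 1) : x ∈ Bp r := by
  obtain ⟨h1, h2, h3, h4⟩ := h; rw [rc_smul (inv_nonneg.2 hr.le)] at h1 h2; have e : (r⁻¹ • x) 2 = r⁻¹ * x 2 := by simp
  rw [e] at h3 h4; have hx : ∀ t : ℝ, r * (r⁻¹ * t) = t := fun t => by field_simp
  have k1 := mll h1 hr.le
  have k2 := mll h2 hr.le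
  have k3 := mll h3 hr.le
  have k4 := mll h4 hr.le
  rw [mul_neg, hx] at k3 k4; rw [hx] at k1 k2; exact ⟨by linarith, by linarith, by linarith, by linarith⟩

lemma Bp_box {r s : ℝ} (hrs : r ≤ s) {x : E3} (h : x ∈ Bp r) : x ∈ box (2 * s) (2 * s) := by
  obtain ⟨h1, h2, h3, h4⟩ := h; have h0 := rc_nonneg x; have q := rc_sq x; refine ⟨?_, ?_, ?_⟩
  · refine le_trans (abs_le_of_sq_le_sq ?_ h0) (by linarith); nlinarith [sq_nonneg (x 1)]
  · refine le_trans (abs_le_of_sq_le_sq ?_ h0) (by linarith); nlinarith [sq_nonneg (x 0)]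
  · rw [abs_le]; constructor <;> linarith

lemma box_vol' {s : ℝ} (hs : 0 ≤ s) : volume (box (2 * s) (2 * s)) = ENNReal.ofReal (64 * s ^ 3) := by
  rw [box_vol (by positivity) (by positivity)]; congr 1; ring

structure Bmp (b : E3 → ℝ) : Prop where
  sm : CD b
  nn : ∀ x, 0 ≤ b x
  le : ∀ x, b x ≤ 1
  sup : ∀ x, b x ≠ 0 → x ∈ Bp 1
  pos : 0 < ∫ x, b x
  int : Integrable b
  ax : Axisym b

def om (b : E3 → ℝ) (c : ℕ → ℝ) (x : E3) : ℝ := ∑' j, c j * b ((rho j)⁻¹ • x)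

section Ini
variable {b : E3 → ℝ} {c : ℕ → ℝ}

lemma Bmp.z (B : Bmp b) {j : ℕ} {x : E3} (h : x ∉ Bp (rho j)) : b ((rho j)⁻¹ • x) = 0 := by
  by_contra hh
  exact h (Bp_scale (rho_pos j) (B.sup _ hh))

lemma om_on (B : Bmp b) {j : ℕ} {x : E3} (h : x ∈ Bp (rho j)) : om b c x = c j * b ((rho j)⁻¹ • x) := by
  unfold om; apply tsum_eq_single; intro i hi; rw [B.z (fun h' => hi (Bp_inj h' h)), mul_zero]

lemma om_off (B : Bmp b) {x : E3} (h : ∀ j, x ∉ Bp (rho j)) : om b c x = 0 := by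
  unfold om; rw [← tsum_zero (α := ℝ) (β := ℕ)]; congr 1; funext j; rw [B.z (h j), mul_zero]

lemma om_sup (B : Bmp b) {x : E3} (h : om b c x ≠ 0) : ∃ j, x ∈ Bp (rho j) := by
  by_contra hh
  push Not at hh; exact h (om_off B hh)

lemma om_nn (B : Bmp b) (c0 : ∀ j, 0 < c j) (x : E3) : 0 ≤ om b c x :=
  tsum_nonneg fun j => mul_nonneg (c0 j).le (B.nn _)

lemma om_le (B : Bmp b) (c0 : ∀ j, 0 < c j) {j : ℕ} {x : E3} (h : x ∈ Bp (rho j)) : om b c x ≤ c j := by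
  rw [om_on B h]; exact mul_le_of_le_one_right (c0 j).le (B.le _)

lemma om_ax (B : Bmp b) : Axisym (om b c) := by
  intro x y h1 h2; unfold om; congr 1; funext j; rw [B.ax _ ((rho j)⁻¹ • y)]
  · rw [rc_smul (inv_nonneg.2 (rho_pos j).le), rc_smul (inv_nonneg.2 (rho_pos j).le), h1]
  · have e : x 2 = y 2 := h2
    simp [zc, e]

lemma om_cs (B : Bmp b) : HasCompactSupport (om b c) := by
  apply HasCompactSupport.of_support_subset_isCompact (isCompact_closedBall (0 : E3) 3); intro x hx; obtain ⟨j, hj⟩ := om_sup B hx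
  have := Bp_norm (rho_pos j) hj
  simp only [Metric.mem_closedBall, dist_zero_right]; linarith [rho_le_one j]

lemma om_sm (B : Bmp b) : ContDiffOn ℝ (⊤ : ℕ∞) (om b c) ({(0 : E3)}ᶜ) := by
  intro x hx; have hx0 : 0 < ‖x‖ := norm_pos_iff.2 hx; obtain ⟨N, hN⟩ := (rho_lim.eventually (gt_mem_nhds (show (0:ℝ) < ‖x‖ / 6 by positivity))).exists
  have hev : ∀ᶠ y in nhds x, ‖x‖ / 2 < ‖y‖ :=
    continuous_norm.continuousAt.eventually (lt_mem_nhds (by linarith))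
  apply ContDiffAt.contDiffWithinAt; have hs : CD (fun y : E3 => ∑ j ∈ Finset.range N, c j * b ((rho j)⁻¹ • y)) :=
    ContDiff.sum fun j _ => contDiff_const.mul (B.sm.comp (contDiff_const_smul _))
  refine hs.contDiffAt.congr_of_eventuallyEq ?_
  filter_upwards [hev] with y hy
  unfold om; apply tsum_eq_sum; intro j hj; have hj : N ≤ j := by simpa using hj
  rw [B.z, mul_zero]; intro hh; have := Bp_norm (rho_pos j) hh; linarith [rho_anti hj]

lemma f0_meas (B : Bmp b) : AEStronglyMeasurable (om b c) (volume : Measure E3) := by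
  have h := (om_sm (c := c) B).continuousOn.aestronglyMeasurable (μ := volume) (measurableSet_singleton (0:E3)).compl
  rwa [Measure.restrict_eq_self_of_ae_mem] at h
  exact compl_mem_ae_iff.2 (measure_singleton _)

lemma f0_int (B : Bmp b) (c0 : ∀ j, 0 < c j) (c1 : ∀ j, c j ≤ 1) :
    Integrable (fun x => om b c x / rc x) := by
  refine ⟨((f0_meas B).aemeasurable.div rc_cont.measurable.aemeasurable).aestronglyMeasurable, ?_⟩
  have hpt : ∀ x, ‖om b c x / rc x‖ₑ ≤ ∑' j, (Bp (rho j)).indicator (fun _ => ENNReal.ofReal ((rho j)⁻¹)) x := by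
    intro x
    by_cases h : ∃ j, x ∈ Bp (rho j)
    · obtain ⟨j, hj⟩ := h; refine le_trans ?_ (ENNReal.le_tsum j); rw [indicator_of_mem hj, Real.enorm_eq_ofReal (div_nonneg (om_nn B c0 x) (rc_nonneg x))]
      apply ENNReal.ofReal_le_ofReal; rw [← one_div]; exact div_le_div₀ zero_le_one ((om_le B c0 hj).trans (c1 j)) (rho_pos j) hj.1
    · push Not at h; simp [om_off B h]
  refine lt_of_le_of_lt (lintegral_mono hpt) ?_
  rw [lintegral_tsum fun j => (measurable_const.indicator (Bp_meas _)).aemeasurable]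
  have hs : Summable fun j : ℕ => 64 * (1 / 4 : ℝ) ^ j :=
    (summable_geometric_of_lt_one (by norm_num) (by norm_num)).mul_left _
  refine lt_of_le_of_lt (ENNReal.tsum_le_tsum fun j => ?_) (b := ∑' j : ℕ, ENNReal.ofReal (64 * (1 / 4 : ℝ) ^ j)) ?_
  · rw [lintegral_indicator_const (Bp_meas _)]; have hv : volume (Bp (rho j)) ≤ ENNReal.ofReal (64 * rho j ^ 3) := by
      rw [← box_vol' (rho_pos j).le]; exact measure_mono fun x hx => Bp_box le_rfl hx
    refine (mul_le_mul_right hv _).trans ?_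
    rw [← ENNReal.ofReal_mul (inv_nonneg.2 (rho_pos j).le)]; apply ENNReal.ofReal_le_ofReal; have hp := rho_pos j
    have e : (rho j)⁻¹ * (64 * rho j ^ 3) = 64 * (rho j * rho j) := by field_simp
    rw [e]; have := mul_le_mul (rho_le_one j) (rho_geom j) hp.le zero_le_one; linarith
  · rw [← ENNReal.ofReal_tsum_of_nonneg (fun j => by positivity) hs]
    exact ENNReal.ofReal_lt_top

lemma om_dat (B : Bmp b) (c0 : ∀ j, 0 < c j) (c1 : ∀ j, c j ≤ 1) :
    Dat c rho (min 1 ((∫ x, b x) / 2)) (fun x => om b c x / rc x) where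
  ρ0 := rho_pos
  ρ1 := rho_zero.le
  gap j := (rho_gap j).le
  c0 := c0
  c1 := c1
  I0 := lt_min one_pos (by linarith [B.pos])
  I1 := min_le_left _ _
  f00 y := div_nonneg (om_nn B c0 y) (rc_nonneg y)
  fi := f0_int B c0 c1
  fs y hy := om_sup (c := c) B (fun h => hy (by simp [h]))
  mass j := by
    have hp := rho_pos j
    have e1 : ∫ y, b ((rho j)⁻¹ • y) = rho j ^ 3 * ∫ x, b x := by
      rw [Measure.integral_comp_inv_smul]; simp [abs_of_pos hp]
    have hbi : Integrable fun y => b ((rho j)⁻¹ • y) := B.int.comp_smul (inv_ne_zero hp.ne')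
    have e2 : ∫ y in Bp (rho j), b ((rho j)⁻¹ • y) = ∫ y, b ((rho j)⁻¹ • y) :=
      setIntegral_eq_integral_of_forall_compl_eq_zero fun y hy => B.z hy
    have e3 : ∫ y in Bp (rho j), (c j / (2 * rho j)) * b ((rho j)⁻¹ • y) = c j * rho j ^ 2 * ((∫ x, b x) / 2) := by
      rw [integral_const_mul, e2, e1]; field_simp
    calc c j * rho j ^ 2 * min 1 ((∫ x, b x) / 2) ≤ c j * rho j ^ 2 * ((∫ x, b x) / 2) :=
          mll (min_le_right _ _) (mul_nonneg (c0 j).le (sq_nonneg _))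
      _ = _ := e3.symm
      _ ≤ _ := by
        apply setIntegral_mono_on (hbi.const_mul _).integrableOn (f0_int B c0 c1).integrableOn (Bp_meas _); intro y hy
        rw [om_on B hy, div_mul_eq_mul_div]; exact div_le_div_of_nonneg_left (mul_nonneg (c0 j).le (B.nn _)) (hp.trans_le hy.1) hy.2.1

end Ini

lemma om_lor {b : E3 → ℝ} {c : ℕ → ℝ} (B : Bmp b) (c0 : ∀ j, 0 < c j) {q : ℝ} (hq : 1 < q) :
    lorentz3q q (fun x => om b c x / rc x) ≤
      (3 * ∑' j, ENNReal.ofReal (64 ^ (q / 3) * c j ^ q)) ^ (1 / q) := by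
  unfold lorentz3q; have hq0 : 0 < q := by linarith
  refine ENNReal.rpow_le_rpow (mul_le_mul_right ?_ _) (by positivity)
  have hfl : ∀ j x, x ∈ Bp (rho j) → |om b c x / rc x| ≤ c j / rho j := by
    intro j x hx; rw [abs_of_nonneg (div_nonneg (om_nn B c0 x) (rc_nonneg x))]; exact div_le_div₀ (c0 j).le (om_le B c0 hx) (rho_pos j) hx.1
  have hex : ∀ l : ℝ, 0 < l → ∀ x, l < |om b c x / rc x| → ∃ j, x ∈ Bp (rho j) ∧ l < c j / rho j := by
    intro l hl x hx; obtain ⟨j, hj⟩ := om_sup (c := c) B (x := x) (fun h => by simp [h] at hx; linarith)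
    exact ⟨j, hj, hx.trans_le (hfl j x hj)⟩
  have hvol : ∀ l : ℝ, 0 < l → (volume {x : E3 | l < |om b c x / rc x|}) ^ (q / 3) ≤
      ∑' j, (Iio (c j / rho j)).indicator (fun _ => ENNReal.ofReal (64 ^ (q / 3) * rho j ^ q)) l := by
    classical
    intro l hl
    by_cases h : ∃ j, l < c j / rho j
    · set j := Nat.find h with hj; have hj1 : l < c j / rho j := Nat.find_spec h; refine le_trans ?_ (ENNReal.le_tsum j)
      rw [indicator_of_mem (show l ∈ Iio (c j / rho j) from hj1)]
      have hv : volume {x : E3 | l < |om b c x / rc x|} ≤ ENNReal.ofReal (64 * rho j ^ 3) := by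
        rw [← box_vol' (rho_pos j).le]; refine measure_mono fun x hx => ?_
        obtain ⟨i, hi, hi2⟩ := hex l hl x hx; exact Bp_box (rho_anti (Nat.find_min' h hi2)) hi
      refine (ENNReal.rpow_le_rpow hv (by positivity)).trans ?_
      have hp := rho_pos j
      rw [ENNReal.ofReal_rpow_of_nonneg (by positivity) (by positivity)]
      apply le_of_eq; congr 1; rw [Real.mul_rpow (by norm_num) (by positivity), ← Real.rpow_natCast, ← Real.rpow_mul hp.le]
      congr 2
      push_cast; ring
    · have : {x : E3 | l < |om b c x / rc x|} = ∅ := by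
        ext x; simp only [mem_ofPred_eq, mem_empty_iff_false, iff_false]; intro hx; obtain ⟨i, _, hi2⟩ := hex l hl x hx; exact h ⟨i, hi2⟩
      rw [this, measure_empty, ENNReal.zero_rpow_of_pos (by positivity)]
      exact bot_le
  calc _ ≤ ∫⁻ l in Ioi (0:ℝ), ∑' j, (Iio (c j / rho j)).indicator
        (fun _ => ENNReal.ofReal ((c j / rho j) ^ (q - 1) * (64 ^ (q / 3) * rho j ^ q))) l := by
        refine setLIntegral_mono' measurableSet_Ioi fun l hl => ?_
        refine (mul_le_mul_right (hvol l hl) _).trans ?_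
        rw [← ENNReal.tsum_mul_left]; refine ENNReal.tsum_le_tsum fun j => ?_
        by_cases hlj : l ∈ Iio (c j / rho j)
        · have hp := rho_pos j
          have hl0 : 0 < l := hl
          have hlj' : l < c j / rho j := hlj
          rw [indicator_of_mem hlj, indicator_of_mem hlj, ← ENNReal.ofReal_mul (Real.rpow_nonneg hl0.le _)]; apply ENNReal.ofReal_le_ofReal
          apply mlr _ (by positivity)
          exact Real.rpow_le_rpow hl0.le hlj'.le (by linarith)
        · rw [indicator_of_notMem hlj, indicator_of_notMem hlj, mul_zero]
    _ = ∑' j, ∫⁻ l in Ioi (0:ℝ), (Iio (c j / rho j)).indicator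
        (fun _ => ENNReal.ofReal ((c j / rho j) ^ (q - 1) * (64 ^ (q / 3) * rho j ^ q))) l :=
        lintegral_tsum fun j => (measurable_const.indicator measurableSet_Iio).aemeasurable
    _ ≤ _ := by
        refine ENNReal.tsum_le_tsum fun j => ?_
        have hp := rho_pos j
        have hc := c0 j
        have ha : 0 < c j / rho j := by positivity
        rw [lintegral_indicator_const measurableSet_Iio, Measure.restrict_apply measurableSet_Iio, inter_comm, Ioi_inter_Iio,
          Real.volume_Ioo, sub_zero, ← ENNReal.ofReal_mul (by positivity)]
        apply le_of_eq; congr 1; have e : (c j / rho j) ^ (q - 1) = (c j / rho j) ^ q / (c j / rho j) := by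
          rw [Real.rpow_sub_one ha.ne']
        rw [e, Real.div_rpow hc.le hp.le]; have : 0 < rho j ^ q := Real.rpow_pos_of_pos hp q; field_simp

/-- non-existence of Yudovich-type weak solutions.  For every `ε̃ > 0`
and `q > 1` there is an axisymmetric `ω₀ ∈ C^∞(ℝ³ \ {0})` with compact support and
`‖ω₀‖_∞ + ‖ω₀‖_1 + ‖ω₀/r‖_{L^{3,q}} ≤ ε̃`, such that for every `T > 0` there is no
Yudovich-type weak solution of the axisymmetric relative-vorticity equation on `(0,T)`
with initial data `ω₀`. -/
theorem nonexistence_of_yudovich_solutions :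
    ∀ εt : ℝ, 0 < εt → ∀ q : ℝ, 1 < q →
      ∃ ω₀ : E3 → ℝ,
        ContDiffOn ℝ (⊤ : ℕ∞) ω₀ ({(0 : E3)}ᶜ) ∧ HasCompactSupport ω₀ ∧ Axisym ω₀ ∧
        eLpNorm ω₀ ∞ volume + eLpNorm ω₀ 1 volume +
            lorentz3q q (fun x => ω₀ x / rc x) ≤ ENNReal.ofReal εt ∧
        ∀ T : ℝ, 0 < T →
          ¬ ∃ (u : E3 → ℝ → E3) (ω : E3 → ℝ → ℝ), IsYudovichSolution T ω₀ u ω := by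
  intro εt hε q hq; obtain ⟨b, b1, b2, b3, b4, b5, b6, b7⟩ := bump_ex; have B : Bmp b := ⟨b1, b2, b3, b4, b5, b6, b7⟩; obtain ⟨g, g0, g1, g2, g3⟩ := seq_ex
  have hgs := g3 q hq
  have hq0 : 0 < q := by linarith
  set S := ∑' j, g j ^ q with hS; have hS0 : 0 ≤ S := tsum_nonneg fun j => Real.rpow_nonneg (g0 j).le _
  set K : ℝ := (3 * (64 ^ (q / 3) * S)) ^ (1 / q) with hK; have hK0 : 0 ≤ K := by positivity
  obtain ⟨e, he0, he1, heε⟩ : ∃ e : ℝ, 0 < e ∧ e ≤ 1 ∧ e * (65 + K) ≤ εt := by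
    refine ⟨min 1 (εt / (65 + K)), lt_min one_pos (by positivity), min_le_left _ _, ?_⟩
    calc _ ≤ εt / (65 + K) * (65 + K) := mlr (min_le_right _ _) (by positivity)
      _ = εt := by field_simp
  set c : ℕ → ℝ := fun j => e * g j with hc
  have c0 (j) : 0 < c j := mul_pos he0 (g0 j)
  have ce (j) : c j ≤ e := mul_le_of_le_one_right he0.le (g1 j)
  have c1 (j) : c j ≤ 1 := (ce j).trans he1
  have hbd (x : E3) : ‖om b c x‖ ≤ e := by
    rw [Real.norm_of_nonneg (om_nn B c0 x)]
    by_cases h : ∃ j, x ∈ Bp (rho j)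
    · obtain ⟨j, hj⟩ := h; exact (om_le B c0 hj).trans (ce j)
    · push Not at h; rw [om_off B h]; exact he0.le
  refine ⟨om b c, om_sm B, om_cs B, om_ax B, ?_, ?_⟩
  · have n1 : eLpNorm (om b c) ∞ volume ≤ ENNReal.ofReal e := by
      rw [eLpNorm_exponent_top]; exact eLpNormEssSup_le_of_ae_bound (ae_of_all _ hbd)
    have n2 : eLpNorm (om b c) 1 volume ≤ ENNReal.ofReal (e * 64) := by
      have hm : MeasurableSet (box (2 * 1) (2 * 1)) := by
        have k (i : Fin 3) : Continuous fun x : E3 => |x i| := by fun_prop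
        exact ((isClosed_le (k 0) continuous_const).inter ((isClosed_le (k 1) continuous_const).inter
          (isClosed_le (k 2) continuous_const))).measurableSet
      rw [eLpNorm_one_eq_lintegral_enorm]
      calc _ ≤ ∫⁻ x, (box (2 * 1) (2 * 1)).indicator (fun _ => ENNReal.ofReal e) x := by
            refine lintegral_mono fun x => ?_
            by_cases h : ∃ j, x ∈ Bp (rho j)
            · obtain ⟨j, hj⟩ := h; rw [indicator_of_mem (Bp_box (rho_le_one j) hj), ← ofReal_norm]; exact ENNReal.ofReal_le_ofReal (hbd x)
            · push Not at h; simp [om_off B h]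
        _ = _ := by
            rw [lintegral_indicator_const hm, box_vol' zero_le_one, ← ENNReal.ofReal_mul he0.le]; norm_num
    have n3 : lorentz3q q (fun x => om b c x / rc x) ≤ ENNReal.ofReal (e * K) := by
      refine (om_lor B c0 hq).trans (le_of_eq ?_)
      have hcq (j) : c j ^ q = e ^ q * g j ^ q := Real.mul_rpow he0.le (g0 j).le
      have hs : Summable fun j => 64 ^ (q / 3) * c j ^ q := by
        simp only [hcq]; exact (hgs.mul_left _).mul_left _
      have hnn : ∀ j, 0 ≤ 64 ^ (q / 3) * c j ^ q := fun j =>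
        mul_nonneg (Real.rpow_nonneg (by norm_num) _) (Real.rpow_nonneg (c0 j).le _)
      rw [← ENNReal.ofReal_tsum_of_nonneg hnn hs]; have h3 : (3 : ℝ≥0∞) = ENNReal.ofReal 3 := by norm_num
      rw [h3, ← ENNReal.ofReal_mul (by norm_num), ENNReal.ofReal_rpow_of_nonneg
        (mul_nonneg (by norm_num) (tsum_nonneg hnn)) (by positivity)]
      congr 1
      have : 3 * ∑' j, 64 ^ (q / 3) * c j ^ q = e ^ q * (3 * (64 ^ (q / 3) * S)) := by
        simp only [hcq, tsum_mul_left]; rw [← hS]; ring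
      rw [this, Real.mul_rpow (Real.rpow_nonneg he0.le _) (by positivity), ← Real.rpow_mul he0.le,
        mul_one_div_cancel hq0.ne', Real.rpow_one]
    refine (add_le_add (add_le_add n1 n2) n3).trans ?_
    rw [← ENNReal.ofReal_add (by positivity) (by positivity), ← ENNReal.ofReal_add (by positivity) (by positivity)]
    apply ENNReal.ofReal_le_ofReal; linarith
  · rintro T hT ⟨u, ω, h⟩; obtain ⟨M, f, u', H⟩ := FL.of_sol hT (f0_int B c0 c1) h; refine noFL (om_dat B c0 c1) ?_ H; intro Q
    obtain ⟨N, hN⟩ := g2 (Q * (e ^ 13)⁻¹); refine ⟨N, ?_⟩; have := mll hN he0.le; simp only [hc, ← Finset.mul_sum]; refine le_trans (le_of_eq ?_) this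
    have := g0 N
    field_simp
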